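/- Let n ≥ 2 and let Ω ⊂ ℝⁿ be a bounded set of finite perimeter. Then H^{n−1}(∂Ω ∩ Ω¹) = 0 if and only if there exists a sequence of bounded open sets E_k with smooth boundary such that E_k ⋐ Ω for every k, E_k → Ω in L¹, and P(E_k) → P(Ω) as k → ∞. -/

import Mathlib

open MeasureTheory Metric Filter Set
open scoped ENNReal Topology NNReal

noncomputable section

/-- The divergence of a vector field `φ : ℝⁿ → ℝⁿ`. -/
def vdiv {n : ℕ} (φ : EuclideanSpace ℝ (Fin n) → EuclideanSpace ℝ (Fin n))
    (x : EuclideanSpace ℝ (Fin n)) : ℝ :=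
  ∑ i, fderiv ℝ φ x (EuclideanSpace.single i 1) i

/-- The relative perimeter `P(E; W)` of a set `E` in an open set `W`, defined variationally as
`sup { ∫_E div φ : φ ∈ C¹_c(W; ℝⁿ), ‖φ‖_∞ ≤ 1 }`. -/
def relPerimeter {n : ℕ} (E W : Set (EuclideanSpace ℝ (Fin n))) : ℝ≥0∞ :=
  ⨆ (φ : EuclideanSpace ℝ (Fin n) → EuclideanSpace ℝ (Fin n)) (_ : ContDiff ℝ 1 φ)
    (_ : HasCompactSupport φ) (_ : tsupport φ ⊆ W) (_ : ∀ x, ‖φ x‖ ≤ 1),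
    ENNReal.ofReal (∫ x in E, vdiv φ x)

/-- The perimeter `P(E)` of a set `E ⊆ ℝⁿ`:
`P(E) = sup { ∫_E div φ : φ ∈ C¹_c(ℝⁿ; ℝⁿ), ‖φ‖_∞ ≤ 1 }`. -/
def perimeter {n : ℕ} (E : Set (EuclideanSpace ℝ (Fin n))) : ℝ≥0∞ :=
  relPerimeter E Set.univ

/-- The set of points where `Ω` has Lebesgue density `α`; `densityPts Ω 1` is the
measure-theoretic interior `Ω¹` and `densityPts Ω 0` is the measure-theoretic exterior `Ω⁰`. -/
def densityPts {n : ℕ} (Ω : Set (EuclideanSpace ℝ (Fin n))) (α : ℝ≥0∞) :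
    Set (EuclideanSpace ℝ (Fin n)) :=
  {x | Tendsto (fun r : ℝ => volume (Ω ∩ ball x r) / volume (ball x r)) (𝓝[>] 0) (𝓝 α)}

/-- A smooth set: a bounded open set whose topological boundary is a smooth hypersurface,
expressed via a smooth defining function with nonvanishing differential on the boundary. -/
def IsSmoothSet {n : ℕ} (E : Set (EuclideanSpace ℝ (Fin n))) : Prop :=
  IsOpen E ∧ Bornology.IsBounded E ∧
  ∃ f : EuclideanSpace ℝ (Fin n) → ℝ, ContDiff ℝ (⊤ : ℕ∞) f ∧
    E = {x | f x < 0} ∧ frontier E = {x | f x = 0} ∧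
    ∀ x ∈ frontier E, fderiv ℝ f x ≠ 0

/-- `E ⋐ Ω` : the closure of `E` is compact and contained in `Ω`. -/
def CpctContained {n : ℕ} (E Ω : Set (EuclideanSpace ℝ (Fin n))) : Prop :=
  IsCompact (closure E) ∧ closure E ⊆ Ω

/-- `E_k → Ω` in `L¹`, i.e. `|E_k Δ Ω| → 0`. -/
def TendstoL1 {n : ℕ} (E : ℕ → Set (EuclideanSpace ℝ (Fin n)))
    (Ω : Set (EuclideanSpace ℝ (Fin n))) : Prop :=
  Tendsto (fun k => volume ((E k \ Ω) ∪ (Ω \ E k))) atTop (𝓝 0)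

/-- The volume `ω_n` of the unit ball in ℝⁿ. -/
def unitBallVol (n : ℕ) : ℝ≥0∞ := volume (ball (0 : EuclideanSpace ℝ (Fin n)) 1)

section
open MeasureTheory Metric Filter Set
open scoped ENNReal Topology NNReal

noncomputable section

abbrev ES (n : ℕ) := EuclideanSpace ℝ (Fin n)

/-- admissible fields -/
structure Adm {n : ℕ} (φ : ES n → ES n) : Prop where
  cd : ContDiff ℝ 1 φ
  cs : HasCompactSupport φ
  le : ∀ x, ‖φ x‖ ≤ 1

lemma vdiv_continuous {n : ℕ} {φ : ES n → ES n} (h : ContDiff ℝ 1 φ) : Continuous (vdiv φ) := by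
  unfold vdiv
  have := h.continuous_fderiv one_ne_zero
  fun_prop

lemma vdiv_hasCompactSupport {n : ℕ} {φ : ES n → ES n} (h : HasCompactSupport φ) :
    HasCompactSupport (vdiv φ) := by
  refine (h.fderiv (𝕜 := ℝ)).mono ?_
  intro x hx
  contrapose! hx
  simp only [Function.mem_support, not_not] at hx ⊢
  simp [vdiv, hx]

lemma vdiv_smul {n : ℕ} {f : ES n → ℝ} {φ : ES n → ES n} {x : ES n}
    (hf : DifferentiableAt ℝ f x) (hφ : DifferentiableAt ℝ φ x) :
    vdiv (fun y => f y • φ y) x = f x * vdiv φ x + fderiv ℝ f x (φ x) := by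
  unfold vdiv
  rw [fderiv_fun_smul hf hφ]
  simp only [add_apply, smul_apply,
    ContinuousLinearMap.smulRight_apply, PiLp.add_apply, PiLp.smul_apply, smul_eq_mul,
    Finset.sum_add_distrib, Finset.mul_sum]
  congr 1
  conv_rhs => rw [← (EuclideanSpace.basisFun (Fin n) ℝ).sum_repr (φ x)]
  simp [map_sum, mul_comm]

lemma vdiv_single {n : ℕ} {f : ES n → ℝ} {x : ES n} (i : Fin n)
    (hf : DifferentiableAt ℝ f x) :
    vdiv (fun y => f y • (EuclideanSpace.single i (1:ℝ) : ES n)) x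
      = fderiv ℝ f x (EuclideanSpace.single i 1) := by
  rw [vdiv_smul hf (differentiableAt_const _)]
  simp [vdiv]

lemma fderiv_comp_apply {n : ℕ} {φ : ES n → ES n} {x : ES n} (hφ : DifferentiableAt ℝ φ x)
    (i : Fin n) (v : ES n) : fderiv ℝ (fun y => φ y i) x v = (fderiv ℝ φ x v) i := by
  have h : HasFDerivAt (fun y => φ y i)
      ((EuclideanSpace.proj i : ES n →L[ℝ] ℝ).comp (fderiv ℝ φ x)) x :=
    (EuclideanSpace.proj i : ES n →L[ℝ] ℝ).hasFDerivAt.comp x hφ.hasFDerivAt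
  rw [h.fderiv]; rfl

lemma vdiv_eq_sum {n : ℕ} {φ : ES n → ES n} {x : ES n} (hφ : DifferentiableAt ℝ φ x) :
    vdiv φ x = ∑ i, fderiv ℝ (fun y => φ y i) x (EuclideanSpace.single i 1) := by
  unfold vdiv
  simp only [fderiv_comp_apply hφ]

lemma integral_fderiv_zero {n : ℕ} {f : ES n → ℝ} (hf : ContDiff ℝ 1 f)
    (hc : HasCompactSupport f) (v : ES n) : ∫ x, fderiv ℝ f x v = 0 := by
  have h1 : Continuous fun x => fderiv ℝ f x v := by
    have := hf.continuous_fderiv one_ne_zero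
    fun_prop
  have h2 : HasCompactSupport fun x => fderiv ℝ f x v := hc.fderiv_apply (𝕜 := ℝ) v
  have := integral_mul_fderiv_eq_neg_fderiv_mul_of_integrable (μ := (volume : Measure (ES n)))
    (f := fun _ => (1:ℝ)) (g := f) (v := v) (by simp)
    (by simpa using h1.integrable_of_hasCompactSupport h2)
    (by simpa using hf.continuous.integrable_of_hasCompactSupport hc)
    (fun x _ => differentiableAt_const _) (fun x _ => hf.differentiable one_ne_zero x)
  simpa using this

lemma integral_vdiv_zero {n : ℕ} {φ : ES n → ES n} (h : ContDiff ℝ 1 φ)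
    (hc : HasCompactSupport φ) : ∫ x, vdiv φ x = 0 := by
  have hd : ∀ x, vdiv φ x = ∑ i, fderiv ℝ (fun y => φ y i) x (EuclideanSpace.single i 1) :=
    fun x => vdiv_eq_sum (h.differentiable one_ne_zero x)
  have hcd : ∀ i, ContDiff ℝ 1 (fun y => φ y i) := fun i =>
    (EuclideanSpace.proj i : ES n →L[ℝ] ℝ).contDiff.comp h
  have hcs : ∀ i, HasCompactSupport (fun y => φ y i) := fun i =>
    hc.comp_left (g := fun v : ES n => v i) rfl
  simp_rw [hd]
  rw [integral_finsetSum]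
  · exact Finset.sum_eq_zero fun i _ => integral_fderiv_zero (hcd i) (hcs i) _
  · intro i _
    have h1 : Continuous fun x => fderiv ℝ (fun y => φ y i) x (EuclideanSpace.single i 1) := by
      have := (hcd i).continuous_fderiv one_ne_zero
      fun_prop
    exact h1.integrable_of_hasCompactSupport ((hcs i).fderiv_apply (𝕜 := ℝ) _)

lemma vdiv_integrable {n : ℕ} {φ : ES n → ES n} (h : ContDiff ℝ 1 φ)
    (hc : HasCompactSupport φ) : Integrable (vdiv φ) :=
  (vdiv_continuous h).integrable_of_hasCompactSupport (vdiv_hasCompactSupport hc)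

lemma fderiv_app_continuous {n : ℕ} {f : ES n → ℝ} {φ : ES n → ES n} (hf : ContDiff ℝ 1 f)
    (h : ContDiff ℝ 1 φ) : Continuous (fun x => fderiv ℝ f x (φ x)) :=
  (hf.continuous_fderiv one_ne_zero).clm_apply h.continuous

lemma fderiv_app_cs {n : ℕ} {f : ES n → ℝ} {φ : ES n → ES n}
    (hc : HasCompactSupport φ) : HasCompactSupport (fun x => fderiv ℝ f x (φ x)) := by
  refine hc.mono ?_
  intro x hx
  contrapose! hx
  simp only [Function.mem_support, not_not] at hx ⊢
  simp [hx]

lemma smul_cs {n : ℕ} {f : ES n → ℝ} {φ : ES n → ES n}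
    (hc : HasCompactSupport φ) : HasCompactSupport (fun x => f x • φ x) := by
  refine hc.mono ?_
  intro x hx
  contrapose! hx
  simp only [Function.mem_support, not_not] at hx ⊢
  simp [hx]

lemma ibp {n : ℕ} {f : ES n → ℝ} {φ : ES n → ES n} (hf : ContDiff ℝ 1 f)
    (h : ContDiff ℝ 1 φ) (hc : HasCompactSupport φ) :
    ∫ x, f x * vdiv φ x = - ∫ x, fderiv ℝ f x (φ x) := by
  have h0 := integral_vdiv_zero (φ := fun y => f y • φ y) (hf.smul h) (smul_cs hc)
  have h1 : ∀ x, vdiv (fun y => f y • φ y) x = f x * vdiv φ x + fderiv ℝ f x (φ x) :=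
    fun x => vdiv_smul (hf.differentiable one_ne_zero x) (h.differentiable one_ne_zero x)
  simp_rw [h1] at h0
  rw [integral_add] at h0
  · linarith
  · exact (hf.continuous.mul (vdiv_continuous h)).integrable_of_hasCompactSupport
      (vdiv_hasCompactSupport hc).mul_left
  · exact (fderiv_app_continuous hf h).integrable_of_hasCompactSupport (fderiv_app_cs hc)

lemma Adm.le_per {n : ℕ} {φ : ES n → ES n} (h : Adm φ) {Ω : Set (ES n)}
    (hP : perimeter Ω ≠ ⊤) : ∫ x in Ω, vdiv φ x ≤ (perimeter Ω).toReal := by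
  have : ENNReal.ofReal (∫ x in Ω, vdiv φ x) ≤ perimeter Ω := by
    unfold perimeter relPerimeter
    exact le_iSup_of_le φ (le_iSup_of_le h.cd (le_iSup_of_le h.cs
      (le_iSup_of_le (subset_univ _) (le_iSup_of_le h.le le_rfl))))
  have h2 := ENNReal.toReal_mono hP this
  rw [ENNReal.toReal_ofReal'] at h2
  exact (le_max_left _ _).trans h2

lemma exists_adm {n : ℕ} (Ω : Set (ES n)) {κ : ℝ} (hκ : 0 < κ) :
    ∃ φ : ES n → ES n, Adm φ ∧ (perimeter Ω).toReal - κ < ∫ x in Ω, vdiv φ x := by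
  by_contra! hcon
  have h0 : 0 ≤ (perimeter Ω).toReal - κ := by
    have := hcon (fun _ => 0) ⟨contDiff_const, HasCompactSupport.zero, by simp⟩
    refine le_trans ?_ this
    simp [vdiv]
  have : perimeter Ω ≤ ENNReal.ofReal ((perimeter Ω).toReal - κ) := by
    conv_lhs => unfold perimeter relPerimeter
    simp only [iSup_le_iff]
    intro φ h1 h2 _ h4
    exact ENNReal.ofReal_le_ofReal (hcon φ ⟨h1, h2, h4⟩)
  have h2 := ENNReal.toReal_mono ENNReal.ofReal_ne_top this
  rw [ENNReal.toReal_ofReal h0] at h2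
  linarith

lemma per_le {n : ℕ} {Ω : Set (ES n)} {M : ℝ}
    (h : ∀ φ : ES n → ES n, Adm φ → ∫ x in Ω, vdiv φ x ≤ M) : perimeter Ω ≤ ENNReal.ofReal M := by
  unfold perimeter relPerimeter
  simp only [iSup_le_iff]
  intro φ h1 h2 _ h4
  exact ENNReal.ofReal_le_ofReal (h φ ⟨h1, h2, h4⟩)

end
end

section
open MeasureTheory Metric Filter Set
open scoped ENNReal Topology NNReal

noncomputable section

lemma grad_le {n : ℕ} {v : ES n → ℝ} (hv : ContDiff ℝ (⊤ : ℕ∞) v) (hc : HasCompactSupport v)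
    {M : ℝ} (h : ∀ φ : ES n → ES n, Adm φ → ∫ x, v x * vdiv φ x ≤ M) :
    ∫ x, ‖fderiv ℝ v x‖ ≤ M := by
  have hv1 : ContDiff ℝ 1 v := hv.of_le (by exact_mod_cast le_top)
  have hcf : HasCompactSupport (fderiv ℝ v) := hc.fderiv (𝕜 := ℝ)
  have hDc : Continuous (fderiv ℝ v) := hv1.continuous_fderiv one_ne_zero
  set L := (InnerProductSpace.toDual ℝ (ES n)).symm with hL
  have hD : ContDiff ℝ 1 (fderiv ℝ v) := by
    refine hv.fderiv_right (m := 1) ?_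
    exact WithTop.coe_le_coe.2 (le_top : (1 + 1 : ℕ∞) ≤ ⊤)
  have hg : ContDiff ℝ 1 (fun x => L (fderiv ℝ v x)) := L.contDiff.comp hD
  have hnorm : ∀ x, ‖L (fderiv ℝ v x)‖ = ‖fderiv ℝ v x‖ := fun x => L.norm_map _
  have happ : ∀ x, fderiv ℝ v x (L (fderiv ℝ v x)) = ‖fderiv ℝ v x‖ ^ 2 := by
    intro x
    rw [← hnorm, ← real_inner_self_eq_norm_sq, hL, InnerProductSpace.toDual_symm_apply]
  have key : ∀ κ : ℝ, 0 < κ → ∫ x, ‖fderiv ℝ v x‖ ≤ M + κ * volume.real (tsupport v) := by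
    intro κ hκ
    set s : ES n → ℝ := fun x => Real.sqrt (κ ^ 2 + ‖L (fderiv ℝ v x)‖ ^ 2) with hs
    have hpos : ∀ x, 0 < κ ^ 2 + ‖L (fderiv ℝ v x)‖ ^ 2 := fun x => by positivity
    have hspos : ∀ x, 0 < s x := fun x => Real.sqrt_pos.2 (hpos x)
    have hsC : ContDiff ℝ 1 s := by
      apply ContDiff.sqrt
      · exact contDiff_const.add (hg.norm_sq ℝ)
      · intro x; exact (hpos x).ne'
    have hsle : ∀ x, s x ≤ κ + ‖fderiv ℝ v x‖ := by
      intro x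
      rw [hs]; dsimp only
      rw [hnorm, Real.sqrt_le_left (by positivity)]
      nlinarith [norm_nonneg (fderiv ℝ v x)]
    have hsge : ∀ x, ‖fderiv ℝ v x‖ ≤ s x := by
      intro x
      apply Real.le_sqrt_of_sq_le
      rw [hnorm]
      nlinarith
    set φ : ES n → ES n := fun x => (-(s x)⁻¹) • L (fderiv ℝ v x) with hφ
    have hA : Adm φ := by
      refine ⟨?_, ?_, ?_⟩
      · exact ((hsC.inv fun x => (hspos x).ne').neg).smul hg
      · refine hcf.mono ?_
        intro x hx
        contrapose! hx
        simp only [Function.mem_support, not_not] at hx ⊢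
        simp [hφ, hx]
      · intro x
        rw [hφ]; dsimp only
        rw [norm_smul, norm_neg, norm_inv, hnorm, Real.norm_of_nonneg (hspos x).le]
        rw [inv_mul_le_iff₀ (hspos x)]
        simpa using hsge x
    have h1 := h φ hA
    rw [ibp hv1 hA.cd hA.cs, ← integral_neg] at h1
    have h2 : ∀ x, ‖fderiv ℝ v x‖ ≤ -(fderiv ℝ v x (φ x)) + (tsupport v).indicator (fun _ => κ) x := by
      intro x
      by_cases hx : x ∈ tsupport v
      · rw [indicator_of_mem hx, hφ]; dsimp only
        rw [map_smul, happ, smul_eq_mul]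
        have : ‖fderiv ℝ v x‖ * s x ≤ ‖fderiv ℝ v x‖ ^ 2 + κ * s x := by
          nlinarith [hsle x, hsge x, norm_nonneg (fderiv ℝ v x)]
        have h3 : ‖fderiv ℝ v x‖ = (s x)⁻¹ * (‖fderiv ℝ v x‖ * s x) := by
          field_simp [(hspos x).ne']
        rw [h3]
        calc (s x)⁻¹ * (‖fderiv ℝ v x‖ * s x) ≤ (s x)⁻¹ * (‖fderiv ℝ v x‖ ^ 2 + κ * s x) := by
              gcongr
          _ = _ := by field_simp [(hspos x).ne']
      · have : fderiv ℝ v x = 0 := by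
          by_contra hne
          exact hx (support_fderiv_subset ℝ hne)
        simp [this, indicator_of_notMem hx]
    have hfin : volume (tsupport v) < ⊤ := hc.isCompact.measure_lt_top
    have hi1 : Integrable (fun x => -(fderiv ℝ v x (φ x))) :=
      ((fderiv_app_continuous hv1 hA.cd).integrable_of_hasCompactSupport (fderiv_app_cs hA.cs)).neg
    have hi2 : Integrable ((tsupport v).indicator (fun _ => κ)) (volume : Measure (ES n)) :=
      (integrable_indicator_iff (isClosed_tsupport v).measurableSet).2
        (integrableOn_const hfin.ne)
    calc ∫ x, ‖fderiv ℝ v x‖ ≤ ∫ x, (-(fderiv ℝ v x (φ x)) + (tsupport v).indicator (fun _ => κ) x) :=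
          integral_mono (hDc.norm.integrable_of_hasCompactSupport hcf.norm) (hi1.add hi2) h2
      _ = (∫ x, -(fderiv ℝ v x (φ x))) + ∫ x, (tsupport v).indicator (fun _ => κ) x :=
          integral_add hi1 hi2
      _ ≤ _ := by
          rw [integral_indicator (isClosed_tsupport v).measurableSet, setIntegral_const]
          rw [smul_eq_mul, mul_comm]
          linarith
  have hT : Tendsto (fun κ : ℝ => M + κ * volume.real (tsupport v)) (𝓝[>] 0) (𝓝 M) := by
    have : Tendsto (fun κ : ℝ => M + κ * volume.real (tsupport v)) (𝓝 0)
      (𝓝 (M + 0 * volume.real (tsupport v))) := by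
      apply Continuous.tendsto; fun_prop
    simpa using this.mono_left nhdsWithin_le_nhds
  exact ge_of_tendsto hT (by filter_upwards [self_mem_nhdsWithin] with κ hκ using key κ hκ)

def eps (k : ℕ) : ℝ := 1 / ((k : ℝ) + 1)

lemma eps_pos (k : ℕ) : 0 < eps k := by unfold eps; positivity
lemma eps_le (k : ℕ) : eps k ≤ 1 := by
  unfold eps; rw [div_le_one (by positivity)]; linarith [(Nat.cast_nonneg k : (0:ℝ) ≤ k)]
lemma eps_tendsto : Tendsto eps atTop (𝓝 0) := tendsto_one_div_add_atTop_nhds_zero_nat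

def mb (n k : ℕ) : ContDiffBump (0 : ES n) :=
  ⟨eps k / 2, eps k, half_pos (eps_pos k), half_lt_self (eps_pos k)⟩

def chi {n : ℕ} (Ω : Set (ES n)) : ES n → ℝ := Ω.indicator (fun _ => 1)

def moll {n : ℕ} (Ω : Set (ES n)) (k : ℕ) : ES n → ℝ :=
  MeasureTheory.convolution ((mb n k).normed volume) (chi Ω) (ContinuousLinearMap.lsmul ℝ ℝ) volume

lemma chi_nonneg {n : ℕ} (Ω : Set (ES n)) (x) : 0 ≤ chi Ω x := by
  unfold chi; exact indicator_nonneg (fun _ _ => zero_le_one) x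
lemma chi_le {n : ℕ} (Ω : Set (ES n)) (x) : chi Ω x ≤ 1 := by
  unfold chi; exact indicator_le' (fun _ _ => le_rfl) (fun _ _ => zero_le_one) x

lemma moll_apply {n : ℕ} (Ω : Set (ES n)) (k : ℕ) (x : ES n) :
    moll Ω k x = ∫ y, (mb n k).normed volume y * chi Ω (x - y) := by
  simp [moll, convolution, smul_eq_mul]

section
variable {n : ℕ} {Ω : Set (ES n)}

lemma chi_measurable (hm : MeasurableSet Ω) : Measurable (chi Ω) := measurable_const.indicator hm

lemma chi_locInt (hm : MeasurableSet Ω) : LocallyIntegrable (chi Ω) volume := by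
  exact (locallyIntegrable_const (1:ℝ)).indicator hm

lemma chi_integrable (hb : Bornology.IsBounded Ω) (hm : MeasurableSet Ω) : Integrable (chi Ω) volume := by
  unfold chi
  rw [integrable_indicator_iff hm]
  exact integrableOn_const hb.measure_lt_top.ne

lemma moll_contDiff (hm : MeasurableSet Ω) (k : ℕ) : ContDiff ℝ (⊤ : ℕ∞) (moll Ω k) :=
  (mb n k).hasCompactSupport_normed.contDiff_convolution_left _
    ((mb n k).contDiff_normed) (chi_locInt hm)

lemma moll_integrand (hm : MeasurableSet Ω) (k : ℕ) (x : ES n) :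
    Integrable (fun y => (mb n k).normed volume y * chi Ω (x - y)) := by
  refine ((mb n k).integrable_normed (μ := volume)).mul_bdd (c := 1) ?_ ?_
  · exact ((chi_measurable hm).comp (measurable_const.sub measurable_id)).aestronglyMeasurable
  · refine Eventually.of_forall fun y => ?_
    rw [Real.norm_of_nonneg (chi_nonneg _ _)]; exact chi_le _ _

lemma moll_nonneg (k : ℕ) (x : ES n) : 0 ≤ moll Ω k x := by
  rw [moll_apply]
  exact integral_nonneg fun y => mul_nonneg ((mb n k).nonneg_normed y) (chi_nonneg _ _)

lemma moll_le (hm : MeasurableSet Ω) (k : ℕ) (x : ES n) : moll Ω k x ≤ 1 := by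
  rw [moll_apply, ← (mb n k).integral_normed (μ := volume)]
  refine integral_mono (moll_integrand hm k x) (mb n k).integrable_normed fun y => ?_
  exact mul_le_of_le_one_right ((mb n k).nonneg_normed y) (chi_le _ _)

lemma exists_R (hb : Bornology.IsBounded Ω) : ∃ R : ℝ, 0 < R ∧ ∀ x, x ∉ closedBall (0 : ES n) R →
    chi Ω x = 0 ∧ ∀ k, moll Ω k x = 0 := by
  obtain ⟨R, hR⟩ := hb.subset_closedBall (0 : ES n)
  refine ⟨max R 0 + 1, by positivity, fun x hx => ⟨?_, fun k => ?_⟩⟩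
  · refine indicator_of_notMem (fun h => hx ?_) _
    refine closedBall_subset_closedBall ?_ (hR h)
    linarith [le_max_left R 0]
  · rw [moll_apply]
    refine integral_eq_zero_of_ae (Eventually.of_forall fun y => ?_)
    simp only [Pi.zero_apply, mul_eq_zero]
    by_contra! hcon
    have h1 : y ∈ ball (0 : ES n) (eps k) := by
      have : y ∈ Function.support ((mb n k).normed volume) := hcon.1
      rwa [(mb n k).support_normed_eq] at this
    have h2 : x - y ∈ Ω := by
      by_contra h
      exact hcon.2 (indicator_of_notMem h _)
    have h3 := hR h2
    rw [mem_closedBall_zero_iff] at h3 hx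
    rw [mem_ball_zero_iff] at h1
    apply hx
    calc ‖x‖ = ‖(x - y) + y‖ := by simp
      _ ≤ ‖x - y‖ + ‖y‖ := norm_add_le _ _
      _ ≤ R + 1 := by linarith [eps_le k]
      _ ≤ _ := by linarith [le_max_left R 0]

lemma moll_cs (hb : Bornology.IsBounded Ω) (k : ℕ) : HasCompactSupport (moll Ω k) := by
  obtain ⟨R, _, hR⟩ := exists_R hb
  exact HasCompactSupport.intro (isCompact_closedBall 0 R) fun x hx => (hR x hx).2 k

lemma moll_ae (hm : MeasurableSet Ω) : ∀ᵐ x : ES n, Tendsto (fun k => moll Ω k x) atTop (𝓝 (chi Ω x)) := by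
  refine ContDiffBump.ae_convolution_tendsto_right_of_locallyIntegrable (K := 2)
    (φ := fun k => mb n k) ?_ ?_ (chi_locInt hm)
  · exact eps_tendsto
  · exact Eventually.of_forall fun k => by simp [mb]; linarith

lemma moll_density (hm : MeasurableSet Ω) (k : ℕ) (x : ES n) :
    volume.real (closedBall x (eps k / 2) \ Ω) ≤
      (1 - moll Ω k x) * volume.real (closedBall (0 : ES n) (eps k)) := by
  set V := volume.real (closedBall (0 : ES n) (eps k)) with hV
  have hVpos : 0 < V := ENNReal.toReal_pos
    (measure_closedBall_pos volume _ (eps_pos k)).ne' (isCompact_closedBall _ _).measure_lt_top.ne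
  set ρ := (mb n k).normed (volume : Measure (ES n)) with hρ
  have hρi : Integrable ρ := (mb n k).integrable_normed
  have h1 : 1 - moll Ω k x = ∫ y, ρ y * (1 - chi Ω (x - y)) := by
    have h0 : (1:ℝ) = ∫ y, ρ y := ((mb n k).integral_normed (μ := volume)).symm
    rw [moll_apply]
    conv_lhs => rw [h0]
    rw [← integral_sub hρi (moll_integrand hm k x)]
    congr 1; ext y; simp only [← hρ]; ring
  set A : Set (ES n) := (fun y => x - y) ⁻¹' (closedBall x (eps k / 2) \ Ω) with hA
  have hAm : MeasurableSet A := (measurable_const.sub measurable_id)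
    (measurableSet_closedBall.diff hm)
  have hAv : volume.real A = volume.real (closedBall x (eps k / 2) \ Ω) := by
    have := (Measure.measurePreserving_sub_left (volume : Measure (ES n)) x).measure_preimage
      (s := closedBall x (eps k / 2) \ Ω) (measurableSet_closedBall.diff hm).nullMeasurableSet
    simp only [measureReal_def, hA, this]
  have hfin : volume A ≠ ⊤ := by
    rw [(Measure.measurePreserving_sub_left (volume : Measure (ES n)) x).measure_preimage
      (measurableSet_closedBall.diff hm).nullMeasurableSet]
    exact ((measure_mono sdiff_subset).trans_lt (isCompact_closedBall _ _).measure_lt_top).ne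
  have h2 : ∀ y, A.indicator (fun _ => V⁻¹) y ≤ ρ y * (1 - chi Ω (x - y)) := by
    intro y
    by_cases hy : y ∈ A
    · rw [indicator_of_mem hy]
      obtain ⟨hy1, hy2⟩ := hy
      have : chi Ω (x - y) = 0 := indicator_of_notMem hy2 _
      rw [this, sub_zero, mul_one, hρ, (mb n k).normed_def]
      have h3 : (mb n k) y = 1 := by
        apply ContDiffBump.one_of_mem_closedBall
        rw [mem_closedBall, dist_eq_norm] at hy1
        rw [mem_closedBall_zero_iff]
        simp only [sub_sub_cancel_left, norm_neg] at hy1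
        exact hy1
      rw [h3, one_div]
      exact inv_anti₀ (mb n k).integral_pos ((mb n k).integral_le_measure_closedBall volume)
    · rw [indicator_of_notMem hy]
      exact mul_nonneg ((mb n k).nonneg_normed y) (sub_nonneg.2 (chi_le _ _))
  have h3 : V⁻¹ * volume.real A ≤ 1 - moll Ω k x := by
    rw [h1]
    have : ∫ y, A.indicator (fun _ => V⁻¹) y = V⁻¹ * volume.real A := by
      rw [integral_indicator hAm, setIntegral_const, smul_eq_mul, mul_comm]
    rw [← this]
    refine integral_mono ((integrable_indicator_iff hAm).2 (integrableOn_const hfin)) ?_ h2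
    have := hρi.sub (moll_integrand hm k x)
    refine this.congr (Eventually.of_forall fun y => ?_)
    simp only [← hρ, Pi.sub_apply]; ring
  rw [← hAv]
  rwa [inv_mul_le_iff₀ hVpos, mul_comm] at h3

lemma vdiv_translate {φ : ES n → ES n} (y x : ES n) :
    vdiv (fun z => φ (z + y)) x = vdiv φ (x + y) := by
  unfold vdiv
  simp only [fderiv_comp_add_right]

lemma Adm.translate {φ : ES n → ES n} (h : Adm φ) (y : ES n) : Adm (fun z => φ (z + y)) :=
  ⟨h.cd.comp (contDiff_id.add contDiff_const),
    h.cs.comp_homeomorph (Homeomorph.addRight y), fun _ => h.le _⟩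

lemma integral_chi_mul (hm : MeasurableSet Ω) (f : ES n → ℝ) :
    ∫ x, chi Ω x * f x = ∫ x in Ω, f x := by
  rw [← integral_indicator hm]
  congr 1; ext x
  by_cases hx : x ∈ Ω <;> simp [chi, hx]

lemma moll_test (hm : MeasurableSet Ω) (hP : perimeter Ω ≠ ⊤) (k : ℕ) {φ : ES n → ES n} (h : Adm φ) :
    ∫ x, moll Ω k x * vdiv φ x ≤ (perimeter Ω).toReal := by
  set ρ := (mb n k).normed (volume : Measure (ES n)) with hρ
  have hρi : Integrable ρ := (mb n k).integrable_normed
  obtain ⟨C, hC⟩ := (vdiv_continuous h.cd).bounded_above_of_compact_support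
    (vdiv_hasCompactSupport h.cs)
  have hIntg : Integrable (Function.uncurry fun (x y : ES n) => ρ y * chi Ω (x - y) * vdiv φ x)
      (volume.prod volume) := by
    have h1 : Integrable (fun z : ES n × ES n => vdiv φ z.1 * ρ z.2) (volume.prod volume) :=
      (vdiv_integrable h.cd h.cs).mul_prod hρi
    have h2 := h1.mul_bdd (c := 1) (g := fun z : ES n × ES n => chi Ω (z.1 - z.2))
      ((chi_measurable hm).comp (measurable_fst.sub measurable_snd)).aestronglyMeasurable
      (Eventually.of_forall fun z => by
        rw [Real.norm_of_nonneg (chi_nonneg _ _)]; exact chi_le _ _)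
    refine h2.congr (Eventually.of_forall fun z => ?_)
    simp only [Function.uncurry]; ring
  have h2 : ∀ y, ∫ x, ρ y * chi Ω (x - y) * vdiv φ x
      = ρ y * ∫ x in Ω, vdiv (fun z => φ (z + y)) x := by
    intro y
    simp_rw [mul_assoc, integral_const_mul]
    congr 1
    rw [← integral_chi_mul hm]
    simp_rw [vdiv_translate]
    rw [← integral_add_right_eq_self (fun x => chi Ω (x - y) * vdiv φ x) y]
    simp
  have h1 : ∫ x, moll Ω k x * vdiv φ x = ∫ y, ρ y * ∫ x in Ω, vdiv (fun z => φ (z + y)) x := by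
    simp_rw [moll_apply, ← integral_mul_const, ← hρ]
    rw [integral_integral_swap hIntg]
    congr 1; ext y
    exact h2 y
  rw [h1]
  calc ∫ y, ρ y * ∫ x in Ω, vdiv (fun z => φ (z + y)) x ≤ ∫ y, ρ y * (perimeter Ω).toReal := by
        refine integral_mono ?_ (hρi.mul_const _) fun y => ?_
        · refine hIntg.integral_prod_right.congr (Eventually.of_forall fun y => ?_)
          exact h2 y
        · exact mul_le_mul_of_nonneg_left ((h.translate y).le_per hP) ((mb n k).nonneg_normed y)
    _ = (perimeter Ω).toReal := by
        rw [integral_mul_const, (mb n k).integral_normed, one_mul]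

lemma moll_grad (hb : Bornology.IsBounded Ω) (hm : MeasurableSet Ω) (hP : perimeter Ω ≠ ⊤) (k : ℕ) :
    ∫ x, ‖fderiv ℝ (moll Ω k) x‖ ≤ (perimeter Ω).toReal :=
  grad_le (moll_contDiff hm k) (moll_cs hb k) fun _ hφ => moll_test hm hP k hφ

end
end
end

section
open MeasureTheory Metric Filter Set
open scoped ENNReal Topology NNReal CompactlySupported

noncomputable section

/-- the ultrafilter -/
abbrev UF : Filter ℕ := (hyperfilter ℕ : Ultrafilter ℕ)

lemma UF_le : UF ≤ atTop := by
  have := hyperfilter_le_cofinite (α := ℕ)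
  rwa [Nat.cofinite_eq_atTop] at this

lemma uf_lim {a : ℕ → ℝ} {M : ℝ} (h : ∀ k, |a k| ≤ M) : ∃ l, Tendsto a UF (𝓝 l) := by
  have hc : IsCompact (Icc (-M) M) := isCompact_Icc
  obtain ⟨l, _, hl⟩ := hc.ultrafilter_le_nhds ((hyperfilter ℕ).map a) (by
    rw [Ultrafilter.coe_map, le_principal_iff, mem_map]
    exact Eventually.of_forall fun k => abs_le.1 (h k))
  exact ⟨l, hl⟩

lemma exists_weak_limit {n : ℕ} (g : ℕ → ES n → ℝ) (hc : ∀ k, Integrable (g k) volume)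
    (h0 : ∀ k x, 0 ≤ g k x) {M : ℝ} (hM : ∀ k, ∫ x, g k x ≤ M) :
    ∃ μ : Measure (ES n), IsFiniteMeasure μ ∧ μ univ ≤ ENNReal.ofReal M ∧
      ∀ f : ES n → ℝ, Continuous f → HasCompactSupport f →
        Tendsto (fun k => ∫ x, f x * g k x) UF (𝓝 (∫ x, f x ∂μ)) := by
  have hM0 : 0 ≤ M := (integral_nonneg (h0 0)).trans (hM 0)
  have hIntg : ∀ (f : C_c(ES n, ℝ)) k, Integrable (fun x => f x * g k x) := by
    intro f k
    obtain ⟨C, hC⟩ := f.continuous.bounded_above_of_compact_support f.hasCompactSupport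
    exact (hc k).bdd_mul f.continuous.aestronglyMeasurable (Eventually.of_forall hC)
  have hbd : ∀ (f : C_c(ES n, ℝ)) (C : ℝ), (∀ x, ‖f x‖ ≤ C) →
      ∀ k, |∫ x, f x * g k x| ≤ C * M := by
    intro f C hC k
    have hC0 : 0 ≤ C := (norm_nonneg _).trans (hC 0)
    calc |∫ x, f x * g k x| ≤ ∫ x, |f x * g k x| := abs_integral_le_integral_abs
      _ ≤ ∫ x, C * g k x := by
          refine integral_mono (hIntg f k).abs ((hc k).const_mul C) fun x => ?_
          simp only [abs_mul, abs_of_nonneg (h0 k x)]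
          exact mul_le_mul_of_nonneg_right (hC x) (h0 k x)
      _ = C * ∫ x, g k x := integral_const_mul _ _
      _ ≤ C * M := by gcongr; exact hM k
  have hex : ∀ f : C_c(ES n, ℝ), ∃ l, Tendsto (fun k => ∫ x, f x * g k x) UF (𝓝 l) := by
    intro f
    obtain ⟨C, hC⟩ := f.continuous.bounded_above_of_compact_support f.hasCompactSupport
    exact uf_lim (hbd f C hC)
  choose L hL using hex
  let Λ₀ : C_c(ES n, ℝ) →ₗ[ℝ] ℝ :=
    { toFun := L
      map_add' := by
        intro f₁ f₂
        refine tendsto_nhds_unique (hL (f₁ + f₂)) (((hL f₁).add (hL f₂)).congr fun k => ?_)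
        rw [← integral_add (hIntg f₁ k) (hIntg f₂ k)]
        congr 1; ext x; simp [add_mul]
      map_smul' := by
        intro c f
        refine tendsto_nhds_unique (hL (c • f)) (((hL f).const_mul c).congr fun k => ?_)
        rw [← integral_const_mul]
        congr 1; ext x; simp [mul_assoc] }
  let Λ : C_c(ES n, ℝ) →ₚ[ℝ] ℝ := PositiveLinearMap.mk₀ Λ₀ (by
    intro f hf
    refine ge_of_tendsto (hL f) (Eventually.of_forall fun k => ?_)
    exact integral_nonneg fun x => mul_nonneg (hf x) (h0 k x))
  have hΛ : ∀ f, Λ f = L f := fun f => rfl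
  have hball : ∀ R : ℕ, RealRMK.rieszMeasure Λ (closedBall (0 : ES n) R) ≤ ENNReal.ofReal M := by
    intro R
    obtain ⟨f, hf1, _, hf3, hf4⟩ := exists_continuous_one_zero_of_isCompact
      (isCompact_closedBall (0 : ES n) R) isClosed_empty (disjoint_empty _)
    let F : C_c(ES n, ℝ) := ⟨f, hf3⟩
    refine (RealRMK.rieszMeasure_le_of_eq_one Λ (f := F) (fun x => (hf4 x).1)
      (isCompact_closedBall _ _) (fun x hx => hf1 hx)).trans ?_
    refine ENNReal.ofReal_le_ofReal ?_
    rw [hΛ]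
    refine le_of_tendsto (hL F) (Eventually.of_forall fun k => ?_)
    refine (le_abs_self _).trans ((hbd F 1 (fun x => ?_) k).trans (by simp))
    change ‖f x‖ ≤ 1
    rw [Real.norm_of_nonneg (hf4 x).1]; exact (hf4 x).2
  have hun : RealRMK.rieszMeasure Λ univ ≤ ENNReal.ofReal M := by
    rw [← iUnion_closedBall_nat (0 : ES n), Monotone.measure_iUnion]
    · exact iSup_le hball
    · intro a b hab
      exact closedBall_subset_closedBall (by exact_mod_cast hab)
  refine ⟨RealRMK.rieszMeasure Λ, ⟨hun.trans_lt ENNReal.ofReal_lt_top⟩, hun, ?_⟩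
  intro f hf1 hf2
  have := RealRMK.integral_rieszMeasure Λ (⟨⟨f, hf1⟩, hf2⟩ : C_c(ES n, ℝ))
  have h2 := hL (⟨⟨f, hf1⟩, hf2⟩ : C_c(ES n, ℝ))
  rw [← hΛ, ← this] at h2
  exact h2

lemma fderiv_zero_of_eq_one {n : ℕ} {η : ES n → ℝ} (h1 : ∀ y, η y ≤ 1) {y : ES n}
    (hy : η y = 1) : fderiv ℝ η y = 0 :=
  IsLocalMax.fderiv_eq_zero (Eventually.of_forall fun z => by rw [hy]; exact h1 z)

lemma fderiv_zero_of_eq_zero {n : ℕ} {η : ES n → ℝ} (h1 : ∀ y, 0 ≤ η y) {y : ES n}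
    (hy : η y = 0) : fderiv ℝ η y = 0 :=
  IsLocalMin.fderiv_eq_zero (Eventually.of_forall fun z => by rw [hy]; exact h1 z)

lemma smoothTransition_deriv_bdd : ∃ C : ℝ, 0 < C ∧ ∀ t, |deriv Real.smoothTransition t| ≤ C := by
  have hcont : Continuous (deriv Real.smoothTransition) :=
    (Real.smoothTransition.contDiff (n := 1)).continuous_deriv le_rfl
  obtain ⟨C, hC⟩ := (isCompact_Icc (a := (0:ℝ)) (b := 1)).exists_bound_of_continuousOn
    hcont.continuousOn
  refine ⟨max C 1, by positivity, fun t => ?_⟩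
  by_cases ht : t ∈ Icc (0:ℝ) 1
  · exact (hC t ht).trans (le_max_left _ _)
  · have : deriv Real.smoothTransition t = 0 := by
      rw [mem_Icc, not_and_or, not_le, not_le] at ht
      rcases ht with ht | ht
      · refine IsLocalMin.deriv_eq_zero (Eventually.of_forall fun z => ?_)
        rw [Real.smoothTransition.zero_of_nonpos ht.le]; exact Real.smoothTransition.nonneg z
      · refine IsLocalMax.deriv_eq_zero (Eventually.of_forall fun z => ?_)
        rw [Real.smoothTransition.one_of_one_le ht.le]; exact Real.smoothTransition.le_one z
    rw [this, abs_zero]; positivity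

/-- radial cut-off functions -/
structure Cut {n : ℕ} (C : ℝ) (x : ES n) (r R : ℝ) (η : ES n → ℝ) : Prop where
  cd : ContDiff ℝ (⊤ : ℕ∞) η
  cs : HasCompactSupport η
  nonneg : ∀ y, 0 ≤ η y
  le : ∀ y, η y ≤ 1
  one : ∀ y ∈ closedBall x r, η y = 1
  zero : ∀ y, y ∉ ball x R → η y = 0
  grad : ∀ y, ‖fderiv ℝ η y‖ ≤ C / (R - r)

lemma exists_cut : ∃ C : ℝ, 0 < C ∧ ∀ (n : ℕ) (x : ES n) (r R : ℝ), 0 < r → r < R →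
    ∃ η : ES n → ℝ, Cut C x r R η := by
  obtain ⟨C, hC0, hC⟩ := smoothTransition_deriv_bdd
  refine ⟨2 * C, by positivity, fun n x r R hr hR => ?_⟩
  have hd : 0 < R ^ 2 - r ^ 2 := by nlinarith
  set q : ES n → ℝ := fun y => (R ^ 2 - ‖y - x‖ ^ 2) / (R ^ 2 - r ^ 2) with hq
  have hqC : ContDiff ℝ (⊤ : ℕ∞) q := by
    apply ContDiff.div_const
    exact contDiff_const.sub ((contDiff_id.sub contDiff_const).norm_sq ℝ)
  have hz : ∀ y, y ∉ ball x R → Real.smoothTransition (q y) = 0 := by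
    intro y hy
    rw [mem_ball, dist_eq_norm, not_lt] at hy
    apply Real.smoothTransition.zero_of_nonpos
    apply div_nonpos_of_nonpos_of_nonneg _ hd.le
    nlinarith
  refine ⟨fun y => Real.smoothTransition (q y), ?_, ?_, ?_, ?_, ?_, hz, ?_⟩
  · exact Real.smoothTransition.contDiff.comp hqC
  · refine HasCompactSupport.intro (isCompact_closedBall x R) fun y hy => hz y fun h => hy
      (ball_subset_closedBall h)
  · exact fun y => Real.smoothTransition.nonneg _
  · exact fun y => Real.smoothTransition.le_one _
  · intro y hy
    rw [mem_closedBall, dist_eq_norm] at hy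
    apply Real.smoothTransition.one_of_one_le
    rw [hq]; dsimp only
    rw [le_div_iff₀ hd]
    nlinarith [norm_nonneg (y - x)]
  · intro y
    by_cases hy : y ∈ ball x R
    · have h1 : HasFDerivAt q ((R ^ 2 - r ^ 2)⁻¹ • (-((2:ℕ) • (innerSL ℝ (y - x) : ES n →L[ℝ] ℝ)))) y := by
        have h2 : HasFDerivAt (fun y : ES n => ‖y - x‖ ^ 2) ((2:ℕ) • (innerSL ℝ (y - x) : ES n →L[ℝ] ℝ)) y := by
          have := ((hasFDerivAt_id (𝕜 := ℝ) y).sub_const x).norm_sq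
          simpa using this
        have h3 := (h2.const_sub (R ^ 2)).const_mul ((R ^ 2 - r ^ 2)⁻¹)
        refine h3.congr_of_eventuallyEq (Eventually.of_forall fun z => ?_)
        simp [hq, div_eq_inv_mul]
      have h2 : HasDerivAt Real.smoothTransition (deriv Real.smoothTransition (q y)) (q y) :=
        (((Real.smoothTransition.contDiff (n := 1)).differentiable one_ne_zero) _).hasDerivAt
      have h4 : HasFDerivAt (fun y => Real.smoothTransition (q y)) _ y := h2.comp_hasFDerivAt y h1
      rw [h4.fderiv]
      have h3 : ‖(R ^ 2 - r ^ 2)⁻¹ • (-((2:ℕ) • (innerSL ℝ (y - x) : ES n →L[ℝ] ℝ)))‖ ≤ 2 / (R - r) := by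
        rw [norm_smul, norm_neg, norm_inv, Real.norm_of_nonneg hd.le, ← Nat.cast_smul_eq_nsmul ℝ,
          norm_smul, innerSL_apply_norm]
        rw [mem_ball, dist_eq_norm] at hy
        rw [inv_mul_le_iff₀ hd]
        have : (R ^ 2 - r ^ 2) * (2 / (R - r)) = 2 * (R + r) := by
          have : R - r ≠ 0 := by linarith
          field_simp; ring
        rw [this]
        norm_num
        linarith
      rw [norm_smul]
      calc _ ≤ C * (2 / (R - r)) := by
            gcongr
            exact hC _
        _ = _ := by ring
    · rw [fderiv_zero_of_eq_zero (fun y => Real.smoothTransition.nonneg _) (hz y hy), norm_zero]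
      exact div_nonneg (by positivity) (by linarith)

/-- the Sobolev exponent -/
def pn (n : ℕ) : ℝ := n / (n - 1)

lemma pn_conj {n : ℕ} (hn : 2 ≤ n) : Real.HolderConjugate n (pn n) := by
  have : (1:ℝ) < n := by exact_mod_cast hn
  exact Real.HolderConjugate.conjExponent this

lemma sobolev {n : ℕ} (hn : 2 ≤ n) : ∃ K : ℝ, 0 < K ∧ ∀ v : ES n → ℝ, ContDiff ℝ 1 v →
    HasCompactSupport v → ∫ x, |v x| ^ pn n ≤ K * (∫ x, ‖fderiv ℝ v x‖) ^ pn n := by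
  have hp := pn_conj hn
  have hp0 : 0 < pn n := hp.symm.pos
  set c := lintegralPowLePowLIntegralFDerivConst (volume : Measure (ES n)) (pn n)
  refine ⟨c + 1, by positivity, fun v hv hc => ?_⟩
  have h := lintegral_pow_le_pow_lintegral_fderiv (volume : Measure (ES n)) (u := v) hv hc
    (p := pn n) (by simpa using hp)
  have hDi : Integrable (fun x => ‖fderiv ℝ v x‖) :=
    (hv.continuous_fderiv one_ne_zero).norm.integrable_of_hasCompactSupport
      (hc.fderiv (𝕜 := ℝ)).norm
  have hD0 : 0 ≤ ∫ x, ‖fderiv ℝ v x‖ := integral_nonneg fun x => norm_nonneg _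
  have h1 : ∫⁻ x, ‖fderiv ℝ v x‖ₑ = ENNReal.ofReal (∫ x, ‖fderiv ℝ v x‖) := by
    rw [ofReal_integral_eq_lintegral_ofReal hDi (Eventually.of_forall fun x => norm_nonneg _)]
    simp
  have h2 : ∫ x, |v x| ^ pn n = (∫⁻ x, ‖v x‖ₑ ^ pn n).toReal := by
    rw [integral_eq_lintegral_of_nonneg_ae]
    · congr 1; refine lintegral_congr fun x => ?_
      rw [← ENNReal.ofReal_rpow_of_nonneg (abs_nonneg _) hp0.le]
      congr 1
      exact (Real.enorm_eq_ofReal_abs _).symm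
    · exact Eventually.of_forall fun x => by positivity
    · exact (hv.continuous.abs.rpow_const fun x => Or.inr hp0.le).aestronglyMeasurable
  rw [h2]
  rw [h1, ENNReal.ofReal_rpow_of_nonneg hD0 hp0.le] at h
  have h3 := ENNReal.toReal_mono (by finiteness) h
  rw [ENNReal.toReal_mul, ENNReal.toReal_ofReal (by positivity), ENNReal.coe_toReal] at h3
  refine h3.trans ?_
  gcongr
  linarith

end
end

section
open MeasureTheory Metric Filter Set
open scoped ENNReal Topology NNReal

noncomputable section

/-- volume of the complement of `Ω` in closed balls -/
def mc {n : ℕ} (Ω : Set (ES n)) (x : ES n) (r : ℝ) : ℝ := volume.real (closedBall x r \ Ω)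

/-- properties of the perimeter measure -/
structure PM {n : ℕ} (K : ℝ) (Ω : Set (ES n)) (μ : Measure (ES n)) : Prop where
  fin : IsFiniteMeasure μ
  mass : μ univ ≤ perimeter Ω
  c1 : ∀ φ : ES n → ES n, ContDiff ℝ 1 φ → HasCompactSupport φ →
    ∫ x in Ω, vdiv φ x ≤ ∫ x, ‖φ x‖ ∂μ
  c3 : ∀ i : Fin n, ∃ ν : Measure (ES n), IsFiniteMeasure ν ∧ ∀ f : ES n → ℝ, ContDiff ℝ 1 f →
    HasCompactSupport f → ∫ x, f x ∂ν = ∫ x, f x ∂μ -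
      ∫ x in Ω, fderiv ℝ f x (EuclideanSpace.single i 1)
  iso : ∀ x r R, 0 < r → r < R → mc Ω x r ≤
    K * (μ.real (closedBall x R) + (mc Ω x R - mc Ω x r) / (R - r)) ^ pn n

section
variable {n : ℕ} {Ω : Set (ES n)}

lemma mc_mono {x : ES n} {r R : ℝ} (h : r ≤ R) : mc Ω x r ≤ mc Ω x R := by
  refine measureReal_mono (sdiff_subset_sdiff_left (closedBall_subset_closedBall h)) ?_
  exact ne_top_of_le_ne_top (isCompact_closedBall x R).measure_lt_top.ne (measure_mono sdiff_subset)

lemma mc_nonneg {x : ES n} {r : ℝ} : 0 ≤ mc Ω x r := measureReal_nonneg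

lemma annulus_le (hm : MeasurableSet Ω) {x : ES n} {r R : ℝ} (h : r ≤ R) :
    volume.real ((closedBall x R \ closedBall x r) \ Ω) = mc Ω x R - mc Ω x r := by
  have : (closedBall x R \ closedBall x r) \ Ω = (closedBall x R \ Ω) \ (closedBall x r \ Ω) := by
    ext y; simp only [Set.mem_sdiff]; tauto
  rw [this, mc, mc, measureReal_sdiff
    (sdiff_subset_sdiff_left (closedBall_subset_closedBall h))
    (measurableSet_closedBall.diff hm) (ne_top_of_le_ne_top
      (isCompact_closedBall x R).measure_lt_top.ne (measure_mono sdiff_subset))]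

lemma moll_tendsto (hm : MeasurableSet Ω) {h : ES n → ℝ} (hi : Integrable h) :
    Tendsto (fun k => ∫ x, moll Ω k x * h x) atTop (𝓝 (∫ x in Ω, h x)) := by
  rw [← integral_chi_mul hm]
  refine tendsto_integral_of_dominated_convergence (fun x => ‖h x‖) ?_ hi.norm ?_ ?_
  · exact fun k => (moll_contDiff hm k).continuous.aestronglyMeasurable.mul hi.aestronglyMeasurable
  · refine fun k => Eventually.of_forall fun x => ?_
    rw [norm_mul, Real.norm_of_nonneg (moll_nonneg k x)]
    exact mul_le_of_le_one_left (norm_nonneg _) (moll_le hm k x)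
  · filter_upwards [moll_ae hm] with x hx
    exact hx.mul_const _

lemma moll_contDiff1 (hm : MeasurableSet Ω) (k : ℕ) : ContDiff ℝ 1 (moll Ω k) :=
  (moll_contDiff hm k).of_le (by exact_mod_cast le_top)

lemma moll_grad_int (hb : Bornology.IsBounded Ω) (hm : MeasurableSet Ω) (k : ℕ) :
    Integrable (fun x => ‖fderiv ℝ (moll Ω k) x‖) :=
  ((moll_contDiff1 hm k).continuous_fderiv one_ne_zero).norm.integrable_of_hasCompactSupport
    ((moll_cs hb k).fderiv (𝕜 := ℝ)).norm

lemma norm_single (i : Fin n) : ‖(EuclideanSpace.single i 1 : ES n)‖ = 1 := by simp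

lemma iso_aux {S C : ℝ} (hS : 0 < S) (hC : 0 < C)
    (hn : 2 ≤ n)
    (hSob : ∀ v : ES n → ℝ, ContDiff ℝ 1 v →
      HasCompactSupport v → ∫ x, |v x| ^ pn n ≤ S * (∫ x, ‖fderiv ℝ v x‖) ^ pn n)
    (hb : Bornology.IsBounded Ω) (hm : MeasurableSet Ω)
    {μ : Measure (ES n)} [IsFiniteMeasure μ] (hμ : ∀ f : ES n → ℝ, Continuous f → HasCompactSupport f →
        Tendsto (fun k => ∫ x, f x * ‖fderiv ℝ (moll Ω k) x‖) UF (𝓝 (∫ x, f x ∂μ)))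
    {x : ES n} {r R : ℝ} (hr : 0 < r) (hR : r < R) {η : ES n → ℝ} (hη : Cut C x r R η) :
    mc Ω x r ≤
    S * (μ.real (closedBall x R) + C * ((mc Ω x R - mc Ω x r) / (R - r))) ^ pn n := by
  have hp0 : 0 < pn n := (pn_conj hn).symm.pos
  have hη1 : ContDiff ℝ 1 η := hη.cd.of_le (by exact_mod_cast le_top)
  set v : ℕ → ES n → ℝ := fun k y => (1 - moll Ω k y) * η y with hv
  have hvC : ∀ k, ContDiff ℝ 1 (v k) := fun k => (contDiff_const.sub (moll_contDiff1 hm k)).mul hη1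
  have hvc : ∀ k, HasCompactSupport (v k) := fun k => hη.cs.mul_left
  have hDηi : Integrable (fun y => ‖fderiv ℝ η y‖) :=
    (hη1.continuous_fderiv one_ne_zero).norm.integrable_of_hasCompactSupport
      (hη.cs.fderiv (𝕜 := ℝ)).norm
  have hi1 : ∀ k, Integrable (fun y => η y * ‖fderiv ℝ (moll Ω k) y‖) := fun k =>
    (hη1.continuous.mul ((moll_contDiff1 hm k).continuous_fderiv one_ne_zero).norm
      ).integrable_of_hasCompactSupport hη.cs.mul_right
  have hi2 : ∀ k, Integrable (fun y => moll Ω k y * ‖fderiv ℝ η y‖) := fun k =>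
    ((moll_contDiff1 hm k).continuous.mul (hη1.continuous_fderiv one_ne_zero).norm
      ).integrable_of_hasCompactSupport ((hη.cs.fderiv (𝕜 := ℝ)).norm).mul_left
  have hDv : ∀ k, ∫ y, ‖fderiv ℝ (v k) y‖ ≤ (∫ y, η y * ‖fderiv ℝ (moll Ω k) y‖) +
      ((∫ y, ‖fderiv ℝ η y‖) - ∫ y, moll Ω k y * ‖fderiv ℝ η y‖) := by
    intro k
    have hi3 : Integrable (fun y => ‖fderiv ℝ η y‖ - moll Ω k y * ‖fderiv ℝ η y‖) :=
      hDηi.sub (hi2 k)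
    rw [← integral_sub hDηi (hi2 k), ← integral_add (hi1 k) hi3]
    refine integral_mono (((hvC k).continuous_fderiv
      one_ne_zero).norm.integrable_of_hasCompactSupport ((hvc k).fderiv (𝕜 := ℝ)).norm)
      ((hi1 k).add (hDηi.sub (hi2 k))) fun y => ?_
    have hd1 : HasFDerivAt (fun y => 1 - moll Ω k y) (-(fderiv ℝ (moll Ω k) y)) y :=
      (((moll_contDiff1 hm k).differentiable one_ne_zero y).hasFDerivAt).const_sub 1
    have hd2 := hd1.mul ((hη1.differentiable one_ne_zero y).hasFDerivAt)
    have e : fderiv ℝ (v k) y = _ := hd2.fderiv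
    dsimp only
    rw [e]
    refine (norm_add_le _ _).trans ?_
    rw [norm_smul, norm_smul, norm_neg, Real.norm_of_nonneg (hη.nonneg y),
      Real.norm_of_nonneg (by linarith [moll_le hm k y])]
    linarith
  have hlim : Tendsto (fun k => (∫ y, η y * ‖fderiv ℝ (moll Ω k) y‖) +
      ((∫ y, ‖fderiv ℝ η y‖) - ∫ y, moll Ω k y * ‖fderiv ℝ η y‖)) UF
      (𝓝 ((∫ y, η y ∂μ) + ((∫ y, ‖fderiv ℝ η y‖) - ∫ y in Ω, ‖fderiv ℝ η y‖))) :=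
    (hμ η hη1.continuous hη.cs).add (((moll_tendsto hm hDηi).mono_left UF_le).const_sub _)
  have hlim2 := (hlim.rpow_const (p := pn n) (Or.inr hp0.le)).const_mul S
  have hlim1 : Tendsto (fun k => ∫ y, |v k y| ^ pn n) UF (𝓝 (∫ y, |(1 - chi Ω y) * η y| ^ pn n)) := by
    refine Tendsto.mono_left ?_ UF_le
    refine tendsto_integral_of_dominated_convergence ((closedBall x R).indicator fun _ => 1) ?_ ?_ ?_ ?_
    · exact fun k => ((hvC k).continuous.abs.rpow_const fun _ => Or.inr hp0.le).aestronglyMeasurable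
    · rw [integrable_indicator_iff measurableSet_closedBall]
      exact (integrableOn_const (isCompact_closedBall x R).measure_lt_top.ne)
    · refine fun k => Eventually.of_forall fun y => ?_
      by_cases hy : y ∈ closedBall x R
      · rw [indicator_of_mem hy, Real.norm_of_nonneg (by positivity)]
        refine Real.rpow_le_one (abs_nonneg _) ?_ hp0.le
        rw [hv]; dsimp only
        rw [abs_mul, abs_of_nonneg (hη.nonneg y), abs_of_nonneg (by linarith [moll_le hm k y])]
        exact mul_le_one₀ (by linarith [moll_nonneg (Ω := Ω) k y]) (hη.nonneg y) (hη.le y)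
      · rw [indicator_of_notMem hy, hv]; dsimp only
        rw [hη.zero y fun h => hy (ball_subset_closedBall h), mul_zero, abs_zero,
          Real.zero_rpow hp0.ne', norm_zero]
    · filter_upwards [moll_ae hm] with y hy
      exact (((hy.const_sub 1).mul_const (η y)).abs).rpow_const (Or.inr hp0.le)
  have hmain := le_of_tendsto_of_tendsto hlim1 hlim2 (Eventually.of_forall fun k =>
    (hSob (v k) (hvC k) (hvc k)).trans (by
      dsimp only
      gcongr
      exact hDv k))
  have hL : mc Ω x r ≤ ∫ y, |(1 - chi Ω y) * η y| ^ pn n := by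
    have e : mc Ω x r = ∫ y, (closedBall x r \ Ω).indicator (fun _ => (1:ℝ)) y := by
      rw [integral_indicator (measurableSet_closedBall.diff hm)]
      simp [mc]
    rw [e]
    refine integral_mono_of_nonneg (Eventually.of_forall fun y => ?_) ?_
      (Eventually.of_forall fun y => ?_)
    · exact indicator_nonneg (fun _ _ => zero_le_one) y
    · have hm1 : Measurable (fun y => |(1 - chi Ω y) * η y| ^ pn n) :=
        (((chi_measurable hm).const_sub 1).mul hη1.continuous.measurable).abs.pow_const _
      refine Integrable.mono' (g := (closedBall x R).indicator fun _ => 1) ?_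
        hm1.aestronglyMeasurable (Eventually.of_forall fun y => ?_)
      · rw [integrable_indicator_iff measurableSet_closedBall]
        exact (integrableOn_const (isCompact_closedBall x R).measure_lt_top.ne)
      · by_cases hy : y ∈ closedBall x R
        · rw [indicator_of_mem hy, Real.norm_of_nonneg (by positivity)]
          refine Real.rpow_le_one (abs_nonneg _) ?_ hp0.le
          rw [abs_mul, abs_of_nonneg (hη.nonneg y), abs_of_nonneg (by linarith [chi_le Ω y])]
          exact mul_le_one₀ (by linarith [chi_nonneg Ω y]) (hη.nonneg y) (hη.le y)
        · rw [indicator_of_notMem hy]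
          rw [hη.zero y fun h => hy (ball_subset_closedBall h), mul_zero, abs_zero,
            Real.zero_rpow hp0.ne', norm_zero]
    · by_cases hy : y ∈ closedBall x r \ Ω
      · rw [indicator_of_mem hy]; dsimp only
        rw [hη.one y hy.1]
        simp [chi, hy.2]
      · rw [indicator_of_notMem hy]; dsimp only; positivity
  have hA : ∫ y, η y ∂μ ≤ μ.real (closedBall x R) := by
    have : μ.real (closedBall x R) = ∫ y, (closedBall x R).indicator (fun _ => (1:ℝ)) y ∂μ := by
      rw [integral_indicator measurableSet_closedBall]; simp
    rw [this]
    refine integral_mono_of_nonneg (Eventually.of_forall hη.nonneg) ?_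
      (Eventually.of_forall fun y => ?_)
    · exact (integrable_const 1).indicator measurableSet_closedBall
    · by_cases hy : y ∈ closedBall x R
      · rw [indicator_of_mem hy]; exact hη.le y
      · rw [indicator_of_notMem hy, hη.zero y fun h => hy (ball_subset_closedBall h)]
  have hB : (∫ y, ‖fderiv ℝ η y‖) - ∫ y in Ω, ‖fderiv ℝ η y‖ ≤
      C * ((mc Ω x R - mc Ω x r) / (R - r)) := by
    have hRr : 0 < R - r := by linarith
    rw [← integral_add_compl hm hDηi, add_sub_cancel_left]
    have : C * ((mc Ω x R - mc Ω x r) / (R - r)) =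
        ∫ y in Ωᶜ, (closedBall x R \ closedBall x r).indicator (fun _ => C / (R - r)) y := by
      rw [setIntegral_indicator (measurableSet_closedBall.diff measurableSet_closedBall),
        setIntegral_const, ← annulus_le hm hR.le, inter_comm, ← sdiff_eq, smul_eq_mul]
      ring
    rw [this]
    refine integral_mono_of_nonneg (Eventually.of_forall fun y => norm_nonneg _) ?_
      (Eventually.of_forall fun y => ?_)
    · refine Integrable.integrableOn ?_
      rw [integrable_indicator_iff (measurableSet_closedBall.diff measurableSet_closedBall)]
      exact (integrableOn_const (ne_top_of_le_ne_top (isCompact_closedBall x R).measure_lt_top.ne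
        (measure_mono sdiff_subset)))
    · by_cases hy : y ∈ closedBall x R \ closedBall x r
      · rw [indicator_of_mem hy]; exact hη.grad y
      · rw [indicator_of_notMem hy]; dsimp only
        rw [Set.mem_sdiff, not_and_or, not_not] at hy
        rcases hy with hy | hy
        · rw [fderiv_zero_of_eq_zero hη.nonneg
            (hη.zero y fun h => hy (ball_subset_closedBall h)), norm_zero]
        · rw [fderiv_zero_of_eq_one hη.le (hη.one y hy), norm_zero]
  refine hL.trans (hmain.trans ?_)
  gcongr
  refine add_nonneg (integral_nonneg hη.nonneg) ?_
  rw [← integral_add_compl hm hDηi, add_sub_cancel_left]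
  exact integral_nonneg fun _ => norm_nonneg _

end

lemma exists_PM {n : ℕ} (hn : 2 ≤ n) : ∃ K : ℝ, 0 < K ∧ ∀ Ω : Set (ES n), Bornology.IsBounded Ω →
    MeasurableSet Ω → perimeter Ω ≠ ⊤ → ∃ μ, PM K Ω μ := by
  obtain ⟨S, hS, hSob⟩ := sobolev hn
  obtain ⟨C, hC, hcut⟩ := exists_cut
  have hp0 : 0 < pn n := (pn_conj hn).symm.pos
  refine ⟨S * (1 + C) ^ pn n, by positivity, fun Ω hb hm hP => ?_⟩
  obtain ⟨μ, hfin, hmass, hlim⟩ := exists_weak_limit (fun k x => ‖fderiv ℝ (moll Ω k) x‖)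
    (moll_grad_int hb hm) (fun _ _ => norm_nonneg _) (moll_grad hb hm hP)
  have hcd := moll_contDiff1 hm
  refine ⟨μ, hfin, by rwa [ENNReal.ofReal_toReal hP] at hmass, ?_, ?_, ?_⟩
  · intro φ hφ hc
    refine le_of_tendsto_of_tendsto ((moll_tendsto hm (vdiv_integrable hφ hc)).mono_left UF_le)
      (hlim (fun x => ‖φ x‖) hφ.continuous.norm hc.norm) (Eventually.of_forall fun k => ?_)
    dsimp only
    rw [ibp (hcd k) hφ hc, ← integral_neg]
    refine integral_mono ((fderiv_app_continuous (hcd k) hφ).integrable_of_hasCompactSupport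
      (fderiv_app_cs hc)).neg ?_ fun x => ?_
    · exact (hφ.continuous.norm.mul ((hcd k).continuous_fderiv
        one_ne_zero).norm).integrable_of_hasCompactSupport hc.norm.mul_right
    · dsimp only
      refine (neg_le_abs _).trans ?_
      rw [mul_comm]
      exact (fderiv ℝ (moll Ω k) x).le_opNorm (φ x)
  · intro i
    set e : ES n := EuclideanSpace.single i 1 with he
    have hDi : ∀ k, Integrable (fun x => fderiv ℝ (moll Ω k) x e) := fun k =>
      (((hcd k).continuous_fderiv one_ne_zero).clm_apply
        continuous_const).integrable_of_hasCompactSupport ((moll_cs hb k).fderiv_apply (𝕜 := ℝ) _)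
    have hab : ∀ k x, |fderiv ℝ (moll Ω k) x e| ≤ ‖fderiv ℝ (moll Ω k) x‖ := by
      intro k x
      refine ((fderiv ℝ (moll Ω k) x).le_opNorm e).trans ?_
      rw [he, norm_single, mul_one]
    obtain ⟨ν, hνfin, _, hνlim⟩ := exists_weak_limit
      (fun k x => ‖fderiv ℝ (moll Ω k) x‖ + fderiv ℝ (moll Ω k) x e)
      (fun k => (moll_grad_int hb hm k).add (hDi k))
      (fun k x => by linarith [abs_le.1 (hab k x)])
      (M := (perimeter Ω).toReal) (fun k => by
        rw [integral_add (moll_grad_int hb hm k) (hDi k),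
          integral_fderiv_zero (hcd k) (moll_cs hb k), add_zero]
        exact moll_grad hb hm hP k)
    refine ⟨ν, hνfin, fun f hf hfc => ?_⟩
    have hfD : Integrable (fun x => fderiv ℝ f x e) :=
      ((hf.continuous_fderiv one_ne_zero).clm_apply
        continuous_const).integrable_of_hasCompactSupport (hfc.fderiv_apply (𝕜 := ℝ) _)
    refine tendsto_nhds_unique (hνlim f hf.continuous hfc) ?_
    refine ((hlim f hf.continuous hfc).sub ((moll_tendsto hm hfD).mono_left UF_le)).congr ?_
    intro k
    have h1 := ibp (hcd k) (φ := fun y => f y • e) (hf.smul contDiff_const) (hfc.smul_right)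
    have h2 : ∀ x, vdiv (fun y => f y • e) x = fderiv ℝ f x e := fun x =>
      vdiv_single i (hf.differentiable one_ne_zero x)
    simp_rw [h2] at h1
    rw [h1, sub_neg_eq_add, ← integral_add]
    · congr 1; ext x; simp [mul_add]
    · exact (hf.continuous.mul ((hcd k).continuous_fderiv
        one_ne_zero).norm).integrable_of_hasCompactSupport hfc.mul_right
    · exact (fderiv_app_continuous (hcd k) (hf.smul contDiff_const)).integrable_of_hasCompactSupport
        (fderiv_app_cs hfc.smul_right)
  · intro x r R hr hR
    obtain ⟨η, hη⟩ := hcut n x r R hr hR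
    have h := iso_aux hS hC hn hSob hb hm hlim hr hR hη
    refine h.trans ?_
    have h0 : 0 ≤ (mc Ω x R - mc Ω x r) / (R - r) :=
      div_nonneg (by linarith [mc_mono (Ω := Ω) (x := x) hR.le]) (by linarith)
    have h1 : 0 ≤ μ.real (closedBall x R) := measureReal_nonneg
    rw [mul_assoc, ← Real.mul_rpow (by positivity) (by positivity)]
    gcongr
    nlinarith
end
end

section
open MeasureTheory Metric Filter Set
open scoped ENNReal Topology NNReal

noncomputable section

open scoped Manifold ContDiff in
lemma urysohn {n : ℕ} {A U : Set (ES n)} (hA : IsCompact A) (hU : IsOpen U) (h : A ⊆ U) :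
    ∃ f : ES n → ℝ, ContDiff ℝ (⊤ : ℕ∞) f ∧ HasCompactSupport f ∧ tsupport f ⊆ U ∧
      (∀ᶠ x in 𝓝ˢ A, f x = 1) ∧ (∀ x, 0 ≤ f x) ∧ ∀ x, f x ≤ 1 := by
  obtain ⟨R, hR⟩ := hA.isBounded.subset_ball (0 : ES n)
  set V := U ∩ ball (0 : ES n) R with hV
  have hVo : IsOpen V := hU.inter isOpen_ball
  have hAV : A ⊆ V := subset_inter h hR
  obtain ⟨f, h0, h1, hI⟩ := exists_contMDiffMap_zero_one_nhds_of_isClosed (n := (⊤:ℕ∞)) 𝓘(ℝ, ES n)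
    hVo.isClosed_compl hA.isClosed (disjoint_compl_left_iff_subset.2 hAV)
  have hts : tsupport f ⊆ V := by
    intro x hx
    by_contra hxV
    have h2 : ∀ᶠ y in 𝓝 x, f y = 0 := by
      rw [eventually_nhdsSet_iff_forall] at h0
      exact h0 x hxV
    exact (notMem_tsupport_iff_eventuallyEq.2 h2) hx
  refine ⟨f, f.contMDiff.contDiff, ?_, hts.trans inter_subset_left, h1, fun x => (hI x).1,
    fun x => (hI x).2⟩
  refine HasCompactSupport.intro (isCompact_closedBall (0 : ES n) R) fun x hx => ?_
  by_contra hne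
  exact hx (ball_subset_closedBall (hts (subset_tsupport f hne)).2)

lemma meas_le {n : ℕ} {α β : Measure (ES n)} [IsFiniteMeasure α] [IsFiniteMeasure β]
    (h : ∀ f : ES n → ℝ, ContDiff ℝ (⊤ : ℕ∞) f → HasCompactSupport f → (∀ x, 0 ≤ f x) →
      (∀ x, f x ≤ 1) → ∫ x, f x ∂α ≤ ∫ x, f x ∂β) : α ≤ β := by
  have hK : ∀ A : Set (ES n), IsCompact A → α A ≤ β A := by
    intro A hA
    rw [A.measure_eq_iInf_isOpen β]
    refine le_iInf₂ fun U hAU => le_iInf fun hU => ?_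
    obtain ⟨f, hf, hc, hs, h1, h0, hle⟩ := urysohn hA hU hAU
    have hfi : ∀ γ : Measure (ES n), IsFiniteMeasure γ → Integrable f γ := fun γ _ =>
      hf.continuous.integrable_of_hasCompactSupport hc
    have e1 : α.real A ≤ ∫ x, f x ∂α := by
      have : α.real A = ∫ x, A.indicator (fun _ => (1:ℝ)) x ∂α := by
        rw [integral_indicator hA.measurableSet]; simp
      rw [this]
      refine integral_mono ((integrable_const _).indicator hA.measurableSet) (hfi α inferInstance)
        fun x => ?_
      by_cases hx : x ∈ A
      · rw [indicator_of_mem hx, h1.self_of_nhdsSet x hx]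
      · rw [indicator_of_notMem hx]; exact h0 x
    have e2 : ∫ x, f x ∂β ≤ β.real U := by
      have : β.real U = ∫ x, U.indicator (fun _ => (1:ℝ)) x ∂β := by
        rw [integral_indicator hU.measurableSet]; simp
      rw [this]
      refine integral_mono (hfi β inferInstance) ((integrable_const _).indicator hU.measurableSet)
        fun x => ?_
      by_cases hx : x ∈ U
      · rw [indicator_of_mem hx]; exact hle x
      · rw [indicator_of_notMem hx]
        exact (image_eq_zero_of_notMem_tsupport fun h => hx (hs h)).le
    have := (e1.trans (h f hf hc h0 hle)).trans e2
    exact (ENNReal.toReal_le_toReal (measure_ne_top _ _) (measure_ne_top _ _)).1 this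
  refine Measure.le_iff.2 fun s hs => ?_
  rw [hs.measure_eq_iSup_isCompact_of_ne_top (measure_ne_top α s)]
  exact iSup₂_le fun A hA => iSup_le fun hc => (hK A hc).trans (measure_mono hA)

section
variable {n : ℕ} {Ω : Set (ES n)} {K : ℝ} {μ : Measure (ES n)}

/-- near optimal fields -/
lemma PM.opt (h : PM K Ω μ) (hP : perimeter Ω ≠ ⊤) {κ : ℝ} (hκ : 0 < κ) :
    ∃ φ : ES n → ES n, Adm φ ∧ (perimeter Ω).toReal - κ < ∫ x in Ω, vdiv φ x ∧
    ∀ ζ : ES n → ℝ, ContDiff ℝ 1 ζ → (∀ x, 0 ≤ ζ x) → (∀ x, ζ x ≤ 1) →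
      ∫ x, ζ x ∂μ - κ ≤ ∫ x in Ω, vdiv (fun y => ζ y • φ y) x := by
  have := h.fin
  obtain ⟨φ, hφ, hlt⟩ := exists_adm Ω hκ
  refine ⟨φ, hφ, hlt, fun ζ hζ h0 h1 => ?_⟩
  have hζ' : ContDiff ℝ 1 (fun y => 1 - ζ y) := contDiff_const.sub hζ
  have hc := h.c1 (fun y => (1 - ζ y) • φ y) (hζ'.smul hφ.cd) (smul_cs hφ.cs)
  have hζi : Integrable ζ μ := by
    refine Integrable.mono' (integrable_const (1:ℝ)) hζ.continuous.aestronglyMeasurable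
      (Eventually.of_forall fun x => ?_)
    rw [Real.norm_of_nonneg (h0 x)]; exact h1 x
  have hle : ∫ x, ‖(1 - ζ x) • φ x‖ ∂μ ≤ ∫ x, (1 - ζ x) ∂μ := by
    refine integral_mono_of_nonneg (Eventually.of_forall fun x => norm_nonneg _)
      ((integrable_const _).sub hζi) (Eventually.of_forall fun x => ?_)
    dsimp only
    rw [norm_smul, Real.norm_of_nonneg (by linarith [h1 x])]
    exact mul_le_of_le_one_right (by linarith [h1 x]) (hφ.le x)
  rw [integral_sub (integrable_const _) hζi] at hle
  have hmass : ∫ _x, (1:ℝ) ∂μ ≤ (perimeter Ω).toReal := by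
    simp only [integral_const, smul_eq_mul, mul_one]
    exact ENNReal.toReal_mono hP h.mass
  have hsum : ∫ x in Ω, vdiv φ x = (∫ x in Ω, vdiv (fun y => ζ y • φ y) x) +
      ∫ x in Ω, vdiv (fun y => (1 - ζ y) • φ y) x := by
    rw [← integral_add]
    · congr 1; ext x
      rw [vdiv_smul (hζ.differentiable one_ne_zero x) (hφ.cd.differentiable one_ne_zero x),
        vdiv_smul (hζ'.differentiable one_ne_zero x) (hφ.cd.differentiable one_ne_zero x),
        fderiv_const_sub]
      simp; ring
    · exact (vdiv_integrable (hζ.smul hφ.cd) (smul_cs hφ.cs)).integrableOn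
    · exact (vdiv_integrable (hζ'.smul hφ.cd) (smul_cs hφ.cs)).integrableOn
  linarith

lemma PM.c2 (h : PM K Ω μ) (i : Fin n) {f : ES n → ℝ} (hf : ContDiff ℝ 1 f)
    (hc : HasCompactSupport f) :
    |∫ x in Ω, fderiv ℝ f x (EuclideanSpace.single i 1)| ≤ ∫ x, |f x| ∂μ := by
  set e : ES n := EuclideanSpace.single i 1 with he
  have key : ∀ g : ES n → ℝ, ContDiff ℝ 1 g → HasCompactSupport g →
      ∫ x in Ω, fderiv ℝ g x e ≤ ∫ x, |g x| ∂μ := by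
    intro g hg hgc
    have := h.c1 (fun y => g y • e) (hg.smul contDiff_const) hgc.smul_right
    have h2 : ∀ x, vdiv (fun y => g y • e) x = fderiv ℝ g x e := fun x =>
      vdiv_single i (hg.differentiable one_ne_zero x)
    simp_rw [h2, norm_smul, he, norm_single, mul_one, Real.norm_eq_abs] at this
    exact this
  rw [abs_le']
  refine ⟨key f hf hc, ?_⟩
  have := key (fun x => - f x) hf.neg hc.neg
  simp only [fderiv_fun_neg, abs_neg] at this
  rw [← integral_neg]
  simpa using this

lemma PM.normal (h : PM K Ω μ) (hn : 2 ≤ n) (hP : perimeter Ω ≠ ⊤) :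
    ∃ ν : Fin n → Measure (ES n), (∀ i, IsFiniteMeasure (ν i)) ∧ (∀ i, ∀ f : ES n → ℝ,
      ContDiff ℝ 1 f → HasCompactSupport f → ∫ x, f x ∂(ν i) = ∫ x, f x ∂μ -
      ∫ x in Ω, fderiv ℝ f x (EuclideanSpace.single i 1)) ∧
    ∀ᵐ x ∂μ, ∃ i, (∀ r, 0 < r → 0 < μ.real (closedBall x r)) ∧ ∀ᶠ r in 𝓝[>] (0:ℝ),
      μ.real (closedBall x r) ≤ 2 * n * |(ν i).real (closedBall x r) - μ.real (closedBall x r)| := by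
  have := h.fin
  choose ν hfin hν using h.c3
  refine ⟨ν, hfin, hν, ?_⟩
  have hle : ∀ i, ν i ≤ (2:ℝ≥0∞) • μ := by
    intro i
    have : IsFiniteMeasure ((2:ℝ≥0∞) • μ) := by
      have e : (2:ℝ≥0∞) • μ = (2:ℝ≥0) • μ := rfl
      rw [e]; infer_instance
    refine meas_le fun f hf hc h0 h1 => ?_
    have hf1 : ContDiff ℝ 1 f := hf.of_le (by exact_mod_cast le_top)
    rw [hν i f hf1 hc, integral_smul_measure]
    have h2 := h.c2 i hf1 hc
    simp_rw [fun x => abs_of_nonneg (h0 x)] at h2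
    have := (abs_le.1 h2).1
    simp
    linarith
  have hac : ∀ i, ν i ≪ μ := fun i => Measure.absolutelyContinuous_of_le_smul (hle i)
  set g : Fin n → ES n → ℝ := fun i x => ((ν i).rnDeriv μ x).toReal with hg
  have hgi : ∀ i, Integrable (g i) μ := fun i => Measure.integrable_toReal_rnDeriv
  have hgm : ∀ i, Measurable (g i) := fun i => (Measure.measurable_rnDeriv _ _).ennreal_toReal
  set s : ES n → ℝ := fun x => ∑ i, |1 - g i x| with hs
  have hs0 : ∀ x, 0 ≤ s x := fun x => Finset.sum_nonneg fun i _ => abs_nonneg _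
  have hsm : Measurable s := Finset.measurable_sum _ fun i _ => ((hgm i).const_sub 1).abs
  have hsi : Integrable s μ := integrable_finsetSum _ fun i _ => ((integrable_const 1).sub (hgi i)).abs
  -- representation
  have hrep : ∀ i, ∀ f : ES n → ℝ, ContDiff ℝ 1 f → HasCompactSupport f →
      ∫ x in Ω, fderiv ℝ f x (EuclideanSpace.single i 1) = ∫ x, f x * (1 - g i x) ∂μ := by
    intro i f hf hc
    have h1 := hν i f hf hc
    have hfi := hfin i
    have hd : (ν i).HaveLebesgueDecomposition μ := Measure.haveLebesgueDecomposition_of_sigmaFinite _ _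
    rw [← integral_rnDeriv_smul (hac i)] at h1
    obtain ⟨C, hC⟩ := hf.continuous.bounded_above_of_compact_support hc
    have hi1 : Integrable f μ := hf.continuous.integrable_of_hasCompactSupport hc
    have hi2 : Integrable (fun x => f x * g i x) μ :=
      (hgi i).bdd_mul hf.continuous.aestronglyMeasurable (Eventually.of_forall hC)
    have e : ∀ x, f x * (1 - g i x) = f x - f x * g i x := fun x => by ring
    simp_rw [e]
    rw [integral_sub hi1 hi2]
    have e2 : ∫ x, ((ν i).rnDeriv μ x).toReal • f x ∂μ = ∫ x, f x * g i x ∂μ := by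
      congr 1; ext x; simp [hg, mul_comm]
    linarith
  have hfin2 : IsFiniteMeasure (μ.withDensity fun x => ENNReal.ofReal (s x)) :=
    isFiniteMeasure_withDensity_ofReal hsi.hasFiniteIntegral
  have hcomp : μ ≤ μ.withDensity fun x => ENNReal.ofReal (s x) := by
    refine meas_le fun ζ hζ hc h0 h1 => ?_
    have hζ1 : ContDiff ℝ 1 ζ := hζ.of_le (by exact_mod_cast le_top)
    rw [integral_withDensity_eq_integral_toReal_smul hsm.ennreal_ofReal
      (Eventually.of_forall fun x => ENNReal.ofReal_lt_top)]
    simp_rw [ENNReal.toReal_ofReal (hs0 _), smul_eq_mul]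
    refine le_of_forall_pos_le_add fun κ hκ => ?_
    obtain ⟨φ, hφ, -, hopt⟩ := h.opt hP hκ
    have h2 := hopt ζ hζ1 h0 h1
    have hψ : ContDiff ℝ 1 (fun y => ζ y • φ y) := hζ1.smul hφ.cd
    have hcd : ∀ i, ContDiff ℝ 1 (fun y => (ζ y • φ y) i) := fun i =>
      (EuclideanSpace.proj i : ES n →L[ℝ] ℝ).contDiff.comp hψ
    have hψc : HasCompactSupport (fun y => ζ y • φ y) := smul_cs hφ.cs
    have hcs : ∀ i, HasCompactSupport (fun y => (ζ y • φ y) i) := fun i =>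
      hψc.comp_left (g := fun v : ES n => v i) rfl
    have e1 : ∫ x in Ω, vdiv (fun y => ζ y • φ y) x =
        ∑ i, ∫ x, (ζ x • φ x) i * (1 - g i x) ∂μ := by
      simp_rw [fun x => vdiv_eq_sum (hψ.differentiable one_ne_zero x)]
      rw [integral_finsetSum]
      · exact Finset.sum_congr rfl fun i _ => hrep i _ (hcd i) (hcs i)
      · intro i _
        refine Integrable.integrableOn ?_
        exact (((hcd i).continuous_fderiv one_ne_zero).clm_apply
          continuous_const).integrable_of_hasCompactSupport ((hcs i).fderiv_apply (𝕜 := ℝ) _)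
    have hIntg : ∀ i, Integrable (fun x => (ζ x • φ x) i * (1 - g i x)) μ := by
      intro i
      obtain ⟨C, hC⟩ := (hcd i).continuous.bounded_above_of_compact_support (hcs i)
      exact ((integrable_const 1).sub (hgi i)).bdd_mul (hcd i).continuous.aestronglyMeasurable
        (Eventually.of_forall hC)
    rw [e1, ← integral_finsetSum _ fun i _ => hIntg i] at h2
    have e3 : ∫ x, ∑ i, (ζ x • φ x) i * (1 - g i x) ∂μ ≤ ∫ x, s x * ζ x ∂μ := by
      refine integral_mono (integrable_finsetSum _ fun i _ => hIntg i) ?_ fun x => ?_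
      · refine hsi.mul_bdd (c := 1) hζ1.continuous.aestronglyMeasurable
          (Eventually.of_forall fun x => ?_)
        rw [Real.norm_of_nonneg (h0 x)]; exact h1 x
      · dsimp only
        rw [hs]; dsimp only
        rw [Finset.sum_mul]
        refine Finset.sum_le_sum fun i _ => ?_
        refine (le_abs_self _).trans ?_
        rw [abs_mul, mul_comm]
        gcongr
        have : |φ x i| ≤ 1 := (PiLp.norm_apply_le (φ x) i).trans (hφ.le x)
        simp only [PiLp.smul_apply, smul_eq_mul, abs_mul, abs_of_nonneg (h0 x)]
        exact mul_le_of_le_one_right (h0 x) this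
    linarith
  have hs1 : ∀ᵐ x ∂μ, (1:ℝ≥0∞) ≤ ENNReal.ofReal (s x) := by
    refine ae_le_of_forall_setLIntegral_le_of_sigmaFinite measurable_const fun t ht _ => ?_
    have h2 := hcomp t
    rw [withDensity_apply _ ht] at h2
    simpa using h2
  have hlim : ∀ᵐ x ∂μ, ∀ i, Tendsto (fun r => (ν i) (closedBall x r) / μ (closedBall x r))
      (𝓝[>] 0) (𝓝 ((ν i).rnDeriv μ x)) :=
    ae_all_iff.2 fun i => Besicovitch.ae_tendsto_rnDeriv (ν i) μ
  have hlt : ∀ᵐ x ∂μ, ∀ i, (ν i).rnDeriv μ x < ⊤ := ae_all_iff.2 fun i => Measure.rnDeriv_lt_top _ _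
  filter_upwards [hs1, hlim, hlt, Measure.support_mem_ae (μ := μ)] with x h1 h2 h3 h4
  have hsx : 1 ≤ s x := by simpa using h1
  have hpos : ∀ r, 0 < r → 0 < μ.real (closedBall x r) := by
    intro r hr
    have := (Measure.mem_support_iff_forall x).1 h4 _ (closedBall_mem_nhds x hr)
    exact ENNReal.toReal_pos this.ne' (measure_ne_top _ _)
  have hn0 : (0:ℝ) < n := by exact_mod_cast (by omega : 0 < n)
  obtain ⟨i, hi⟩ : ∃ i, 1 / (n:ℝ) ≤ |1 - g i x| := by
    by_contra! hcon
    have : s x < ∑ _i : Fin n, 1 / (n:ℝ) := by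
      refine Finset.sum_lt_sum_of_nonempty ⟨⟨0, by omega⟩, Finset.mem_univ _⟩ fun i _ => hcon i
    simp at this
    rw [mul_inv_cancel₀ hn0.ne'] at this
    linarith
  refine ⟨i, hpos, ?_⟩
  have h5 := (ENNReal.tendsto_toReal (h3 i).ne).comp (h2 i)
  have h6 : Tendsto (fun r => |1 - (ν i).real (closedBall x r) / μ.real (closedBall x r)|) (𝓝[>] 0)
      (𝓝 |1 - g i x|) := by
    refine ((h5.const_sub 1).abs).congr fun r => ?_
    simp [ENNReal.toReal_div, Measure.real]
  have h7 : 1 / (2 * (n:ℝ)) < |1 - g i x| := by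
    refine lt_of_lt_of_le ?_ hi
    exact one_div_lt_one_div_of_lt hn0 (by linarith)
  filter_upwards [h6.eventually (lt_mem_nhds h7), self_mem_nhdsWithin] with r hr hr0
  have hμr := hpos r hr0
  have e : 1 - (ν i).real (closedBall x r) / μ.real (closedBall x r) =
    - (((ν i).real (closedBall x r) - μ.real (closedBall x r)) / μ.real (closedBall x r)) := by
      field_simp; ring
  rw [e, abs_neg, abs_div, abs_of_pos hμr, div_lt_div_iff₀ (by positivity) hμr] at hr
  linarith
end
end
end

section
open MeasureTheory Metric Filter Set
open scoped ENNReal Topology NNReal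

noncomputable section

lemma mono_growth {F : ℝ → ℝ} (hF : Monotone F) {a b c : ℝ} (hab : a ≤ b)
    (h : ∀ s ∈ Ioo a b, DifferentiableAt ℝ F s → c ≤ deriv F s) : c * (b - a) ≤ F b - F a := by
  have h1 := (hF.monotoneOn (uIcc a b)).intervalIntegral_deriv_mem_uIcc
  have h2 : F a ≤ F b := hF hab
  rw [uIcc_of_le (by linarith)] at h1
  refine le_trans ?_ h1.2
  have e : c * (b - a) = ∫ _ in a..b, c := by simp; ring
  rw [e]
  refine intervalIntegral.integral_mono_ae_restrict hab (by simp)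
    (hF.monotoneOn (uIcc a b)).intervalIntegrable_deriv ?_
  rw [EventuallyLE, ← restrict_Ioo_eq_restrict_Icc, ae_restrict_iff' measurableSet_Ioo]
  filter_upwards [hF.ae_differentiableAt] with s hs hs'
  exact h s hs' hs

section
variable {n : ℕ} {Ω : Set (ES n)} {K C : ℝ} {μ : Measure (ES n)}

lemma mc_monotone (x : ES n) : Monotone (mc Ω x) := fun _ _ h => mc_mono h

lemma cut_compl (hm : MeasurableSet Ω) {x : ES n} {r R : ℝ} (hR : r < R) {η : ES n → ℝ}
    (hη : Cut C x r R η) :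
    ∫ y in Ωᶜ, ‖fderiv ℝ η y‖ ≤ C * ((mc Ω x R - mc Ω x r) / (R - r)) := by
  have hRr : 0 < R - r := by linarith
  have : C * ((mc Ω x R - mc Ω x r) / (R - r)) =
      ∫ y in Ωᶜ, (closedBall x R \ closedBall x r).indicator (fun _ => C / (R - r)) y := by
    rw [setIntegral_indicator (measurableSet_closedBall.diff measurableSet_closedBall),
      setIntegral_const, ← annulus_le hm hR.le, inter_comm, ← sdiff_eq, smul_eq_mul]
    ring
  rw [this]
  refine integral_mono_of_nonneg (Eventually.of_forall fun y => norm_nonneg _) ?_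
    (Eventually.of_forall fun y => ?_)
  · refine Integrable.integrableOn ?_
    rw [integrable_indicator_iff (measurableSet_closedBall.diff measurableSet_closedBall)]
    exact (integrableOn_const (ne_top_of_le_ne_top (isCompact_closedBall x R).measure_lt_top.ne
      (measure_mono sdiff_subset)))
  · by_cases hy : y ∈ closedBall x R \ closedBall x r
    · rw [indicator_of_mem hy]; exact hη.grad y
    · rw [indicator_of_notMem hy]; dsimp only
      rw [Set.mem_sdiff, not_and_or, not_not] at hy
      rcases hy with hy | hy
      · rw [fderiv_zero_of_eq_zero hη.nonneg
          (hη.zero y fun h => hy (ball_subset_closedBall h)), norm_zero]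
      · rw [fderiv_zero_of_eq_one hη.le (hη.one y hy), norm_zero]

lemma Cut.cd1 {x : ES n} {r R : ℝ} {η : ES n → ℝ} (hη : Cut C x r R η) : ContDiff ℝ 1 η :=
  hη.cd.of_le (by exact_mod_cast le_top)

lemma Cut.grad_int {x : ES n} {r R : ℝ} {η : ES n → ℝ} (hη : Cut C x r R η) :
    Integrable (fun y => ‖fderiv ℝ η y‖) :=
  (hη.cd1.continuous_fderiv one_ne_zero).norm.integrable_of_hasCompactSupport
    (hη.cs.fderiv (𝕜 := ℝ)).norm

lemma cut_bound (hm : MeasurableSet Ω) {x : ES n} {r R : ℝ} (hR : r < R) {η : ES n → ℝ}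
    (hη : Cut C x r R η) (i : Fin n) :
    |∫ y in Ω, fderiv ℝ η y (EuclideanSpace.single i 1)| ≤
      C * ((mc Ω x R - mc Ω x r) / (R - r)) := by
  have hDi : Integrable (fun x => fderiv ℝ η x (EuclideanSpace.single i 1)) :=
      ((hη.cd1.continuous_fderiv one_ne_zero).clm_apply
        continuous_const).integrable_of_hasCompactSupport (hη.cs.fderiv_apply (𝕜 := ℝ) _)
  have h0 := integral_fderiv_zero hη.cd1 hη.cs (EuclideanSpace.single i 1)
  rw [← integral_add_compl hm hDi] at h0
  have : ∫ y in Ω, fderiv ℝ η y (EuclideanSpace.single i 1) =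
    - ∫ y in Ωᶜ, fderiv ℝ η y (EuclideanSpace.single i 1) := by linarith
  rw [this, abs_neg]
  refine le_trans ?_ (cut_compl hm hR hη)
  refine abs_integral_le_integral_abs.trans (integral_mono hDi.integrableOn.abs
    hη.grad_int.integrableOn fun y => ?_)
  refine ((fderiv ℝ η y).le_opNorm _).trans ?_
  rw [norm_single, mul_one]

lemma cut_int (γ : Measure (ES n)) [IsFiniteMeasure γ] {x : ES n} {r R : ℝ} {η : ES n → ℝ}
    (hη : Cut C x r R η) : γ.real (closedBall x r) ≤ ∫ y, η y ∂γ ∧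
      ∫ y, η y ∂γ ≤ γ.real (closedBall x R) := by
  have hi : Integrable η γ := hη.cd.continuous.integrable_of_hasCompactSupport hη.cs
  have e : ∀ s, γ.real (closedBall x s) = ∫ y, (closedBall x s).indicator (fun _ => (1:ℝ)) y ∂γ := by
    intro s
    rw [integral_indicator measurableSet_closedBall]; simp
  constructor
  · rw [e]
    refine integral_mono ((integrable_const _).indicator measurableSet_closedBall) hi fun y => ?_
    by_cases hy : y ∈ closedBall x r
    · rw [indicator_of_mem hy, hη.one y hy]
    · rw [indicator_of_notMem hy]; exact hη.nonneg y
  · rw [e]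
    refine integral_mono hi ((integrable_const _).indicator measurableSet_closedBall) fun y => ?_
    by_cases hy : y ∈ closedBall x R
    · rw [indicator_of_mem hy]; exact hη.le y
    · rw [indicator_of_notMem hy, hη.zero y fun h => hy (ball_subset_closedBall h)]

lemma ball_right (γ : Measure (ES n)) [IsFiniteMeasure γ] (x : ES n) (r : ℝ) :
    Tendsto (fun h => γ.real (closedBall x (r + h))) (𝓝[>] 0) (𝓝 (γ.real (closedBall x r))) := by
  have h1 := tendsto_measure_biInter_gt (μ := γ) (s := fun h => closedBall x (r + h)) (a := (0:ℝ))
    (fun _ _ => measurableSet_closedBall.nullMeasurableSet)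
    (fun i j _ hij => closedBall_subset_closedBall (by linarith))
    ⟨1, one_pos, measure_ne_top _ _⟩
  have h2 : (⋂ h > (0:ℝ), closedBall x (r + h)) = closedBall x r := by
    ext y
    simp only [mem_iInter, mem_closedBall]
    constructor
    · intro h; exact le_of_forall_pos_le_add h
    · intro h s hs; linarith
  rw [h2] at h1
  exact (ENNReal.tendsto_toReal (measure_ne_top _ _)).comp h1

lemma deriv_right {F : ℝ → ℝ} {r d : ℝ} (h : HasDerivAt F d r) :
    Tendsto (fun h => (F (r + h) - F r) / h) (𝓝[>] 0) (𝓝 d) := by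
  refine ((hasDerivAt_iff_tendsto_slope_zero.1 h).mono_left
    (nhdsWithin_mono _ fun y (hy : 0 < y) => hy.ne')).congr fun h => ?_
  rw [smul_eq_mul]; ring

lemma flux_bound (hm : MeasurableSet Ω)
    (hcut : ∀ (n : ℕ) (x : ES n) (r R : ℝ), 0 < r → r < R → ∃ η : ES n → ℝ, Cut C x r R η)
    (ν : Measure (ES n)) [IsFiniteMeasure ν] [IsFiniteMeasure μ] {i : Fin n}
    (hν : ∀ f : ES n → ℝ,
      ContDiff ℝ 1 f → HasCompactSupport f → ∫ x, f x ∂ν = ∫ x, f x ∂μ -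
      ∫ x in Ω, fderiv ℝ f x (EuclideanSpace.single i 1)) {x : ES n} {r d : ℝ} (hr : 0 < r)
    (hd : HasDerivAt (mc Ω x) d r) :
    |ν.real (closedBall x r) - μ.real (closedBall x r)| ≤ C * d := by
  have hb : ∀ h > 0, ν.real (closedBall x r) - μ.real (closedBall x (r + h)) ≤
        C * ((mc Ω x (r + h) - mc Ω x r) / h) ∧
      μ.real (closedBall x r) - ν.real (closedBall x (r + h)) ≤
        C * ((mc Ω x (r + h) - mc Ω x r) / h) := by
    intro h hh
    obtain ⟨η, hη⟩ := hcut n x r (r + h) hr (by linarith)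
    have h1 := cut_bound hm (by linarith) hη i
    have h2 := hν η hη.cd1 hη.cs
    rw [add_sub_cancel_left, abs_le] at h1
    have h3 := cut_int ν hη
    have h4 := cut_int μ hη
    constructor <;> linarith [h1.1, h1.2, h3.1, h3.2, h4.1, h4.2]
  have hlim := (deriv_right hd).const_mul C
  rw [abs_le']
  constructor
  · refine le_of_tendsto_of_tendsto ((ball_right μ x r).const_sub _) hlim ?_
    filter_upwards [self_mem_nhdsWithin] with h hh using (hb h hh).1
  · have := le_of_tendsto_of_tendsto ((ball_right ν x r).const_sub (μ.real (closedBall x r))) hlim (by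
      filter_upwards [self_mem_nhdsWithin] with h hh using (hb h hh).2)
    linarith

lemma PM.iso' (h : PM K Ω μ) (hn : 2 ≤ n) {x : ES n} {r d : ℝ} (hr : 0 < r)
    (hd : HasDerivAt (mc Ω x) d r) : mc Ω x r ≤ K * (μ.real (closedBall x r) + d) ^ pn n := by
  have := h.fin
  have hp0 : 0 < pn n := (pn_conj hn).symm.pos
  have h1 := (((ball_right μ x r).add (deriv_right hd)).rpow_const (p := pn n)
    (Or.inr hp0.le)).const_mul K
  refine le_of_tendsto_of_tendsto tendsto_const_nhds h1 ?_
  filter_upwards [self_mem_nhdsWithin] with s hs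
  have := h.iso x r (r + s) hr (by linarith [mem_Ioi.1 hs])
  rwa [add_sub_cancel_left] at this

end

lemma lower_density {n : ℕ} (hn : 2 ≤ n) {K : ℝ} (hK : 0 < K) : ∃ c : ℝ, 0 < c ∧ ∀ (Ω : Set (ES n))
    (μ : Measure (ES n)), MeasurableSet Ω → perimeter Ω ≠ ⊤ → PM K Ω μ →
    ∀ᵐ x ∂μ, ∀ᶠ r in 𝓝[>] (0:ℝ), c * r ^ n ≤ mc Ω x r := by
  obtain ⟨C, hC, hcut⟩ := exists_cut
  have hp0 : 0 < pn n := (pn_conj hn).symm.pos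
  have hn0 : (0:ℝ) < n := by exact_mod_cast (by omega : 0 < n)
  have hn1 : (1:ℝ) < n := by exact_mod_cast (by omega : 1 < n)
  set A := 2 * n * C + 1 with hA
  have hA0 : 0 < A := by positivity
  set c := (A * n)⁻¹ * K⁻¹ ^ (pn n)⁻¹ with hc
  have hc0 : 0 < c := by positivity
  refine ⟨c ^ n, by positivity, fun Ω μ hm hP h => ?_⟩
  have := h.fin
  obtain ⟨ν, hfin, hν, hae⟩ := h.normal hn hP
  filter_upwards [hae] with x ⟨i, hpos, hev⟩
  have := hfin i
  obtain ⟨r0, hr0, hball⟩ := mem_nhdsGT_iff_exists_Ioo_subset.1 hev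
  have hr0' : 0 < r0 := hr0
  have hB : ∀ r ∈ Ioo 0 r0, ∀ d, HasDerivAt (mc Ω x) d r →
      μ.real (closedBall x r) ≤ 2 * n * C * d := by
    intro r hr d hd
    have h1 : μ.real (closedBall x r) ≤
      2 * n * |(ν i).real (closedBall x r) - μ.real (closedBall x r)| := hball hr
    have h2 := flux_bound hm hcut (ν i) (hν i) hr.1 hd
    calc _ ≤ _ := h1
      _ ≤ 2 * n * (C * d) := by gcongr
      _ = _ := by ring
  have hmpos : ∀ r ∈ Ioo 0 r0, 0 < mc Ω x r := by
    intro r hr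
    by_contra hcon
    have h0 : mc Ω x r = 0 := le_antisymm (not_lt.1 hcon) mc_nonneg
    have hd : HasDerivAt (mc Ω x) 0 (r / 2) := by
      refine (hasDerivAt_const (r / 2) (0:ℝ)).congr_of_eventuallyEq ?_
      filter_upwards [Iio_mem_nhds (show r / 2 < r by linarith [hr.1])] with s hs
      exact le_antisymm (h0 ▸ mc_mono (mem_Iio.1 hs).le) mc_nonneg
    have := hB (r / 2) ⟨by linarith [hr.1], by linarith [hr.1, hr.2]⟩ 0 hd
    linarith [hpos (r / 2) (by linarith [hr.1])]
  set F : ℝ → ℝ := fun r => mc Ω x r ^ (n:ℝ)⁻¹ with hF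
  have hF0 : ∀ r, 0 ≤ F r := fun r => Real.rpow_nonneg mc_nonneg _
  have hFn : ∀ r, mc Ω x r = F r ^ n := by
    intro r
    rw [hF]; dsimp only
    rw [Real.rpow_inv_natCast_pow mc_nonneg (by omega)]
  have hFmono : Monotone F := fun a b hab =>
    Real.rpow_le_rpow mc_nonneg (mc_mono hab) (by positivity)
  have hder : ∀ s ∈ Ioo 0 r0, DifferentiableAt ℝ F s → c ≤ deriv F s := by
    intro s hs hd
    have hFs : 0 < F s := Real.rpow_pos_of_pos (hmpos s hs) _
    set f' := deriv F s with hf'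
    have hf0 : 0 ≤ f' := hFmono.deriv_nonneg
    have hmd : HasDerivAt (mc Ω x) (n * F s ^ (n - 1) * f') s := by
      have := hd.hasDerivAt.pow n
      refine this.congr_of_eventuallyEq (Eventually.of_forall fun r => ?_)
      simpa using hFn r
    have h1 := h.iso' hn hs.1 hmd
    have h2 := hB s hs _ hmd
    have h3 : mc Ω x s ≤ K * (A * n * f' * F s ^ (n - 1)) ^ pn n := by
      refine h1.trans ?_
      gcongr
      rw [hA]; linarith
    rw [Real.mul_rpow (by positivity) (by positivity)] at h3
    have h4 : (F s ^ (n - 1)) ^ pn n = F s ^ n := by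
      rw [← Real.rpow_natCast, ← Real.rpow_natCast, ← Real.rpow_mul hFs.le]
      congr 1
      rw [Nat.cast_sub (by omega), pn]
      have : (n:ℝ) - 1 ≠ 0 := by linarith
      push_cast
      field_simp
    rw [h4, hFn s] at h3
    have hFsn : 0 < F s ^ n := by positivity
    have h5 : 1 ≤ K * (A * n * f') ^ pn n := by
      by_contra! hcon
      nlinarith
    have h6 : K⁻¹ ≤ (A * n * f') ^ pn n := by
      rw [inv_le_iff_one_le_mul₀ hK]; linarith
    have h7 : K⁻¹ ^ (pn n)⁻¹ ≤ A * n * f' := by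
      have := Real.rpow_le_rpow (by positivity) h6 (inv_nonneg.2 hp0.le)
      rwa [Real.rpow_rpow_inv (by positivity) hp0.ne'] at this
    rw [hc, inv_mul_le_iff₀ (by positivity)]
    exact h7
  have : Ioo 0 r0 ∈ 𝓝[>] (0:ℝ) := Ioo_mem_nhdsGT hr0'
  filter_upwards [this] with r hr
  have h1 := mono_growth hFmono hr.1.le (c := c) fun s hs => hder s ⟨hs.1, hs.2.trans hr.2⟩
  rw [hFn, ← mul_pow]
  have hcr : 0 ≤ c * r := mul_nonneg hc0.le hr.1.le
  gcongr
  linarith [hF0 0]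
end
end

section
open MeasureTheory Metric Filter Set
open scoped ENNReal Topology NNReal

noncomputable section

/-- countable covers by small balls with small total `(n-1)`-content -/
def SCov {n : ℕ} (T : Set (ES n)) (ρ : ℝ) (σ : ℝ≥0∞) : Prop :=
  ∃ (ι : Type) (_ : Countable ι) (x : ι → ES n) (r : ι → ℝ), (∀ i, 0 < r i ∧ r i ≤ ρ) ∧
    T ⊆ ⋃ i, ball (x i) (r i) ∧ ∑' i, ENNReal.ofReal (r i ^ (n-1)) ≤ σ

section
variable {n : ℕ} {Ω : Set (ES n)} {μ : Measure (ES n)} {K C : ℝ}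

lemma SCov.mono {T T' : Set (ES n)} {ρ ρ' : ℝ} {σ σ' : ℝ≥0∞} (h : SCov T ρ σ) (hT : T' ⊆ T)
    (hρ : ρ ≤ ρ') (hσ : σ ≤ σ') : SCov T' ρ' σ' := by
  obtain ⟨ι, hι, x, r, h1, h2, h3⟩ := h
  exact ⟨ι, hι, x, r, fun i => ⟨(h1 i).1, (h1 i).2.trans hρ⟩, hT.trans h2, h3.trans hσ⟩

lemma SCov.iUnion {J : Type} [Countable J] {T : J → Set (ES n)} {ρ : ℝ} {σ : J → ℝ≥0∞}
    (h : ∀ j, SCov (T j) ρ (σ j)) : SCov (⋃ j, T j) ρ (∑' j, σ j) := by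
  choose ι hι x r h1 h2 h3 using h
  refine ⟨Σ j, ι j, inferInstance, fun p => x p.1 p.2, fun p => r p.1 p.2, fun p => h1 p.1 p.2, ?_, ?_⟩
  · intro y hy
    obtain ⟨j, hj⟩ := mem_iUnion.1 hy
    obtain ⟨i, hi⟩ := mem_iUnion.1 (h2 j hj)
    exact mem_iUnion.2 ⟨⟨j, i⟩, hi⟩
  · rw [ENNReal.tsum_sigma']
    exact ENNReal.tsum_le_tsum h3

lemma SCov.union {A B : Set (ES n)} {ρ : ℝ} {σ σ' : ℝ≥0∞} (hA : SCov A ρ σ) (hB : SCov B ρ σ') :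
    SCov (A ∪ B) ρ (σ + σ') := by
  have := SCov.iUnion (J := Bool) (T := fun b => cond b A B) (ρ := ρ) (σ := fun b => cond b σ σ')
    (by rintro (_|_); exacts [hB, hA])
  rw [tsum_bool] at this
  exact this.mono (by rw [union_eq_iUnion]) le_rfl (by simp [add_comm])

lemma SCov.iUnion_pos {J : Type} [Countable J] {T : J → Set (ES n)} {ρ : ℝ}
    (h : ∀ j, ∀ σ > 0, SCov (T j) ρ σ) {σ : ℝ≥0∞} (hσ : 0 < σ) : SCov (⋃ j, T j) ρ σ := by
  obtain ⟨e, he, hs⟩ := ENNReal.exists_pos_sum_of_countable hσ.ne' J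
  exact (SCov.iUnion fun j => h j (e j) (by exact_mod_cast he j)).mono subset_rfl le_rfl hs.le

lemma vitali_cov {T W : Set (ES n)} {ρ c : ℝ} (hc : 0 < c) [IsFiniteMeasure μ]
    (h : ∀ x ∈ T, ∃ r, 0 < r ∧ r ≤ ρ ∧ closedBall x (2*r) ⊆ W ∧
      c * r^(n-1) ≤ μ.real (closedBall x (2*r))) :
    SCov T (11*ρ) (ENNReal.ofReal (11^(n-1)/c) * μ W) := by
  choose! r h1 h2 h3 h4 using h
  obtain ⟨u, hu, hd, hcov⟩ := Vitali.exists_disjoint_subfamily_covering_enlargement_closedBall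
    T id (fun x => 2 * r x) (2*ρ) (fun x hx => by linarith [h2 x hx]) 5 (by norm_num)
  have huc : u.Countable := hd.countable_of_nonempty_interior fun x hx => by
    refine ⟨x, ?_⟩
    exact ball_subset_interior_closedBall (mem_ball_self (by linarith [h1 x (hu hx)]))
  refine ⟨u, huc.to_subtype, fun x => x, fun x => 11 * r x, fun x => ⟨by linarith [h1 x (hu x.2)],
    by linarith [h2 x (hu x.2)]⟩, ?_, ?_⟩
  · intro x hx
    obtain ⟨b, hb, hxb⟩ := hcov x hx
    refine mem_iUnion.2 ⟨⟨b, hb⟩, ?_⟩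
    have := hxb (mem_closedBall_self (by linarith [h1 x hx]))
    refine closedBall_subset_ball ?_ this
    have := h1 b (hu hb)
    simp only; linarith
  · have hle : ∀ x : u, ENNReal.ofReal ((11 * r x)^(n-1)) ≤
        ENNReal.ofReal (11^(n-1)/c) * μ (closedBall (x:ES n) (2 * r x)) := by
      intro x
      rw [← ofReal_measureReal, ← ENNReal.ofReal_mul (by positivity)]
      refine ENNReal.ofReal_le_ofReal ?_
      rw [mul_pow, div_mul_eq_mul_div, mul_div_assoc]
      refine mul_le_mul_of_nonneg_left ?_ (by positivity)
      rw [le_div_iff₀ hc, mul_comm]; exact h4 x (hu x.2)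
    refine (ENNReal.tsum_le_tsum hle).trans ?_
    rw [ENNReal.tsum_mul_left]
    gcongr
    have : Countable u := huc.to_subtype
    rw [← measure_iUnion (ι := u) (f := fun x : u => closedBall (x:ES n) (2 * r x))
      (fun a b hab => hd a.2 b.2 (fun h => hab (Subtype.ext h)))
      (fun _ => measurableSet_closedBall)]
    exact measure_mono (iUnion_subset fun x => h3 x (hu x.2))

lemma SCov.hausdorff {T : Set (ES n)} {σ : ℝ≥0∞} (hn : 2 ≤ n) (h : ∀ ρ > 0, SCov T ρ σ) :
    μH[(n:ℝ)-1] T ≤ 2^(n-1) * σ := by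
  choose! ι hι x r h1 h2 h3 using h
  have hn' : ((n:ℝ)-1) = ((n-1:ℕ):ℝ) := by rw [Nat.cast_sub (by omega)]; simp
  have : ∀ k, Countable (ι (eps k)) := fun k => hι _ (eps_pos k)
  have ht : Tendsto (fun k => ENNReal.ofReal (2 * eps k)) atTop (𝓝 0) := by
    have := ENNReal.tendsto_ofReal (eps_tendsto.const_mul 2)
    simpa using this
  have hd : ∀ k i, ediam (ball (x (eps k) i) (r (eps k) i)) ≤ ENNReal.ofReal (2 * r (eps k) i) := by
    intro k i
    have := ediam_eball_le (x := x (eps k) i) (r := ENNReal.ofReal (r (eps k) i))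
    rw [eball_ofReal] at this
    rw [ENNReal.ofReal_mul (by norm_num)]
    simpa using this
  refine (Measure.hausdorffMeasure_le_liminf_tsum (ι := fun k => ι (eps k)) _ T _ ht
    (fun k i => ball (x (eps k) i) (r (eps k) i)) (Eventually.of_forall fun k i => ?_)
    (Eventually.of_forall fun k => h2 _ (eps_pos k))).trans ?_
  · exact (hd k i).trans (ENNReal.ofReal_le_ofReal (by linarith [(h1 _ (eps_pos k) i).2]))
  · refine (liminf_le_liminf (v := fun _ => 2^(n-1) * σ) (Eventually.of_forall fun k => ?_)).trans
      (by simp)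
    calc _ ≤ ∑' i, 2^(n-1) * ENNReal.ofReal ((r (eps k) i)^(n-1)) := by
          refine ENNReal.tsum_le_tsum fun i => ?_
          have h0 := (h1 _ (eps_pos k) i).1.le
          rw [hn', ENNReal.rpow_natCast, ENNReal.ofReal_pow h0, ← mul_pow]
          gcongr
          refine (hd k i).trans ?_
          rw [ENNReal.ofReal_mul (by norm_num)]; simp
      _ ≤ _ := by rw [ENNReal.tsum_mul_left]; gcongr; exact h3 _ (eps_pos k)

lemma scov_of_null {T : Set (ES n)} (hn : 2 ≤ n) (h : μH[(n:ℝ)-1] T = 0) {ρ : ℝ} (hρ : 0 < ρ)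
    {σ : ℝ≥0∞} (hσ : 0 < σ) : SCov T ρ σ := by
  have hn' : ((n:ℝ)-1) = ((n-1:ℕ):ℝ) := by rw [Nat.cast_sub (by omega)]; simp
  have hn1 : n - 1 ≠ 0 := by omega
  rw [Measure.hausdorffMeasure_apply] at h
  simp only [ENNReal.iSup_eq_zero] at h
  have h := h (ENNReal.ofReal (ρ/4)) (by simpa using by positivity)
  have hlt := h.trans_lt (ENNReal.half_pos hσ.ne')
  simp only [iInf_lt_iff] at hlt
  obtain ⟨t, ht1, ht2, ht3⟩ := hlt
  obtain ⟨e, he, hs⟩ := ENNReal.exists_pos_sum_of_countable (ENNReal.half_pos hσ.ne').ne' ℕ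
  have hfin : ∀ i, ediam (t i) ≠ ⊤ := fun i => ne_top_of_le_ne_top ENNReal.ofReal_ne_top (ht2 i)
  have key : ∀ i, ∃ r, (ediam (t i)).toReal < r ∧ r ≤ ρ ∧
      ENNReal.ofReal (r^(n-1)) ≤ ediam (t i) ^ ((n:ℝ)-1) + e i := by
    intro i
    set d := (ediam (t i)).toReal
    have hd0 : 0 ≤ d := ENNReal.toReal_nonneg
    have hd : d ≤ ρ/4 := ENNReal.toReal_le_of_le_ofReal (by positivity) (ht2 i)
    have hc : Tendsto (fun r : ℝ => r^(n-1)) (𝓝[>] d) (𝓝 (d^(n-1))) :=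
      ((continuous_pow (n-1)).tendsto d).mono_left nhdsWithin_le_nhds
    have h1 := hc.eventually_lt_const (show d^(n-1) < d^(n-1) + e i from
      lt_add_of_pos_right _ (by exact_mod_cast he i))
    have h2 : ∀ᶠ r in 𝓝[>] d, r < ρ := nhdsWithin_le_nhds (Iio_mem_nhds (by linarith))
    obtain ⟨r, hr1, hr2, hr3⟩ := (h1.and (h2.and self_mem_nhdsWithin)).exists
    refine ⟨r, hr3, hr2.le, ?_⟩
    refine (ENNReal.ofReal_le_ofReal hr1.le).trans ?_
    rw [ENNReal.ofReal_add (by positivity) (by positivity), hn', ENNReal.rpow_natCast,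
      ENNReal.ofReal_pow hd0, ENNReal.ofReal_toReal (hfin i)]
    simp
  choose r hr1 hr2 hr3 using key
  refine ⟨{i // (t i).Nonempty}, inferInstance, fun i => i.2.some, fun i => r i, fun i =>
    ⟨ENNReal.toReal_nonneg.trans_lt (hr1 i), hr2 i⟩, ?_, ?_⟩
  · intro y hy
    obtain ⟨i, hi⟩ := mem_iUnion.1 (ht1 hy)
    refine mem_iUnion.2 ⟨⟨i, ⟨y, hi⟩⟩, ?_⟩
    rw [mem_ball]
    refine lt_of_le_of_lt ?_ (hr1 i)
    rw [dist_edist]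
    exact ENNReal.toReal_mono (hfin i) (edist_le_ediam_of_mem hi (Set.Nonempty.some_mem _))
  · calc _ ≤ ∑' i : {i // (t i).Nonempty}, ((⨆ _ : (t i).Nonempty, ediam (t i) ^ ((n:ℝ)-1)) + e i) := by
          refine ENNReal.tsum_le_tsum fun i => (hr3 i).trans ?_
          rw [iSup_pos i.2]
      _ ≤ ∑' i, ((⨆ _ : (t i).Nonempty, ediam (t i) ^ ((n:ℝ)-1)) + e i) :=
          ENNReal.tsum_comp_le_tsum_of_injective Subtype.val_injective
            (fun i => ((⨆ _ : (t i).Nonempty, ediam (t i) ^ ((n:ℝ)-1)) + (e i : ℝ≥0∞)))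
      _ ≤ σ := by
          rw [ENNReal.tsum_add]
          exact (add_le_add ht3.le hs.le).trans (ENNReal.add_halves σ).le
end
end
end

section
open MeasureTheory Metric Filter Set
open scoped ENNReal Topology NNReal

noncomputable section

section
variable {n : ℕ} {Ω : Set (ES n)} {μ : Measure (ES n)} {K C : ℝ}

lemma c6 (hn : 2 ≤ n) (hK : 0 < K) : ∃ δ0 : ℝ, 0 < δ0 ∧ ∀ a, 0 < a → a ≤ δ0 →
    ∀ (Ω : Set (ES n)) (μ : Measure (ES n)), PM K Ω μ → ∀ x r, 0 < r → a * r^n ≤ mc Ω x r →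
    mc Ω x (2*r) ≤ 2 * a * (2*r)^n → a * r^(n-1) ≤ μ.real (closedBall x (2*r)) := by
  have hn1 : (1:ℝ) < n := by exact_mod_cast (by omega : 1 < n)
  have hp : 0 < pn n - 1 := by
    rw [pn, sub_pos, lt_div_iff₀ (by linarith)]; linarith
  set p := pn n with hpdef
  set A : ℝ := 1 + 2^(n+1) with hA
  have hA0 : 0 < A := by positivity
  set B := 2 * (K * A^p) with hB
  have hB0 : 0 < B := by positivity
  refine ⟨(1/B)^(1/(p-1)), by positivity, ?_⟩
  intro a ha had Ω μ h x r hr h1 h2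
  by_contra! hlt
  have hiso := h.iso x r (2*r) hr (by linarith)
  have e1 : μ.real (closedBall x (2*r)) + (mc Ω x (2*r) - mc Ω x r) / (2*r - r) ≤ A * a * r^(n-1) := by
    have : (mc Ω x (2*r) - mc Ω x r) / (2*r - r) ≤ 2^(n+1) * a * r^(n-1) := by
      rw [div_le_iff₀ (by linarith)]
      have hrn : r^n = r^(n-1) * r := by rw [← pow_succ]; congr 1; omega
      have : mc Ω x (2*r) - mc Ω x r ≤ 2 * a * (2*r)^n := by
        linarith [mc_nonneg (Ω := Ω) (x := x) (r := r)]
      rw [mul_pow, hrn] at this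
      calc _ ≤ _ := this
        _ = _ := by ring
    rw [hA]; linarith
  have e0 : 0 ≤ μ.real (closedBall x (2*r)) + (mc Ω x (2*r) - mc Ω x r) / (2*r - r) := by
    have := mc_mono (Ω := Ω) (x := x) (show r ≤ 2 * r by linarith)
    have : 0 ≤ (mc Ω x (2*r) - mc Ω x r) / (2*r - r) := div_nonneg (by linarith) (by linarith)
    positivity
  have e2 : a * r^n ≤ K * (A * a * r^(n-1))^p :=
    h1.trans (hiso.trans (mul_le_mul_of_nonneg_left (Real.rpow_le_rpow e0 e1 (by linarith)) hK.le))
  have e3 : (r^(n-1))^p = r^n := by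
    rw [← Real.rpow_natCast, ← Real.rpow_mul hr.le, ← Real.rpow_natCast]
    congr 1
    rw [hpdef, pn, Nat.cast_sub (by omega)]; push_cast
    field_simp [show (n:ℝ) - 1 ≠ 0 by linarith]
  rw [Real.mul_rpow (by positivity) (by positivity), e3, Real.mul_rpow hA0.le ha.le] at e2
  have e4 : a ^ p = a^(p-1) * a := by
    rw [← Real.rpow_add_one ha.ne']; congr 1; ring
  have e5 : a^(p-1) ≤ 1/B := by
    calc a^(p-1) ≤ ((1/B)^(1/(p-1)))^(p-1) := Real.rpow_le_rpow ha.le had hp.le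
      _ = 1/B := by rw [← Real.rpow_mul (by positivity), one_div_mul_cancel hp.ne', Real.rpow_one]
  have e6 : K * (A^p * a^p * r^n) ≤ 1/2 * (a * r^n) := by
    have : K * A^p * a^(p-1) ≤ 1/2 := by
      calc K * A^p * a^(p-1) ≤ K * A^p * (1/B) := mul_le_mul_of_nonneg_left e5 (by positivity)
        _ = 1/2 := by rw [hB]; field_simp
    rw [e4]
    calc _ = K * A^p * a^(p-1) * (a * r^n) := by ring
      _ ≤ _ := mul_le_mul_of_nonneg_right this (by positivity)
  have : 0 < a * r^n := by positivity
  linarith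

lemma dyadic {x : ES n} {δ r0 : ℝ} (hr0 : 0 < r0) (h0 : mc Ω x r0 < δ * r0^n) :
    (∃ r, 0 < r ∧ 2 * r ≤ r0 ∧ δ * r^n ≤ mc Ω x r ∧ mc Ω x (2*r) < δ * (2*r)^n) ∨
      ∀ r, 0 < r → r ≤ r0 → mc Ω x r < 2^n * δ * r^n := by
  classical
  by_cases hall : ∀ j : ℕ, mc Ω x (r0/2^j) < δ * (r0/2^j)^n
  · right
    intro r hr hrr
    have hδ : 0 < δ := by
      have : 0 < δ * r0^n := lt_of_le_of_lt mc_nonneg h0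
      exact pos_of_mul_pos_left this (by positivity)
    obtain ⟨j, hj1, hj2⟩ := exists_nat_pow_near (x := r0/r) (y := (2:ℝ))
      ((one_le_div hr).2 hrr) (by norm_num)
    have h1 : r ≤ r0/2^j := by
      rw [le_div_iff₀ (by positivity)] at hj1 ⊢; linarith
    have h2 : r0/2^j ≤ 2 * r := by
      rw [div_lt_iff₀ hr, pow_succ] at hj2
      rw [div_le_iff₀ (by positivity)]; linarith
    calc mc Ω x r ≤ mc Ω x (r0/2^j) := mc_mono h1
      _ < δ * (r0/2^j)^n := hall j
      _ ≤ δ * (2*r)^n := by gcongr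
      _ = _ := by rw [mul_pow]; ring
  · left
    push Not at hall
    obtain ⟨hf, hmin⟩ := And.intro (Nat.find_spec hall) (fun m => @Nat.find_min _ _ hall m)
    set j := Nat.find hall
    have hj : j ≠ 0 := by
      intro hj; rw [hj] at hf; simp at hf; linarith
    obtain ⟨i, hi⟩ := Nat.exists_eq_succ_of_ne_zero hj
    have e : 2 * (r0/2^j) = r0/2^i := by rw [hi, pow_succ]; field_simp
    refine ⟨r0/2^j, by positivity, ?_, hf, ?_⟩
    · rw [e]; exact div_le_self hr0.le (one_le_pow₀ (by norm_num))
    · rw [e]; have := hmin i (by omega); push Not at this; exact this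

lemma vol_cB (x : ES n) {r : ℝ} (hr : 0 ≤ r) :
    volume.real (closedBall x r) = r^n * volume.real (ball (0:ES n) 1) := by
  have := Measure.addHaar_real_closedBall (volume : Measure (ES n)) x hr
  simpa using this

lemma om_pos : 0 < volume.real (ball (0:ES n) 1) := by
  refine ENNReal.toReal_pos (measure_ball_pos _ _ one_pos).ne' measure_ball_lt_top.ne

lemma ratio_eq (hm : MeasurableSet Ω) (x : ES n) {r : ℝ} (hr : 0 < r) :
    volume (Ω ∩ ball x r) / volume (ball x r) =
      ENNReal.ofReal (1 - mc Ω x r / (r^n * volume.real (ball (0:ES n) 1))) := by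
  have hv : volume.real (ball x r) = r^n * volume.real (ball (0:ES n) 1) := by
    have := Measure.addHaar_ball_of_pos (volume : Measure (ES n)) x hr
    rw [Measure.real, this, ENNReal.toReal_mul, ENNReal.toReal_ofReal (by positivity)]
    simp [Measure.real]
  have hpos : 0 < volume.real (ball x r) := by rw [hv]; have := om_pos (n := n); positivity
  have hmc : mc Ω x r = volume.real (ball x r \ Ω) := by
    rw [mc]
    refine measureReal_congr ?_
    have hae : (ball x r : Set (ES n)) =ᵐ[volume] closedBall x r := by
      refine ae_eq_of_subset_of_measure_ge ball_subset_closedBall ?_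
        measurableSet_ball.nullMeasurableSet (isCompact_closedBall x r).measure_lt_top.ne
      rw [← ofReal_measureReal (isCompact_closedBall x r).measure_lt_top.ne, vol_cB x hr.le, ← hv,
        ofReal_measureReal measure_ball_lt_top.ne]
    exact hae.symm.diff (ae_eq_refl _)
  have hsum : volume.real (ball x r) = volume.real (Ω ∩ ball x r) + mc Ω x r := by
    rw [hmc, inter_comm]
    exact (measureReal_inter_add_sdiff hm measure_ball_lt_top.ne).symm
  rw [← hv]
  have : 1 - mc Ω x r / volume.real (ball x r) = volume.real (Ω ∩ ball x r) / volume.real (ball x r) := by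
    field_simp; linarith
  rw [this, ENNReal.ofReal_div_of_pos hpos, ofReal_measureReal measure_ball_lt_top.ne,
    ofReal_measureReal (ne_top_of_le_ne_top measure_ball_lt_top.ne (measure_mono inter_subset_right))]

lemma dens_iff (hm : MeasurableSet Ω) (x : ES n) :
    x ∈ densityPts Ω 1 ↔ Tendsto (fun r => mc Ω x r / r^n) (𝓝[>] 0) (𝓝 0) := by
  have hω := om_pos (n := n)
  set ω := volume.real (ball (0:ES n) 1)
  have hcong : (fun r => volume (Ω ∩ ball x r) / volume (ball x r)) =ᶠ[𝓝[>] 0]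
      fun r => ENNReal.ofReal (1 - mc Ω x r / (r^n * ω)) := by
    filter_upwards [self_mem_nhdsWithin] with r hr using ratio_eq hm x hr
  have hnn : ∀ᶠ r in 𝓝[>] (0:ℝ), 0 ≤ 1 - mc Ω x r / (r^n * ω) := by
    filter_upwards [self_mem_nhdsWithin] with r hr
    have hr : 0 < r := hr
    rw [sub_nonneg, div_le_one (by positivity), ← vol_cB x hr.le]
    exact measureReal_mono sdiff_subset (isCompact_closedBall x r).measure_lt_top.ne
  have : x ∈ densityPts Ω 1 ↔ Tendsto (fun r => volume (Ω ∩ ball x r) / volume (ball x r)) (𝓝[>] 0) (𝓝 1) := Iff.rfl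
  rw [this, tendsto_congr' hcong]
  constructor
  · intro h
    have h2 := (ENNReal.tendsto_toReal ENNReal.one_ne_top).comp h
    have h3 : Tendsto (fun r => 1 - mc Ω x r / (r^n * ω)) (𝓝[>] 0) (𝓝 1) := by
      refine (h2.congr' ?_)
      filter_upwards [hnn] with r hr
      simp [ENNReal.toReal_ofReal hr]
    have h4 := (h3.const_sub 1).mul_const ω
    simp only [sub_self, zero_mul] at h4
    refine h4.congr fun r => ?_
    field_simp
    ring
  · intro h
    have h2 := (h.div_const ω).const_sub 1
    have h3 := ENNReal.tendsto_ofReal h2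
    simp only [zero_div, sub_zero, ENNReal.ofReal_one] at h3
    refine h3.congr fun r => ?_
    rw [div_div]

lemma dens_lt (hm : MeasurableSet Ω) {x : ES n} (hx : x ∈ densityPts Ω 1) {a : ℝ} (ha : 0 < a) :
    ∀ᶠ r in 𝓝[>] (0:ℝ), mc Ω x r < a * r^n := by
  filter_upwards [((dens_iff hm x).1 hx).eventually_lt_const ha, self_mem_nhdsWithin] with r h1 h2
  have : 0 < r := h2
  rwa [div_lt_iff₀ (by positivity)] at h1

lemma dens_of (hm : MeasurableSet Ω) {x : ES n}
    (h : ∀ m : ℕ, ∀ᶠ r in 𝓝[>] (0:ℝ), mc Ω x r < eps m * r^n) : x ∈ densityPts Ω 1 := by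
  rw [dens_iff hm]
  refine tendsto_order.2 ⟨fun a ha => ?_, fun a ha => ?_⟩
  · filter_upwards [self_mem_nhdsWithin] with r h2
    have : 0 < r := h2
    exact ha.trans_le (div_nonneg mc_nonneg (by positivity))
  · obtain ⟨m, hm⟩ := (eps_tendsto.eventually_lt_const ha).exists
    filter_upwards [h m, self_mem_nhdsWithin] with r h1 h2
    have : 0 < r := h2
    rw [div_lt_iff₀ (by positivity)]
    exact h1.trans (by gcongr)

lemma federer {b : ℝ} (hn : 2 ≤ n) (hm : MeasurableSet Ω) (hP : perimeter Ω ≠ ⊤)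
    (h : PM K Ω μ)
    (hδ : ∀ a, 0 < a → a ≤ b → ∀ x r, 0 < r → a * r^n ≤ mc Ω x r →
      mc Ω x (2*r) ≤ 2 * a * (2*r)^n → a * r^(n-1) ≤ μ.real (closedBall x (2*r)))
    (hl : ∀ᵐ x ∂μ, ∀ᶠ r in 𝓝[>] (0:ℝ), b * r ^ n ≤ mc Ω x r)
    {ρ : ℝ} (hρ : 0 < ρ) {σ : ℝ≥0∞} (hσ : 0 < σ) :
    SCov {x | x ∉ densityPts Ω 1 ∧ ∀ᶠ r in 𝓝[>] (0:ℝ), mc Ω x r < b * r^n} ρ σ := by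
  have := h.fin
  set N := {x | x ∉ densityPts Ω 1 ∧ ∀ᶠ r in 𝓝[>] (0:ℝ), mc Ω x r < b * r^n} with hN
  have hN0 : μ N = 0 := by
    refine measure_mono_null ?_ (ae_iff.1 hl)
    rintro x ⟨-, hx⟩ hx'
    obtain ⟨r, h1, h2⟩ := (hx.and hx').exists
    linarith
  have hNm : N ⊆ ⋃ m : ℕ, {x | x ∈ N ∧ ∃ᶠ r in 𝓝[>] (0:ℝ), eps m * r^n ≤ mc Ω x r} := by
    intro x hx
    by_contra hcon
    simp only [mem_iUnion, Set.mem_ofPred_eq, not_exists, not_and, not_frequently, not_le] at hcon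
    exact hx.1 (dens_of hm fun m => hcon m hx)
  refine SCov.mono (SCov.iUnion_pos (T := fun m : ℕ =>
    {x | x ∈ N ∧ ∃ᶠ r in 𝓝[>] (0:ℝ), eps m * r^n ≤ mc Ω x r}) ?_ hσ) hNm le_rfl le_rfl
  intro m σ hσ
  set a := eps m with ha
  have ha0 : 0 < a := eps_pos m
  set D := ENNReal.ofReal (11^(n-1)/a) with hD
  have hD0 : D ≠ 0 := by
    rw [hD]; simp; positivity
  obtain ⟨W, hW, hWo, hμW⟩ := Set.exists_isOpen_lt_of_lt (μ := μ) N (σ / D) (by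
    rw [hN0]; exact ENNReal.div_pos hσ.ne' ENNReal.ofReal_ne_top)
  have hfin : D * μ W ≤ σ := by
    rw [mul_comm]; exact (ENNReal.le_div_iff_mul_le (Or.inl hD0) (Or.inl ENNReal.ofReal_ne_top)).1 hμW.le
  refine SCov.mono (vitali_cov (μ := μ) (W := W) (ρ := ρ/11) (c := a) ha0 ?_) subset_rfl (by linarith) hfin
  rintro x ⟨hx, hfr⟩
  -- a good radius
  obtain ⟨ε1, hε1, hball⟩ := Metric.isOpen_iff.1 hWo x (hW hx)
  obtain ⟨ε2, hε2, hb2⟩ := (mem_nhdsGT_iff_exists_Ioo_subset).1 hx.2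
  have hε2 : 0 < ε2 := hε2
  set R := min (min (ε1/2) (ε2/2)) (ρ/11) with hR
  have hR0 : 0 < R := by positivity
  have hRlt : ∀ r, 0 < r → r ≤ R → mc Ω x r < b * r^n := fun r h0 h1 =>
    hb2 ⟨h0, by
      have : R ≤ ε2/2 := (min_le_left _ _).trans (min_le_right _ _)
      linarith⟩
  obtain ⟨J, hJ⟩ := pow_unbounded_of_one_lt (b/a) (show (1:ℝ) < 2 by norm_num)
  have hsm : ∀ᶠ r in 𝓝[>] (0:ℝ), r < R/2^J :=
    nhdsWithin_le_nhds (Iio_mem_nhds (show (0:ℝ) < R/2^J by positivity))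
  obtain ⟨s, hs1, hs2, hs0⟩ := (hfr.and_eventually (hsm.and self_mem_nhdsWithin)).exists
  have hs0 : 0 < s := hs0
  have hsJ : 2^J * s ≤ R := by
    rw [lt_div_iff₀ (by positivity)] at hs2; linarith
  have hex : ∃ j, ¬ (2^j * a * (2^j * s)^n ≤ mc Ω x (2^j * s)) := by
    refine ⟨J, ?_⟩
    rw [not_le]
    refine (hRlt _ (by positivity) hsJ).trans ?_
    rw [div_lt_iff₀ ha0] at hJ
    gcongr
  classical
  obtain ⟨hf, hmin⟩ := And.intro (Nat.find_spec hex) (fun m => @Nat.find_min _ _ hex m)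
  have hjJ : Nat.find hex ≤ J := Nat.find_min' hex (by
    rw [not_le]
    refine (hRlt _ (by positivity) hsJ).trans ?_
    rw [div_lt_iff₀ ha0] at hJ
    gcongr)
  set j := Nat.find hex
  have hj0 : j ≠ 0 := by
    intro hj; rw [hj] at hf; simp at hf; linarith
  obtain ⟨i, hi⟩ := Nat.exists_eq_succ_of_ne_zero hj0
  have hPi := hmin i (by omega)
  rw [not_not] at hPi
  rw [hi] at hf
  have hle : 2^(i+1) * s ≤ R := by
    refine le_trans ?_ hsJ
    gcongr
    · norm_num
    · omega
  have e1 : (2:ℝ)^(i+1) * s = 2 * (2^i * s) := by ring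
  have hr0 : 0 < 2^i * s := by positivity
  rw [Nat.succ_eq_add_one, e1, not_le] at hf
  rw [e1] at hle
  have hab : 2^i * a ≤ b := by
    have h1 := hPi.trans_lt (hRlt (2^i * s) hr0 (by linarith))
    exact (lt_of_mul_lt_mul_right h1 (by positivity)).le
  have h6 := hδ (2^i * a) (by positivity) hab x (2^i * s) hr0 hPi (by
    refine hf.le.trans (le_of_eq ?_); ring)
  refine ⟨2^i * s, hr0, ?_, ?_, ?_⟩
  · have : R ≤ ρ/11 := min_le_right _ _
    linarith
  · refine (closedBall_subset_ball ?_).trans hball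
    have : R ≤ ε1/2 := (min_le_left _ _).trans (min_le_left _ _)
    linarith
  · refine le_trans ?_ h6
    have : (1:ℝ) ≤ 2^i := one_le_pow₀ (by norm_num)
    gcongr
    nlinarith
end
end
end

section
open MeasureTheory Metric Filter Set
open scoped ENNReal Topology NNReal

noncomputable section

section
variable {n : ℕ} {Ω : Set (ES n)} {μ : Measure (ES n)} {K C : ℝ}

lemma l1_int {E : ℕ → Set (ES n)} (hm : MeasurableSet Ω) (hE : ∀ k, MeasurableSet (E k))
    (h : TendstoL1 E Ω) {g : ES n → ℝ} (hg : Integrable g) :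
    Tendsto (fun k => ∫ x in E k, g x) atTop (𝓝 (∫ x in Ω, g x)) := by
  have t1 : Tendsto (fun k => ∫ x in E k \ Ω, g x) atTop (𝓝 0) :=
    hg.tendsto_setIntegral_nhds_zero
      (tendsto_of_tendsto_of_tendsto_of_le_of_le tendsto_const_nhds h (fun _ => zero_le)
        fun k => measure_mono subset_union_left)
  have t2 : Tendsto (fun k => ∫ x in Ω \ E k, g x) atTop (𝓝 0) :=
    hg.tendsto_setIntegral_nhds_zero
      (tendsto_of_tendsto_of_tendsto_of_le_of_le tendsto_const_nhds h (fun _ => zero_le)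
        fun k => measure_mono subset_union_right)
  have := (t1.sub t2).const_add (∫ x in Ω, g x)
  simp only [sub_zero, add_zero] at this
  refine this.congr fun k => ?_
  have e1 := integral_inter_add_sdiff (μ := volume) (f := g) (s := E k) hm hg.integrableOn
  have e2 := integral_inter_add_sdiff (μ := volume) (f := g) (s := Ω) (hE k) hg.integrableOn
  rw [inter_comm] at e2
  linarith

lemma smooth_compl {E : Set (ES n)} (hE : IsSmoothSet E) {x : ES n} (hx : x ∉ E) :
    ∀ᶠ r in 𝓝[>] (0:ℝ), (1/4)^n * volume.real (ball (0:ES n) 1) * r^n ≤ mc E x r := by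
  obtain ⟨-, -, f, hf, hEf, hfr, hd⟩ := hE
  have hfx : 0 ≤ f x := by rw [hEf] at hx; simpa using hx
  have hω := om_pos (n := n)
  -- it suffices to find a ball of radius r/4
  suffices h : ∀ᶠ r in 𝓝[>] (0:ℝ), ∃ y, closedBall y (r/4) ⊆ closedBall x r \ E by
    filter_upwards [h, self_mem_nhdsWithin] with r ⟨y, hy⟩ hr
    have hr : 0 < r := hr
    have := measureReal_mono (μ := volume) hy (ne_top_of_le_ne_top
      (isCompact_closedBall x r).measure_lt_top.ne (measure_mono sdiff_subset))
    rw [vol_cB y (by positivity)] at this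
    refine le_trans (le_of_eq ?_) this
    rw [div_pow, div_pow]; ring
  rcases hfx.lt_or_eq with h0 | h0
  · have : ∀ᶠ y in 𝓝 x, 0 < f y := hf.continuous.continuousAt.eventually_const_lt h0
    obtain ⟨ε, hε, hb⟩ := Metric.eventually_nhds_iff_ball.1 this
    have hsm : ∀ᶠ r in 𝓝[>] (0:ℝ), r < ε := nhdsWithin_le_nhds (Iio_mem_nhds hε)
    filter_upwards [hsm, self_mem_nhdsWithin] with r h1 h2
    have h2 : 0 < r := h2
    refine ⟨x, fun y hy => ⟨closedBall_subset_closedBall (by linarith) hy, ?_⟩⟩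
    rw [hEf]
    have := hb y (closedBall_subset_ball (by linarith) hy)
    simp only [mem_ofPred_eq, not_lt]; exact this.le
  · have hxf : x ∈ frontier E := by rw [hfr]; exact h0.symm
    have hne := hd x hxf
    set D := fderiv ℝ f x with hD
    have hDpos : 0 < ‖D‖ := norm_pos_iff.2 hne
    set g := (InnerProductSpace.toDual ℝ (ES n)).symm D with hg
    have hgn : ‖g‖ = ‖D‖ := by rw [hg]; simp
    have hDg : ∀ v, D v = inner ℝ g v := fun v => by rw [hg]; simp
    set v := (1/‖D‖) • g with hv
    have hvn : ‖v‖ = 1 := by rw [hv, norm_smul, hgn]; simp [hDpos.ne']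
    have hDv : D v = ‖D‖ := by
      rw [hv, map_smul, hDg, real_inner_self_eq_norm_sq, hgn, smul_eq_mul]; field_simp
    have hder : HasFDerivAt f D x := (hf.differentiable (by simp) x).hasFDerivAt
    have hlit := hder.isLittleO.def (show 0 < ‖D‖/8 by positivity)
    obtain ⟨ε, hε, hb⟩ := Metric.eventually_nhds_iff_ball.1 hlit
    have hsm : ∀ᶠ r in 𝓝[>] (0:ℝ), r < ε := nhdsWithin_le_nhds (Iio_mem_nhds hε)
    filter_upwards [hsm, self_mem_nhdsWithin] with r h1 h2
    have h2 : 0 < r := h2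
    refine ⟨x + (r/2) • v, fun y hy => ?_⟩
    rw [mem_closedBall, dist_eq_norm] at hy
    set z := y - (x + (r/2) • v) with hz
    have hyx : y - x = (r/2) • v + z := by rw [hz]; abel
    have hyn : ‖y - x‖ ≤ r := by
      rw [hyx]
      refine (norm_add_le _ _).trans ?_
      rw [norm_smul, hvn, Real.norm_of_nonneg (by positivity)]; linarith
    refine ⟨by rw [mem_closedBall, dist_eq_norm]; exact hyn, ?_⟩
    have hyb := hb y (by rw [mem_ball, dist_eq_norm]; linarith)
    rw [← h0, sub_zero, hyx, map_add, map_smul, hDv, smul_eq_mul] at hyb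
    have hDz : |D z| ≤ ‖D‖ * (r/4) := (D.le_opNorm z).trans (by gcongr)
    rw [← hyx] at hyb
    have h3 := (abs_le.1 (hyb.trans (mul_le_mul_of_nonneg_left hyn (by positivity)))).1
    have h4 := (abs_le.1 hDz).1
    have : 0 < r * ‖D‖ := by positivity
    rw [hEf]; simp only [mem_ofPred_eq, not_lt]
    nlinarith

lemma PM.mass_ge (h : PM K Ω μ) : (perimeter Ω).toReal ≤ μ.real univ := by
  have := h.fin
  have h2 : perimeter Ω ≤ ENNReal.ofReal (μ.real univ) := by
    refine per_le fun φ hφ => (h.c1 φ hφ.cd hφ.cs).trans ?_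
    have := norm_setIntegral_le_of_norm_le_const (μ := μ) (s := univ) (f := fun x => ‖φ x‖) (C := 1)
      (measure_lt_top _ _) (fun x _ => by simpa using hφ.le x)
    simp only [Measure.restrict_univ, one_mul] at this
    exact (le_abs_self _).trans this
  exact ENNReal.toReal_le_of_le_ofReal measureReal_nonneg h2

lemma bdd_int (γ : Measure (ES n)) [IsFiniteMeasure γ] {f : ES n → ℝ} (hf : Continuous f)
    (h0 : ∀ x, 0 ≤ f x) (h1 : ∀ x, f x ≤ 1) : Integrable f γ :=
  Integrable.of_bound hf.aestronglyMeasurable 1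
    (Eventually.of_forall fun x => by rw [Real.norm_of_nonneg (h0 x)]; exact h1 x)

set_option maxHeartbeats 800000 in
lemma mu_limsup {E : ℕ → Set (ES n)} (hm : MeasurableSet Ω) (hE : ∀ k, MeasurableSet (E k))
    (h : TendstoL1 E Ω) (hP : perimeter Ω ≠ ⊤)
    (hPE : Tendsto (fun k => perimeter (E k)) atTop (𝓝 (perimeter Ω))) (hμ : PM K Ω μ)
    {ξ : ES n → ℝ} (hξ : ContDiff ℝ 1 ξ) (h0 : ∀ x, 0 ≤ ξ x) (h1 : ∀ x, ξ x ≤ 1) {κ : ℝ} (hκ : 0 < κ) :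
    ∀ᶠ k in atTop, ∀ ν, PM K (E k) ν → ∫ x, ξ x ∂ν ≤ ∫ x, ξ x ∂μ + κ := by
  have := hμ.fin
  obtain ⟨φ, hφ, -, hopt⟩ := hμ.opt hP (show 0 < κ/4 by positivity)
  have hζ : ContDiff ℝ 1 fun x => 1 - ξ x := contDiff_const.sub hξ
  have ho := hopt (fun x => 1 - ξ x) hζ (fun x => by linarith [h1 x]) (fun x => by linarith [h0 x])
  set ψ : ES n → ES n := fun y => (1 - ξ y) • φ y with hψ
  have hψc : ContDiff ℝ 1 ψ := hζ.smul hφ.cd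
  have hψs : HasCompactSupport ψ := smul_cs (f := fun y => 1 - ξ y) hφ.cs
  have ht := l1_int hm hE h (vdiv_integrable hψc hψs)
  have hPr := (ENNReal.tendsto_toReal hP).comp hPE
  have l1 : (∫ x in Ω, vdiv ψ x) - κ/4 < ∫ x in Ω, vdiv ψ x := by linarith
  have l2 : (perimeter Ω).toReal < (perimeter Ω).toReal + κ/4 := by linarith
  filter_upwards [ht.eventually_const_lt l1, hPr.eventually_lt_const l2,
    hPE.eventually_lt_const hP.lt_top] with k e1 e2 e3 ν hν
  have := hν.fin
  have f1 := hν.c1 ψ hψc hψs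
  have iν := bdd_int ν hξ.continuous h0 h1
  have iμ := bdd_int μ hξ.continuous h0 h1
  have f2 : ∫ x, ‖ψ x‖ ∂ν ≤ ∫ x, (1 - ξ x) ∂ν := by
    refine integral_mono (hψc.continuous.norm.integrable_of_hasCompactSupport hψs.norm)
      ((integrable_const _).sub iν) fun x => ?_
    simp only [hψ, norm_smul]
    rw [Real.norm_of_nonneg (by linarith [h1 x])]
    exact mul_le_of_le_one_right (by linarith [h1 x]) (hφ.le x)
  rw [integral_sub (integrable_const _) iν] at f2
  rw [integral_sub (integrable_const _) iμ] at ho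
  simp only [integral_const, smul_eq_mul, mul_one] at f2 ho
  have f3 : ν.real univ ≤ (perimeter (E k)).toReal := ENNReal.toReal_mono e3.ne hν.mass
  have f4 := hμ.mass_ge
  simp only [Function.comp] at e2
  linarith
end
end
end

section
open MeasureTheory Metric Filter Set
open scoped ENNReal Topology NNReal

noncomputable section

section
variable {n : ℕ} {Ω : Set (ES n)} {μ : Measure (ES n)} {K C : ℝ}

lemma mc_le_add {E : Set (ES n)} (hb : Bornology.IsBounded Ω) (x : ES n) (r : ℝ) :
    mc E x r ≤ mc Ω x r + volume.real (Ω \ E) := by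
  have hfin : volume (Ω \ E) ≠ ⊤ :=
    ne_top_of_le_ne_top hb.measure_lt_top.ne (measure_mono sdiff_subset)
  have hfin' : volume (closedBall x r \ Ω) ≠ ⊤ := ne_top_of_le_ne_top
      (isCompact_closedBall x r).measure_lt_top.ne (measure_mono sdiff_subset)
  refine (measureReal_mono (h₂ := measure_union_ne_top hfin' hfin) ?_).trans (measureReal_union_le _ _)
  intro y hy
  by_cases h : y ∈ Ω
  · exact Or.inr ⟨h, hy.2⟩
  · exact Or.inl ⟨hy.1, h⟩

lemma backward_aux (hn : 2 ≤ n) (hK : 0 < K)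
    (hPM : ∀ Ω : Set (ES n), Bornology.IsBounded Ω →
      MeasurableSet Ω → perimeter Ω ≠ ⊤ → ∃ μ, PM K Ω μ) (hb : Bornology.IsBounded Ω)
    (hm : MeasurableSet Ω)
    (hP : perimeter Ω ≠ ⊤) (hμ : PM K Ω μ) {E : ℕ → Set (ES n)} (hE : ∀ k, IsSmoothSet (E k))
    (hEΩ : ∀ k, E k ⊆ Ω) (hL : TendstoL1 E Ω)
    (hPE : Tendsto (fun k => perimeter (E k)) atTop (𝓝 (perimeter Ω)))
    {δ r1 : ℝ} (hδ : 0 < δ) (hr1 : 0 < r1)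
    (hδ6 : ∀ (Ω : Set (ES n)) (μ : Measure (ES n)), PM K Ω μ → ∀ x r, 0 < r → δ * r^n ≤ mc Ω x r →
      mc Ω x (2*r) ≤ 2 * δ * (2*r)^n → δ * r^(n-1) ≤ μ.real (closedBall x (2*r)))
    (hδ1 : 2^n * δ ≤ (1/4)^n * volume.real (ball (0:ES n) 1))
    {A W : Set (ES n)} (hA : IsCompact A) (hW : IsOpen W) (hAW : A ⊆ W) {η : ℝ} (hη : 0 < η)
    (hμW : μ.real W ≤ η) :
    μH[(n:ℝ)-1] {x | x ∈ A ∧ (∀ k, x ∉ E k) ∧ ∀ r, 0 < r → r ≤ r1 → mc Ω x r < δ/2 * r^n} ≤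
      2^(n-1) * (ENNReal.ofReal (11^(n-1)/δ) * ENNReal.ofReal (2*η)) := by
  have := hμ.fin
  refine SCov.hausdorff hn fun ρ hρ => ?_
  obtain ⟨ξ, hξ, hξc, hξs, hξ1, hξ0, hξle⟩ := urysohn hA hW hAW
  obtain ⟨U, hU, hAU, hU1⟩ := mem_nhdsSet_iff_exists.1 hξ1
  obtain ⟨rs, hrs, hth⟩ := hA.exists_cthickening_subset_open hU hAU
  set r0 := min (min r1 rs) (ρ/11) with hr0
  have hr00 : 0 < r0 := by positivity
  have hlim := mu_limsup (K := K) hm (fun k => (hE k).1.measurableSet) hL hP hPE hμ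
    (hξ.of_le (by exact_mod_cast le_top)) hξ0 hξle hη
  have hv : Tendsto (fun k => volume.real (Ω \ E k)) atTop (𝓝 0) := by
    have t : Tendsto (fun k => volume (Ω \ E k)) atTop (𝓝 0) :=
      tendsto_of_tendsto_of_tendsto_of_le_of_le tendsto_const_nhds hL (fun _ => zero_le)
        fun k => measure_mono subset_union_right
    exact (ENNReal.tendsto_toReal ENNReal.zero_ne_top).comp t
  obtain ⟨k, h1, h2, h3⟩ := (hlim.and ((hv.eventually_lt_const
    (show 0 < δ/2 * r0^n by positivity)).and (hPE.eventually_lt_const hP.lt_top))).exists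
  obtain ⟨ν, hν⟩ := hPM (E k) (hE k).2.1 (hE k).1.measurableSet h3.ne
  have := hν.fin
  have hνU : ν U ≤ ENNReal.ofReal (2*η) := by
    rw [← ofReal_measureReal]
    refine ENNReal.ofReal_le_ofReal ?_
    have e1 := h1 ν hν
    have iμ := bdd_int μ hξ.continuous hξ0 hξle
    have iν := bdd_int ν hξ.continuous hξ0 hξle
    have e2 : ∫ x, ξ x ∂μ ≤ μ.real W := by
      rw [← integral_indicator_one hW.measurableSet]
      refine integral_mono iμ ((integrable_const 1).indicator hW.measurableSet) fun x => ?_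
      by_cases hx : x ∈ W
      · simpa [hx] using hξle x
      · have : ξ x = 0 := image_eq_zero_of_notMem_tsupport fun h => hx (hξs h)
        simp [hx, this]
    have e3 : ν.real U ≤ ∫ x, ξ x ∂ν := by
      rw [← integral_indicator_one hU.measurableSet]
      refine integral_mono ((integrable_const 1).indicator hU.measurableSet) iν fun x => ?_
      by_cases hx : x ∈ U
      · have : ξ x = 1 := hU1 hx
        simp [hx, this]
      · simpa [hx] using hξ0 x
    linarith
  refine SCov.mono (vitali_cov (μ := ν) (W := U) (ρ := ρ/11) (c := δ) hδ ?_) subset_rfl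
    (by linarith) (by gcongr)
  rintro x ⟨hxA, hxE, hxr⟩
  have hr01 : r0 ≤ r1 := (min_le_left _ _).trans (min_le_left _ _)
  have hr0s : r0 ≤ rs := (min_le_left _ _).trans (min_le_right _ _)
  have hr0ρ : r0 ≤ ρ/11 := min_le_right _ _
  have hstart : mc (E k) x r0 < δ * r0^n := by
    have := mc_le_add (E := E k) hb x r0
    have := hxr r0 hr00 hr01
    linarith
  rcases dyadic hr00 hstart with ⟨r, hr, hrr, g1, g2⟩ | hbad
  · refine ⟨r, hr, by linarith, ?_, hδ6 _ _ hν x r hr g1 ?_⟩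
    · refine Subset.trans ?_ hth
      refine (closedBall_subset_closedBall (hrr.trans hr0s)).trans ?_
      exact closedBall_subset_cthickening hxA rs
    · refine g2.le.trans ?_
      have : 0 < (2*r)^n := by positivity
      nlinarith
  · exfalso
    have hsm : ∀ᶠ r in 𝓝[>] (0:ℝ), r < r0 := nhdsWithin_le_nhds (Iio_mem_nhds hr00)
    obtain ⟨r, e1, e2, e3⟩ := ((smooth_compl (hE k) (hxE k)).and (hsm.and self_mem_nhdsWithin)).exists
    have e3 : 0 < r := e3
    have := hbad r e3 e2.le
    have : 2^n * δ * r^n ≤ (1/4)^n * volume.real (ball (0:ES n) 1) * r^n := by gcongr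
    linarith

lemma backward (hn : 2 ≤ n) (hb : Bornology.IsBounded Ω) (hm : MeasurableSet Ω)
    (hP : perimeter Ω ≠ ⊤) {E : ℕ → Set (ES n)} (hE : ∀ k, IsSmoothSet (E k))
    (hEc : ∀ k, CpctContained (E k) Ω) (hL : TendstoL1 E Ω)
    (hPE : Tendsto (fun k => perimeter (E k)) atTop (𝓝 (perimeter Ω))) :
    μH[(n:ℝ)-1] (frontier Ω ∩ densityPts Ω 1) = 0 := by
  obtain ⟨K, hK, hPM⟩ := exists_PM hn
  obtain ⟨μ, hμ⟩ := hPM Ω hb hm hP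
  have := hμ.fin
  obtain ⟨δ0, hδ0, h6⟩ := c6 hn hK
  obtain ⟨c0, hc0, hlow⟩ := lower_density hn hK
  have hω := om_pos (n := n)
  set δ := min δ0 ((1/4)^n * volume.real (ball (0:ES n) 1) / 2^n) with hδ
  have hδp : 0 < δ := by positivity
  set S := frontier Ω ∩ densityPts Ω 1 with hS
  have hEΩ : ∀ k, E k ⊆ Ω := fun k => subset_closure.trans (hEc k).2
  have hSE : ∀ x ∈ S, ∀ k, x ∉ E k := by
    intro x hx k hxk
    exact hx.1.2 ((hE k).1.subset_interior_iff.2 (hEΩ k) hxk)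
  have hS0 : μ S = 0 := by
    refine measure_mono_null ?_ (ae_iff.1 (hlow Ω μ hm hP hμ))
    rintro x ⟨-, hx⟩ hx'
    obtain ⟨r, h1, h2⟩ := ((dens_lt hm hx hc0).and hx').exists
    linarith
  have hSj : S = ⋃ j : ℕ, {x | x ∈ S ∧ ∀ r, 0 < r → r ≤ eps j → mc Ω x r < δ/2 * r^n} := by
    ext x
    simp only [mem_iUnion, mem_ofPred_eq, exists_and_left]
    refine ⟨fun hx => ⟨hx, ?_⟩, fun h => h.1⟩
    obtain ⟨ε, hε, hb⟩ := mem_nhdsGT_iff_exists_Ioo_subset.1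
      (dens_lt hm hx.2 (show 0 < δ/2 by positivity))
    obtain ⟨j, hj⟩ := (eps_tendsto.eventually_lt_const (show (0:ℝ) < ε from hε)).exists
    exact ⟨j, fun r h0 h1 => hb ⟨h0, by linarith⟩⟩
  rw [hSj]
  refine measure_iUnion_null fun j => ?_
  have hD : ENNReal.ofReal (11^(n-1)/δ) ≠ ⊤ := ENNReal.ofReal_ne_top
  suffices hh : ∀ η : ℝ, 0 < η → μH[(n:ℝ)-1]
      {x | x ∈ S ∧ ∀ r, 0 < r → r ≤ eps j → mc Ω x r < δ/2 * r^n} ≤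
      2^(n-1) * (ENNReal.ofReal (11^(n-1)/δ) * ENNReal.ofReal (2*η)) by
    have ht : Tendsto (fun k => 2^(n-1) * (ENNReal.ofReal (11^(n-1)/δ) * ENNReal.ofReal (2*eps k)))
        atTop (𝓝 0) := by
      have t1 := ENNReal.tendsto_ofReal (eps_tendsto.const_mul 2)
      have t2 := ENNReal.Tendsto.const_mul (ENNReal.Tendsto.const_mul t1 (Or.inr hD))
        (Or.inr (show (2:ℝ≥0∞)^(n-1) ≠ ⊤ by simp))
      simpa using t2
    exact le_antisymm (ge_of_tendsto' ht fun k => hh _ (eps_pos k)) zero_le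
  intro η hη
  obtain ⟨W, hSW, hW, hμW⟩ := Set.exists_isOpen_lt_of_lt (μ := μ) S (ENNReal.ofReal η) (by
    rw [hS0]; simpa using hη)
  have hμW' : μ.real W ≤ η := ENNReal.toReal_le_of_le_ofReal hη.le hμW.le
  obtain ⟨F, hFc, hFW, hFU, hFm⟩ := hW.exists_iUnion_isClosed
  have hcl : IsCompact (closure Ω) := hb.isCompact_closure
  have hsub : {x | x ∈ S ∧ ∀ r, 0 < r → r ≤ eps j → mc Ω x r < δ/2 * r^n} ⊆
      ⋃ m, {x | x ∈ closure Ω ∩ F m ∧ (∀ k, x ∉ E k) ∧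
        ∀ r, 0 < r → r ≤ eps j → mc Ω x r < δ/2 * r^n} := by
    rintro x ⟨hx, hxr⟩
    have hxW := hSW hx
    rw [← hFU] at hxW
    obtain ⟨m, hm⟩ := mem_iUnion.1 hxW
    exact mem_iUnion.2 ⟨m, ⟨hx.1.1, hm⟩, hSE x hx, hxr⟩
  refine (measure_mono hsub).trans ?_
  have hmono : Monotone fun m => {x | x ∈ closure Ω ∩ F m ∧ (∀ k, x ∉ E k) ∧
        ∀ r, 0 < r → r ≤ eps j → mc Ω x r < δ/2 * r^n} :=
    fun a b hab x hx => ⟨⟨hx.1.1, hFm hab hx.1.2⟩, hx.2⟩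
  rw [hmono.measure_iUnion]
  refine iSup_le fun m => ?_
  refine backward_aux hn hK hPM hb hm hP hμ hE hEΩ hL hPE hδp (eps_pos j) ?_ ?_
    (hcl.inter_right (hFc m)) hW (inter_subset_right.trans (hFW m)) hη hμW'
  · exact fun Ω μ h => h6 δ hδp (min_le_left _ _) Ω μ h
  · have : δ ≤ (1/4)^n * volume.real (ball (0:ES n) 1) / 2^n := min_le_right _ _
    rw [le_div_iff₀ (by positivity)] at this
    linarith
end
end
end

section
open MeasureTheory Metric Filter Set
open scoped ENNReal Topology NNReal

noncomputable section

section
variable {n : ℕ} {Ω : Set (ES n)} {μ : Measure (ES n)} {K C : ℝ}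

lemma mc_measurable (hm : MeasurableSet Ω) (r : ℝ) : Measurable fun y => mc Ω y r := by
  set A : Set (ES n × ES n) := {p | dist p.2 p.1 ≤ r} ∩ {p | p.2 ∉ Ω} with hA
  have hAm : MeasurableSet A := by
    refine MeasurableSet.inter ?_ ?_
    · exact (isClosed_le (by fun_prop) continuous_const).measurableSet
    · exact measurable_snd hm.compl
  have h := (measurable_measure_prodMk_left (ν := (volume : Measure (ES n))) hAm).ennreal_toReal
  exact h

lemma bad_tendsto [IsFiniteMeasure μ] (hm : MeasurableSet Ω) {c : ℝ} {t : ℕ → ℝ}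
    (ht : Tendsto t atTop (𝓝[>] 0))
    (hl : ∀ᵐ x ∂μ, ∀ᶠ r in 𝓝[>] (0:ℝ), c * r ^ n ≤ mc Ω x r) :
    Tendsto (fun k => μ {y | mc Ω y (t k) < c * (t k)^n}) atTop (𝓝 0) := by
  have hmeas : ∀ k, MeasurableSet {y | mc Ω y (t k) < c * (t k)^n} := fun k =>
    measurableSet_lt (mc_measurable hm _) measurable_const
  have := tendsto_measure_of_ae_tendsto_indicator_of_isFiniteMeasure (μ := μ) (L := atTop) (A := ∅)
    MeasurableSet.empty hmeas (by
      filter_upwards [hl] with x hx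
      filter_upwards [ht.eventually hx] with k hk
      simpa using hk)
  simpa using this

lemma front_of_dens (hm : MeasurableSet Ω) {x : ES n} (hx : x ∈ densityPts Ω 1)
    (hi : x ∉ interior Ω) : x ∈ frontier Ω := by
  refine ⟨?_, hi⟩
  by_contra hcl
  obtain ⟨ε, hε, hb⟩ := Metric.isOpen_iff.1 isClosed_closure.isOpen_compl x hcl
  have hsm : ∀ᶠ r in 𝓝[>] (0:ℝ), r < ε := nhdsWithin_le_nhds (Iio_mem_nhds hε)
  obtain ⟨r, h1, h2, h3⟩ := ((dens_lt hm hx (om_pos (n := n))).and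
    (hsm.and self_mem_nhdsWithin)).exists
  have h3 : 0 < r := h3
  have : closedBall x r \ Ω = closedBall x r := by
    refine sdiff_eq_left.2 (disjoint_left.2 fun y hy hy' => ?_)
    exact hb (closedBall_subset_ball h2 hy) (subset_closure hy')
  rw [mc, this, vol_cB x h3.le, mul_comm] at h1
  exact lt_irrefl _ h1

lemma cover_K (hn : 2 ≤ n) (hb : Bornology.IsBounded Ω) (hm : MeasurableSet Ω)
    (hP : perimeter Ω ≠ ⊤) (hS : μH[(n:ℝ)-1] (frontier Ω ∩ densityPts Ω 1) = 0) :
    ∃ η0 : ℝ, 0 < η0 ∧ η0 < 1/2 ∧ ∀ σ : ℝ≥0∞, 0 < σ → ∀ᶠ k in atTop,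
      SCov {x | 1 - η0 ≤ moll Ω k x ∧ x ∉ interior Ω} 1 σ := by
  obtain ⟨K, hK, hPM⟩ := exists_PM hn
  obtain ⟨μ, hμ⟩ := hPM Ω hb hm hP
  have := hμ.fin
  obtain ⟨δ0, hδ0, h6⟩ := c6 hn hK
  obtain ⟨c0, hc0, hlow⟩ := lower_density hn hK
  have hlow := hlow Ω μ hm hP hμ
  have hω := om_pos (n := n)
  set ω := volume.real (ball (0:ES n) 1) with hωd
  set b := min δ0 c0 with hbd
  have hb0 : 0 < b := by positivity
  set δ := b / 2^n with hδ
  have hδp : 0 < δ := by positivity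
  have hδb : 2^n * δ = b := by rw [hδ]; field_simp
  have hδle : δ ≤ b := div_le_self hb0.le (one_le_pow₀ (by norm_num))
  set η0 := min (1/4) (δ / (2 * (ω * 4^n))) with hη0
  refine ⟨η0, by positivity, (min_le_left _ _).trans_lt (by norm_num), fun σ hσ => ?_⟩
  have hη0' : η0 * (ω * 4^n) < δ := by
    have : η0 ≤ δ / (2 * (ω * 4^n)) := min_le_right _ _
    rw [le_div_iff₀ (by positivity)] at this
    linarith
  set D := ENNReal.ofReal (11^(n-1)/δ) with hD
  have ht : Tendsto (fun k => eps k / 4) atTop (𝓝[>] 0) := by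
    refine tendsto_nhdsWithin_iff.2 ⟨by simpa using eps_tendsto.div_const 4, ?_⟩
    exact Eventually.of_forall fun k => div_pos (eps_pos k) (by norm_num)
  have hG := bad_tendsto (μ := μ) hm ht hlow
  have hDG := ENNReal.Tendsto.const_mul hG (Or.inr (show D ≠ ⊤ from ENNReal.ofReal_ne_top))
  rw [mul_zero] at hDG
  have hσ2 : 0 < σ/2 := ENNReal.half_pos hσ.ne'
  have hσ4 : 0 < σ/2/2 := ENNReal.half_pos hσ2.ne'
  filter_upwards [hDG.eventually_lt_const hσ2, eps_tendsto.eventually_lt_const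
    (show (0:ℝ) < 8/11 by norm_num)] with k hk hek
  have hep := eps_pos k
  set R := eps k / 2 with hR
  set T1 := {x | 1 - η0 ≤ moll Ω k x ∧ ∃ r, 0 < r ∧ 2 * r ≤ R/2 ∧ δ * r^n ≤ mc Ω x r ∧
    mc Ω x (2*r) < δ * (2*r)^n} with hT1
  -- density at scale R
  have hdens : ∀ x, 1 - η0 ≤ moll Ω k x → mc Ω x R < δ * (R/2)^n := by
    intro x hx
    have h1 := moll_density hm k x
    rw [vol_cB 0 hep.le] at h1
    have h2 : mc Ω x R ≤ η0 * (eps k ^ n * ω) :=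
      h1.trans (mul_le_mul_of_nonneg_right (by linarith) (by positivity))
    have h3 : eps k = 4 * (R/2) := by rw [hR]; ring
    refine h2.trans_lt ?_
    rw [h3, mul_pow]
    have : 0 < (R/2)^n := by positivity
    nlinarith
  have cov1 : SCov T1 1 (σ/2) := by
    refine SCov.mono (vitali_cov (μ := μ) (W := {y | mc Ω y (eps k/4) < c0 * (eps k/4)^n})
      (ρ := 1/11) (c := δ) hδp ?_) subset_rfl (by norm_num) hk.le
    rintro x ⟨hx, r, hr, hrr, g1, g2⟩
    refine ⟨r, hr, by linarith, fun y hy => ?_, ?_⟩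
    · have e4 : eps k/4 = R/2 := by rw [hR]; ring
      have e1 : mc Ω y (R/2) ≤ mc Ω x R := by
        refine measureReal_mono (sdiff_subset_sdiff_left (closedBall_subset_closedBall' ?_))
          (ne_top_of_le_ne_top (isCompact_closedBall x R).measure_lt_top.ne
            (measure_mono sdiff_subset))
        rw [mem_closedBall] at hy
        linarith
      show mc Ω y (eps k/4) < c0 * (eps k/4)^n
      rw [e4]
      refine (e1.trans_lt (hdens x hx)).trans_le ?_
      have : δ ≤ c0 := hδle.trans (min_le_right _ _)
      gcongr
    · refine h6 δ hδp (hδle.trans (min_le_left _ _)) Ω μ hμ x r hr g1 (g2.le.trans ?_)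
      have : 0 < (2*r)^n := by positivity
      nlinarith
  have cov2 := federer (b := b) hn hm hP hμ (fun a ha hab => h6 a ha (hab.trans (min_le_left _ _)) Ω μ hμ)
    (by
      filter_upwards [hlow] with x hx
      filter_upwards [hx, self_mem_nhdsWithin] with r h1 h2
      have h2 : 0 < r := h2
      refine le_trans ?_ h1
      have : b ≤ c0 := min_le_right _ _
      gcongr) one_pos hσ4
  have cov3 := scov_of_null hn hS one_pos hσ4
  refine SCov.mono (cov1.union (cov2.union cov3)) ?_ le_rfl
    (by rw [ENNReal.add_halves, ENNReal.add_halves])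
  rintro x ⟨hx, hxi⟩
  have hR2 : 0 < R/2 := by positivity
  have hst : mc Ω x (R/2) < δ * (R/2)^n := (mc_mono (by linarith)).trans_lt (hdens x hx)
  rcases dyadic hR2 hst with hc | hall
  · exact Or.inl ⟨hx, hc⟩
  · right
    by_cases hd : x ∈ densityPts Ω 1
    · exact Or.inr ⟨front_of_dens hm hd hxi, hd⟩
    · refine Or.inl ⟨hd, ?_⟩
      have hsm : ∀ᶠ r in 𝓝[>] (0:ℝ), r < R/2 := nhdsWithin_le_nhds (Iio_mem_nhds hR2)
      filter_upwards [hsm, self_mem_nhdsWithin] with r h1 h2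
      rw [← hδb]
      exact hall r h2 h1.le
end
end
end

section
open MeasureTheory Metric Filter Set
open scoped ENNReal Topology NNReal

noncomputable section

section
variable {n : ℕ} {Ω : Set (ES n)} {μ : Measure (ES n)} {K C : ℝ}

lemma gint {v : ES n → ℝ} (hv : ContDiff ℝ (⊤ : ℕ∞) v) (hc : HasCompactSupport v) :
    Integrable fun x => ‖fderiv ℝ v x‖ :=
  (((hv.of_le (by exact_mod_cast le_top) : ContDiff ℝ 1 v).continuous_fderiv
    one_ne_zero).norm).integrable_of_hasCompactSupport (hc.fderiv (𝕜 := ℝ)).norm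

lemma remove_ball (hn : 2 ≤ n) {x : ES n} {r : ℝ} (hr : 0 < r) (hr1 : r ≤ 1) {η : ES n → ℝ}
    (hη : Cut C x r (2*r) η) {w : ES n → ℝ} (hw : ContDiff ℝ (⊤ : ℕ∞) w) (hc : HasCompactSupport w)
    (h0 : ∀ y, 0 ≤ w y) (h1 : ∀ y, w y ≤ 1) (hC : 0 < C) :
    ∫ y, ‖fderiv ℝ (fun y => w y * (1 - η y)) y‖ ≤
      (∫ y, ‖fderiv ℝ w y‖) + (C + 1) * 2^n * volume.real (ball (0:ES n) 1) * r^(n-1) ∧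
    ∫ y, |w y * (1 - η y) - w y| ≤ (C+1) * 2^n * volume.real (ball (0:ES n) 1) * r^(n-1) := by
  have hω := om_pos (n := n)
  set ω := volume.real (ball (0:ES n) 1) with hωd
  have hmu : volume.real (closedBall x (2*r)) = (2*r)^n * ω := vol_cB x (by positivity)
  have hrn : r^n = r^(n-1) * r := by rw [← pow_succ]; congr 1; omega
  have hbi : Integrable ((closedBall x (2*r)).indicator fun _ : ES n => (1:ℝ)) :=
    (integrable_indicator_iff measurableSet_closedBall).2
      (integrableOn_const (isCompact_closedBall x _).measure_lt_top.ne)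
  have hbint : ∫ y, (closedBall x (2*r)).indicator (fun _ : ES n => (1:ℝ)) y = (2*r)^n * ω := by
    rw [← hmu]; exact integral_indicator_one measurableSet_closedBall
  have hw' : ContDiff ℝ (⊤ : ℕ∞) fun y => w y * (1 - η y) := hw.mul (contDiff_const.sub hη.cd)
  have hc' : HasCompactSupport fun y => w y * (1 - η y) := hc.mul_right
  constructor
  · have hpt : ∀ y, ‖fderiv ℝ (fun y => w y * (1 - η y)) y‖ ≤ ‖fderiv ℝ w y‖ +
        C/r * (closedBall x (2*r)).indicator (fun _ => (1:ℝ)) y := by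
      intro y
      have d1 : DifferentiableAt ℝ w y := hw.differentiable (by simp) y
      have d2 : DifferentiableAt ℝ η y := hη.cd.differentiable (by simp) y
      rw [fderiv_fun_mul d1 (d2.const_sub 1), fderiv_const_sub]
      refine (norm_add_le _ _).trans ?_
      rw [norm_smul, norm_smul, norm_neg, Real.norm_of_nonneg (h0 y),
        Real.norm_of_nonneg (by linarith [hη.le y])]
      have e1 : (1 - η y) * ‖fderiv ℝ w y‖ ≤ ‖fderiv ℝ w y‖ :=
        mul_le_of_le_one_left (norm_nonneg _) (by linarith [hη.nonneg y])
      have e2 : w y * ‖fderiv ℝ η y‖ ≤ C/r * (closedBall x (2*r)).indicator (fun _ => (1:ℝ)) y := by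
        refine (mul_le_of_le_one_left (norm_nonneg _) (h1 y)).trans ?_
        by_cases hy : y ∈ closedBall x (2*r)
        · have := hη.grad y
          rw [show 2 * r - r = r by ring] at this
          simpa [hy] using this
        · have : fderiv ℝ η y = 0 := fderiv_zero_of_eq_zero hη.nonneg
            (hη.zero y fun h => hy (ball_subset_closedBall h))
          simp [hy, this]
      linarith
    refine (integral_mono (gint hw' hc') ((gint hw hc).add (hbi.const_mul _)) hpt).trans ?_
    simp only [Pi.add_apply]
    rw [integral_add (gint hw hc) (hbi.const_mul _), integral_const_mul, hbint]
    refine add_le_add le_rfl ?_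
    have : C / r * ((2*r)^n * ω) = C * 2^n * ω * r^(n-1) := by
      rw [mul_pow, hrn]; field_simp
    rw [this]
    gcongr; linarith
  · have hpt : ∀ y, |w y * (1 - η y) - w y| ≤ (closedBall x (2*r)).indicator (fun _ => (1:ℝ)) y := by
      intro y
      have : w y * (1 - η y) - w y = -(w y * η y) := by ring
      rw [this, abs_neg, abs_of_nonneg (mul_nonneg (h0 y) (hη.nonneg y))]
      by_cases hy : y ∈ closedBall x (2*r)
      · simpa [hy] using mul_le_one₀ (h1 y) (hη.nonneg y) (hη.le y)
      · simp [hy, hη.zero y fun h => hy (ball_subset_closedBall h)]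
    have hi : Integrable fun y => |w y * (1 - η y) - w y| :=
      (hw'.continuous.sub hw.continuous).abs.integrable_of_hasCompactSupport
        (hc'.sub hc).abs
    refine (integral_mono hi hbi hpt).trans ?_
    rw [hbint, mul_pow, hrn]
    have : 0 < r^(n-1) := by positivity
    calc 2^n * (r^(n-1) * r) * ω = r * 2^n * ω * r^(n-1) := by ring
      _ ≤ _ := by gcongr; linarith

lemma remove_balls (hn : 2 ≤ n) : ∃ A : ℝ, 0 < A ∧ ∀ (ι : Type) (s : Finset ι) (x : ι → ES n)
    (r : ι → ℝ), (∀ i, 0 < r i ∧ r i ≤ 1) → ∀ v : ES n → ℝ, ContDiff ℝ (⊤ : ℕ∞) v →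
    HasCompactSupport v → (∀ y, 0 ≤ v y) → (∀ y, v y ≤ 1) →
    ∃ w : ES n → ℝ, ContDiff ℝ (⊤ : ℕ∞) w ∧ HasCompactSupport w ∧ (∀ y, 0 ≤ w y) ∧
      (∀ y, w y ≤ 1) ∧ (∀ y, v y = 0 → w y = 0) ∧ (∀ i ∈ s, ∀ y ∈ ball (x i) (r i), w y = 0) ∧
      ∫ y, ‖fderiv ℝ w y‖ ≤ (∫ y, ‖fderiv ℝ v y‖) + A * ∑ i ∈ s, r i ^ (n-1) ∧
      ∫ y, |w y - v y| ≤ A * ∑ i ∈ s, r i ^ (n-1) := by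
  classical
  obtain ⟨C, hC, hcut⟩ := exists_cut
  have hω := om_pos (n := n)
  refine ⟨(C+1) * 2^n * volume.real (ball (0:ES n) 1), by positivity, ?_⟩
  intro ι s x r hr v hv hc h0 h1
  induction s using Finset.induction_on with
  | empty => exact ⟨v, hv, hc, h0, h1, fun _ h => h, by simp, by simp, by simp⟩
  | insert i s his ih =>
    obtain ⟨w, a1, a2, a3, a4, a5, a6, a7, a8⟩ := ih
    obtain ⟨η, hη⟩ := hcut n (x i) (r i) (2 * r i) (hr i).1 (by linarith [(hr i).1])
    obtain ⟨b1, b2⟩ := remove_ball hn (hr i).1 (hr i).2 hη a1 a2 a3 a4 hC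
    have hcd : ContDiff ℝ (⊤ : ℕ∞) fun y => w y * (1 - η y) := a1.mul (contDiff_const.sub hη.cd)
    have hcs : HasCompactSupport fun y => w y * (1 - η y) := a2.mul_right
    refine ⟨fun y => w y * (1 - η y), hcd, hcs, fun y => mul_nonneg (a3 y) (by linarith [hη.le y]),
      fun y => mul_le_one₀ (a4 y) (by linarith [hη.le y]) (by linarith [hη.nonneg y]),
      fun y hy => by simp [a5 y hy], ?_, ?_, ?_⟩
    · intro j hj y hy
      rcases Finset.mem_insert.1 hj with rfl | hj
      · simp [hη.one y (ball_subset_closedBall hy)]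
      · simp [a6 j hj y hy]
    · rw [Finset.sum_insert his, mul_add]; linarith
    · rw [Finset.sum_insert his, mul_add]
      have i1 : Integrable fun y => |w y * (1 - η y) - w y| :=
        (hcd.continuous.sub a1.continuous).abs.integrable_of_hasCompactSupport (hcs.sub a2).abs
      have i2 : Integrable fun y => |w y - v y| :=
        (a1.continuous.sub hv.continuous).abs.integrable_of_hasCompactSupport (a2.sub hc).abs
      have i3 : Integrable fun y => |w y * (1 - η y) - v y| :=
        (hcd.continuous.sub hv.continuous).abs.integrable_of_hasCompactSupport (hcs.sub hc).abs
      have := integral_mono i3 (i1.add i2) fun y => abs_sub_le _ (w y) _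
      simp only [Pi.add_apply] at this
      rw [integral_add i1 i2] at this
      linarith
end
end
end

section
open MeasureTheory Metric Filter Set
open scoped ENNReal Topology NNReal

noncomputable section

section
variable {n : ℕ} {Ω : Set (ES n)} {μ : Measure (ES n)} {K C : ℝ}

lemma exists_step {a : ℝ} (ha : 0 < a) (ha1 : a < 1/2) : ∃ (f : ℝ → ℝ) (M : ℝ), 1 ≤ M ∧
    ContDiff ℝ (⊤ : ℕ∞) f ∧ (∀ s, s ≤ 1 - a → f s = 0) ∧ f 1 = 1 ∧ (∀ s, 0 ≤ f s) ∧
    (∀ s, f s ≤ 1) ∧ (∀ s, 0 ≤ deriv f s) ∧ ∀ s, deriv f s ≤ M := by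
  obtain ⟨C, hC, hCb⟩ := smoothTransition_deriv_bdd
  have hlin : ContDiff ℝ (⊤ : ℕ∞) fun s : ℝ => (s - (1 - a)) / a :=
    (contDiff_id.sub contDiff_const).div_const a
  have hmono : Monotone fun s => Real.smoothTransition ((s - (1 - a)) / a) := by
    intro s t hst
    exact Real.smoothTransition.monotone (by gcongr)
  refine ⟨fun s => Real.smoothTransition ((s - (1 - a)) / a), max 1 (C / a), le_max_left _ _,
    Real.smoothTransition.contDiff.comp hlin, fun s hs => ?_, ?_, fun s => Real.smoothTransition.nonneg _,
    fun s => Real.smoothTransition.le_one _, fun s => hmono.deriv_nonneg, fun s => ?_⟩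
  · exact Real.smoothTransition.zero_of_nonpos (div_nonpos_of_nonpos_of_nonneg (by linarith) ha.le)
  · exact Real.smoothTransition.one_of_one_le (by rw [le_div_iff₀ ha]; linarith)
  · refine le_trans ?_ (le_max_right _ _)
    have h1 : HasDerivAt Real.smoothTransition (deriv Real.smoothTransition ((s - (1 - a)) / a))
        ((s - (1 - a)) / a) :=
      ((Real.smoothTransition.contDiff (n := 1)).differentiable (by simp) _).hasDerivAt
    have h2 : HasDerivAt (fun s : ℝ => (s - (1 - a)) / a) (1/a) s :=
      ((hasDerivAt_id s).sub_const _).div_const a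
    have h3 := h1.comp s h2
    have : deriv (fun s => Real.smoothTransition ((s - (1 - a)) / a)) s = _ := h3.deriv
    rw [this, mul_one_div]
    gcongr
    exact (le_abs_self _).trans (hCb _)

lemma chi_cases (x : ES n) : chi Ω x = 0 ∨ chi Ω x = 1 := by
  unfold chi
  by_cases h : x ∈ Ω
  · simp [h]
  · simp [h]

lemma test_le {v : ES n → ℝ} {φ : ES n → ES n} (hv : ContDiff ℝ (⊤ : ℕ∞) v)
    (hc : HasCompactSupport v) (hφ : Adm φ) :
    ∫ x, v x * vdiv φ x ≤ ∫ x, ‖fderiv ℝ v x‖ := by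
  have hv1 : ContDiff ℝ 1 v := hv.of_le (by exact_mod_cast le_top)
  rw [ibp hv1 hφ.cd hφ.cs, ← integral_neg]
  refine integral_mono ((fderiv_app_continuous hv1 hφ.cd).integrable_of_hasCompactSupport
    (fderiv_app_cs hφ.cs)).neg (gint hv hc) fun x => ?_
  have h1 := (fderiv ℝ v x).le_opNorm (φ x)
  have h2 := hφ.le x
  have h3 := neg_abs_le (fderiv ℝ v x (φ x))
  rw [Real.norm_eq_abs] at h1
  have h4 := norm_nonneg (fderiv ℝ v x)
  show -(fderiv ℝ v x (φ x)) ≤ ‖fderiv ℝ v x‖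
  nlinarith

lemma step_core {u : ES n → ℝ} {φ : ES n → ES n} (huc : ContDiff ℝ (⊤ : ℕ∞) u)
    (hucs : HasCompactSupport u) (hφ : Adm φ) {f : ℝ → ℝ} {M : ℝ} (hM : 1 ≤ M)
    (hf : ContDiff ℝ (⊤ : ℕ∞) f) (f0 : f 0 = 0)
    (d0 : ∀ s, 0 ≤ deriv f s) (dM : ∀ s, deriv f s ≤ M) :
    (∫ x, ‖fderiv ℝ (fun y => f (u y)) x‖) / M + ∫ x, (u x - f (u x) / M) * vdiv φ x ≤
      ∫ x, ‖fderiv ℝ u x‖ := by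
  have hM0 : 0 < M := by linarith
  have hud : ∀ x, HasFDerivAt u (fderiv ℝ u x) x := fun x => (huc.differentiable (by simp) x).hasFDerivAt
  have hfd : ∀ x, HasFDerivAt (fun y => f (u y)) (deriv f (u x) • fderiv ℝ u x) x := fun x =>
    (((hf.differentiable (by simp) (u x)).hasDerivAt).comp_hasFDerivAt x (hud x))
  have hgd : ∀ x, HasFDerivAt (fun y => u y - f (u y) / M)
      ((1 - deriv f (u x) / M) • fderiv ℝ u x) x := by
    intro x
    have h2 := ((hasDerivAt_id (u x)).sub
      (((hf.differentiable (by simp) (u x)).hasDerivAt).div_const M)).comp_hasFDerivAt x (hud x)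
    exact h2
  have hfu : ContDiff ℝ (⊤ : ℕ∞) fun y => f (u y) := hf.comp huc
  have hgu : ContDiff ℝ (⊤ : ℕ∞) fun y => u y - f (u y) / M := huc.sub (hfu.div_const M)
  have hfs : HasCompactSupport fun y => f (u y) := HasCompactSupport.comp_left (g := f) hucs f0
  have hgs : HasCompactSupport fun y => u y - f (u y) / M :=
    HasCompactSupport.comp_left (g := fun s => s - f s / M) hucs (by simp [f0])
  have hsum : ∫ x, ‖fderiv ℝ u x‖ = (∫ x, ‖fderiv ℝ (fun y => f (u y)) x‖) / M +
      ∫ x, ‖fderiv ℝ (fun y => u y - f (u y) / M) x‖ := by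
    rw [← integral_div, ← integral_add ((gint hfu hfs).div_const M) (gint hgu hgs)]
    congr 1; ext x
    have e4 : deriv f (u x) / M ≤ 1 := by rw [div_le_one hM0]; exact dM _
    rw [(hfd x).fderiv, (hgd x).fderiv, norm_smul, norm_smul, Real.norm_of_nonneg (d0 _),
      Real.norm_of_nonneg (by linarith)]
    ring
  have := test_le hgu hgs hφ
  linarith

lemma step_grad (hb : Bornology.IsBounded Ω) (hm : MeasurableSet Ω)
    (hP : perimeter Ω ≠ ⊤) {f : ℝ → ℝ} {M : ℝ} (hM : 1 ≤ M) (hf : ContDiff ℝ (⊤ : ℕ∞) f)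
    (f0 : f 0 = 0) (f1 : f 1 = 1) (fn : ∀ s, 0 ≤ f s) (fl : ∀ s, f s ≤ 1)
    (d0 : ∀ s, 0 ≤ deriv f s) (dM : ∀ s, deriv f s ≤ M) {κ : ℝ} (hκ : 0 < κ) :
    ∀ᶠ k in atTop, ∫ x, ‖fderiv ℝ (fun y => f (moll Ω k y)) x‖ ≤ (perimeter Ω).toReal + κ := by
  have hM0 : 0 < M := by linarith
  set P := (perimeter Ω).toReal with hPd
  obtain ⟨φ, hφ, hlt⟩ := exists_adm Ω (show 0 < κ/(2*M) by positivity)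
  set g : ℝ → ℝ := fun s => s - f s / M with hg
  have hgc : ContDiff ℝ (⊤ : ℕ∞) g := contDiff_id.sub (hf.div_const M)
  have hgd : ∀ s, HasDerivAt g (1 - deriv f s / M) s := fun s =>
    (hasDerivAt_id s).sub (((hf.differentiable (by simp) s).hasDerivAt).div_const M)
  have hchi : ∀ x, g (chi Ω x) = (1 - 1/M) * chi Ω x := by
    intro x
    rcases chi_cases (Ω := Ω) x with h | h <;> rw [h] <;> simp [hg, f0, f1]
  have hlim : Tendsto (fun k => ∫ x, g (moll Ω k x) * vdiv φ x) atTop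
      (𝓝 ((1 - 1/M) * ∫ x in Ω, vdiv φ x)) := by
    have : (1 - 1/M) * ∫ x in Ω, vdiv φ x = ∫ x, g (chi Ω x) * vdiv φ x := by
      rw [← integral_chi_mul hm, ← integral_const_mul]
      congr 1; ext x; rw [hchi]; ring
    rw [this]
    have hvi := vdiv_integrable hφ.cd hφ.cs
    refine tendsto_integral_of_dominated_convergence (fun x => 2 * ‖vdiv φ x‖) ?_
      (hvi.norm.const_mul 2) ?_ ?_
    · exact fun k => ((hgc.continuous.comp (moll_contDiff hm k).continuous).aestronglyMeasurable).mul
        hvi.aestronglyMeasurable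
    · refine fun k => Eventually.of_forall fun x => ?_
      rw [norm_mul]
      gcongr
      rw [Real.norm_eq_abs, abs_le]
      have e1 := moll_nonneg (Ω := Ω) k x
      have e2 := moll_le hm k x
      have e3 : 0 ≤ f (moll Ω k x) / M := div_nonneg (fn _) hM0.le
      have e4 : f (moll Ω k x) / M ≤ 1 := by rw [div_le_one hM0]; linarith [fl (moll Ω k x)]
      simp only [hg]
      constructor <;> linarith
    · filter_upwards [moll_ae hm] with x hx
      exact ((hgc.continuous.tendsto _).comp hx).mul_const _
  have hl : (1 - 1/M) * (∫ x in Ω, vdiv φ x) - κ/(2*M) < (1 - 1/M) * ∫ x in Ω, vdiv φ x := by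
    have : 0 < κ/(2*M) := by positivity
    linarith
  filter_upwards [hlim.eventually_const_lt hl] with k hk
  have hcore := step_core (moll_contDiff hm k) (moll_cs hb k) hφ hM hf f0 d0 dM
  simp only [hg] at hk
  have hgr := moll_grad hb hm hP k
  have hMm : (1 - 1/M) * (P - κ/(2*M)) ≤ (1 - 1/M) * ∫ x in Ω, vdiv φ x := by
    have : 1/M ≤ 1 := by rw [div_le_one hM0]; exact hM
    exact mul_le_mul_of_nonneg_left hlt.le (by linarith)
  have hfin : (∫ x, ‖fderiv ℝ (fun y => f (moll Ω k y)) x‖) / M ≤ (P + κ)/M := by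
    have e1 : (P + κ)/M = P/M + κ/(2*M) + κ/(2*M) := by field_simp; ring
    have e2 : (1 - 1/M) * (P - κ/(2*M)) = P - P/M - κ/(2*M) + 1/M * (κ/(2*M)) := by ring
    have e3 : 0 ≤ 1/M * (κ/(2*M)) := by positivity
    linarith
  rwa [div_le_div_iff_of_pos_right hM0] at hfin

lemma step_l1 (hb : Bornology.IsBounded Ω) (hm : MeasurableSet Ω)
    {f : ℝ → ℝ} (hf : Continuous f)
    (f0 : f 0 = 0) (f1 : f 1 = 1) (fn : ∀ s, 0 ≤ f s) (fl : ∀ s, f s ≤ 1) :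
    Tendsto (fun k => ∫ x, |f (moll Ω k x) - chi Ω x|) atTop (𝓝 0) := by
  obtain ⟨R, hR0, hR⟩ := exists_R hb
  have : (0:ℝ) = ∫ x : ES n, (0:ℝ) := by simp
  rw [this]
  refine tendsto_integral_of_dominated_convergence ((closedBall 0 R).indicator fun _ => 1) ?_
    ((integrable_indicator_iff measurableSet_closedBall).2
      (integrableOn_const (isCompact_closedBall 0 _).measure_lt_top.ne)) ?_ ?_
  · exact fun k => ((hf.comp (moll_contDiff hm k).continuous).measurable.sub
      (chi_measurable hm)).abs.aestronglyMeasurable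
  · refine fun k => Eventually.of_forall fun x => ?_
    rw [Real.norm_eq_abs, abs_abs]
    by_cases hx : x ∈ closedBall 0 R
    · rw [indicator_of_mem hx, abs_le]
      have := fn (moll Ω k x); have := fl (moll Ω k x)
      have := chi_nonneg Ω x; have := chi_le Ω x
      constructor <;> linarith
    · rw [indicator_of_notMem hx, (hR x hx).1, (hR x hx).2 k, f0]; simp
  · filter_upwards [moll_ae hm] with x hx
    have h1 := (((hf.tendsto _).comp hx).sub_const (chi Ω x)).abs
    have : |f (chi Ω x) - chi Ω x| = 0 := by
      rcases chi_cases (Ω := Ω) x with h | h <;> rw [h] <;> simp [f0, f1]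
    rw [this] at h1
    exact h1

lemma exists_w (hn : 2 ≤ n) (hb : Bornology.IsBounded Ω) (hm : MeasurableSet Ω)
    (hP : perimeter Ω ≠ ⊤) (hS : μH[(n:ℝ)-1] (frontier Ω ∩ densityPts Ω 1) = 0) {η : ℝ} (hη : 0 < η) :
    ∃ w : ES n → ℝ, ContDiff ℝ (⊤ : ℕ∞) w ∧ HasCompactSupport w ∧ tsupport w ⊆ interior Ω ∧
      (∀ y, 0 ≤ w y) ∧ (∀ y, w y ≤ 1) ∧ ∫ y, ‖fderiv ℝ w y‖ ≤ (perimeter Ω).toReal + η ∧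
      ∫ y, |w y - chi Ω y| ≤ η := by
  obtain ⟨η0, hη0, hη02, hcov⟩ := cover_K hn hb hm hP hS
  obtain ⟨f, M, hM, hf, fz, f1, fn, fl, d0, dM⟩ := exists_step hη0 hη02
  obtain ⟨A, hA, hrem⟩ := remove_balls hn
  have f0 : f 0 = 0 := fz 0 (by linarith)
  obtain ⟨k, ⟨ι, hι, x, r, hr, hsub, hsum⟩, hk2, hk3⟩ := ((hcov (ENNReal.ofReal (η/(2*A))) (by simpa using by positivity)).and
    ((step_grad hb hm hP hM hf f0 f1 fn fl d0 dM (half_pos hη)).and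
    ((step_l1 hb hm hf.continuous f0 f1 fn fl).eventually_lt_const (half_pos hη)))).exists
  have huc := (moll_contDiff hm k)
  have hucs : HasCompactSupport (moll Ω k) := moll_cs hb k
  set Z := {x | 1 - η0 ≤ moll Ω k x} with hZ
  have hZc : IsClosed Z := isClosed_le continuous_const huc.continuous
  have hZk : IsCompact Z := by
    refine hucs.isCompact.of_isClosed_subset hZc fun y hy => subset_tsupport _ ?_
    have : 1 - η0 ≤ moll Ω k y := hy
    rw [Function.mem_support]; linarith
  have hKc : IsCompact (Z \ interior Ω) := hZk.diff isOpen_interior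
  obtain ⟨s, hs⟩ := hKc.elim_finite_subcover (fun i => ball (x i) (r i)) (fun _ => isOpen_ball) hsub
  obtain ⟨w, a1, a2, a3, a4, a5, a6, a7, a8⟩ := hrem ι s x r hr (fun y => f (moll Ω k y)) (hf.comp huc)
    (hucs.comp_left f0) (fun y => fn _) (fun y => fl _)
  have hsum2 : A * ∑ i ∈ s, r i ^ (n-1) ≤ η/2 := by
    have h1 : ENNReal.ofReal (∑ i ∈ s, r i ^ (n-1)) ≤ ENNReal.ofReal (η/(2*A)) := by
      rw [ENNReal.ofReal_sum_of_nonneg (fun i _ => pow_nonneg (hr i).1.le _)]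
      exact (ENNReal.sum_le_tsum s).trans hsum
    rw [ENNReal.ofReal_le_ofReal_iff (by positivity), le_div_iff₀ (by positivity)] at h1
    linarith
  refine ⟨w, a1, a2, ?_, a3, a4, by linarith, ?_⟩
  · have hcl : IsClosed (Z ∩ (⋃ i ∈ s, ball (x i) (r i))ᶜ) :=
      hZc.inter (isOpen_biUnion fun _ _ => isOpen_ball).isClosed_compl
    have h1 : tsupport w ⊆ Z ∩ (⋃ i ∈ s, ball (x i) (r i))ᶜ := by
      refine closure_minimal (fun y hy => ⟨?_, fun hy2 => ?_⟩) hcl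
      · by_contra hyZ
        have : moll Ω k y ≤ 1 - η0 := by
          have : ¬ (1 - η0 ≤ moll Ω k y) := hyZ
          linarith
        exact hy (a5 y (fz _ this))
      · obtain ⟨i, hi, hyi⟩ := mem_iUnion₂.1 hy2
        exact hy (a6 i hi y hyi)
    intro y hy
    by_contra hyi
    exact (h1 hy).2 (hs ⟨(h1 hy).1, hyi⟩)
  · have hchi := chi_integrable hb hm
    have i1 : Integrable fun y => |w y - f (moll Ω k y)| :=
      (a1.continuous.sub (hf.comp huc).continuous).abs.integrable_of_hasCompactSupport
        (a2.sub (hucs.comp_left f0)).abs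
    have i2 : Integrable fun y => |f (moll Ω k y) - chi Ω y| :=
      (((hf.comp huc).continuous.integrable_of_hasCompactSupport (hucs.comp_left f0)).sub hchi).abs
    have i3 : Integrable fun y => |w y - chi Ω y| :=
      ((a1.continuous.integrable_of_hasCompactSupport a2).sub hchi).abs
    have := integral_mono i3 (i1.add i2) fun y => abs_sub_le _ (f (moll Ω k y)) _
    simp only [Pi.add_apply] at this
    rw [integral_add i1 i2] at this
    linarith
end
end
end

section
open MeasureTheory Metric Filter Set
open scoped ENNReal Topology NNReal

noncomputable section

section
variable {n : ℕ} {Ω : Set (ES n)} {μ : Measure (ES n)} {K C : ℝ}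

lemma mono_growth' {F : ℝ → ℝ} (hF : Monotone F) {D : Set ℝ} (hD : D.Countable) {a b c : ℝ} (hab : a ≤ b)
    (h : ∀ s ∈ Ioo a b, s ∉ D → DifferentiableAt ℝ F s → c ≤ deriv F s) : c * (b - a) ≤ F b - F a := by
  have h1 := (hF.monotoneOn (uIcc a b)).intervalIntegral_deriv_mem_uIcc
  have h2 : F a ≤ F b := hF hab
  rw [uIcc_of_le (by linarith)] at h1
  refine le_trans ?_ h1.2
  have e : c * (b - a) = ∫ _ in a..b, c := by simp; ring
  rw [e]
  refine intervalIntegral.integral_mono_ae_restrict hab (by simp)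
    (hF.monotoneOn (uIcc a b)).intervalIntegrable_deriv ?_
  rw [EventuallyLE, ← restrict_Ioo_eq_restrict_Icc, ae_restrict_iff' measurableSet_Ioo]
  filter_upwards [hF.ae_differentiableAt, hD.ae_notMem volume] with s hs hs2 hs'
  exact h s hs' hs2 hs

lemma regular_fiber_countable {F : ES n → ES n} (hF : ContDiff ℝ 1 F) (b : ES n)
    (hb : ∀ x, F x = b → (fderiv ℝ F x).det ≠ 0) : {x | F x = b}.Countable := by
  have hdisc : DiscreteTopology {x | F x = b} := by
    rw [discreteTopology_subtype_iff']
    rintro x (hx : F x = b)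
    have hdet := hb x hx
    have hs : HasStrictFDerivAt F (fderiv ℝ F x) x :=
      hF.contDiffAt.hasStrictFDerivAt one_ne_zero
    set e := (fderiv ℝ F x).toContinuousLinearEquivOfDetNeZero hdet with he
    have hs' : HasStrictFDerivAt F (e : ES n →L[ℝ] ES n) x := by simpa [he] using hs
    set φ := hs'.toOpenPartialHomeomorph F
    refine ⟨φ.source, φ.open_source, ?_⟩
    ext y
    simp only [Set.mem_inter_iff, Set.mem_singleton_iff]
    constructor
    · rintro ⟨h1, h2⟩
      have : φ y = φ x := by
        show F y = F x
        rw [hx]; exact h2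
      exact φ.injOn h1 hs'.mem_toOpenPartialHomeomorph_source this
    · rintro rfl
      exact ⟨hs'.mem_toOpenPartialHomeomorph_source, hx⟩
  exact (countable_of_Lindelof_of_discrete (X := {x | F x = b}))

lemma sard_a {w : ES n → ℝ} (hw : ContDiff ℝ (⊤ : ℕ∞) w) {ρ : ℝ} (hρ : 0 < ρ) :
    ∃ a : ES n, ‖a‖ < ρ ∧ {x | fderiv ℝ w x = - innerSL ℝ a}.Countable := by
  set F : ES n → ES n := fun x => WithLp.toLp 2 (fun i => fderiv ℝ w x (EuclideanSpace.single i 1)) with hFd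
  have hF : ContDiff ℝ 1 F := by
    rw [contDiff_euclidean]
    intro i
    have h1 : ContDiff ℝ 1 (fderiv ℝ w) := hw.fderiv_right (by norm_cast)
    exact h1.clm_apply contDiff_const
  have hnull : volume (F '' {x | (fderiv ℝ F x).det = 0}) = 0 :=
    addHaar_image_eq_zero_of_det_fderivWithin_eq_zero volume (f' := fderiv ℝ F)
      (fun x _ => ((hF.differentiable one_ne_zero x).hasFDerivAt).hasFDerivWithinAt) (fun x hx => hx)
  have hex : ∃ b ∈ ball (0 : ES n) ρ, b ∉ F '' {x | (fderiv ℝ F x).det = 0} := by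
    by_contra! hcon
    have := measure_mono_null (show ball (0 : ES n) ρ ⊆ _ from hcon) hnull
    exact (measure_ball_pos volume (0 : ES n) hρ).ne' this
  obtain ⟨b, hb, hbn⟩ := hex
  refine ⟨-b, by simpa using hb, ?_⟩
  refine (regular_fiber_countable hF b fun x hx hdet => hbn ⟨x, hdet, hx⟩).mono ?_
  intro x hx
  have hx : fderiv ℝ w x = - innerSL ℝ (-b) := hx
  show F x = b
  ext i
  simp [hFd, hx, EuclideanSpace.inner_single_right]
end
end
end

section
open MeasureTheory Metric Filter Set
open scoped ENNReal Topology NNReal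

noncomputable section

section
variable {n : ℕ} {Ω : Set (ES n)} {μ : Measure (ES n)} {K C : ℝ}

lemma exists_g {w : ES n → ℝ} (hw : ContDiff ℝ (⊤ : ℕ∞) w) (hc : HasCompactSupport w)
    {η : ℝ} (hη : 0 < η) :
    ∃ g : ES n → ℝ, ContDiff ℝ (⊤ : ℕ∞) g ∧ HasCompactSupport g ∧
      ∫ y, ‖fderiv ℝ g y‖ ≤ (∫ y, ‖fderiv ℝ w y‖) + η ∧ ∫ y, |g y - w y| ≤ η ∧
      (∀ y, |g y - w y| ≤ η) ∧ {x | η < g x ∧ fderiv ℝ g x = 0}.Countable := by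
  obtain ⟨θ, t1, t2, -, t4, -, -⟩ := urysohn (A := tsupport w) hc isOpen_univ (subset_univ _)
  set Θ : ES n → ES n := fun x => θ x • x with hΘ
  have hΘc : ContDiff ℝ (⊤ : ℕ∞) Θ := t1.smul contDiff_id
  have hΘs : HasCompactSupport Θ := by
    refine t2.mono fun x hx => ?_
    rw [Function.mem_support] at hx ⊢
    intro h0
    exact hx (by simp [hΘ, h0])
  have hdc : Continuous (fderiv ℝ Θ) := hΘc.continuous_fderiv (by simp)
  have i1 : Integrable fun x => ‖fderiv ℝ Θ x‖ :=
    hdc.norm.integrable_of_hasCompactSupport (hΘs.fderiv (𝕜 := ℝ)).norm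
  have i2 : Integrable fun x => ‖Θ x‖ :=
    hΘc.continuous.norm.integrable_of_hasCompactSupport hΘs.norm
  obtain ⟨A3, hA3⟩ := hΘc.continuous.bounded_above_of_compact_support hΘs
  set A1 := ∫ x, ‖fderiv ℝ Θ x‖ with hA1
  set A2 := ∫ x, ‖Θ x‖ with hA2
  have hA1n : 0 ≤ A1 := integral_nonneg fun _ => norm_nonneg _
  have hA2n : 0 ≤ A2 := integral_nonneg fun _ => norm_nonneg _
  have hA3n : 0 ≤ A3 := (norm_nonneg _).trans (hA3 0)
  obtain ⟨a, ha, hcnt⟩ := sard_a hw (show 0 < η / (1 + A1 + A2 + A3) by positivity)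
  rw [lt_div_iff₀ (by positivity)] at ha
  have han := norm_nonneg a
  have q1 : ‖a‖ * A1 ≤ η := by nlinarith
  have q2 : ‖a‖ * A2 ≤ η := by nlinarith
  have q3 : ‖a‖ * A3 ≤ η := by nlinarith
  have hid : ∀ x, HasFDerivAt (fun y => innerSL ℝ a (Θ y)) ((innerSL ℝ a).comp (fderiv ℝ Θ x)) x :=
    fun x => (innerSL ℝ a).hasFDerivAt.comp x (hΘc.differentiable (by simp) x).hasFDerivAt
  have hic : ContDiff ℝ (⊤ : ℕ∞) fun y => innerSL ℝ a (Θ y) := (innerSL ℝ a).contDiff.comp hΘc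
  have his : HasCompactSupport fun y => innerSL ℝ a (Θ y) := by
    refine hΘs.mono fun x hx => ?_
    rw [Function.mem_support] at hx ⊢
    intro h0
    exact hx (by rw [h0]; simp)
  have hgd : ∀ x, HasFDerivAt (fun y => w y + innerSL ℝ a (Θ y))
      (fderiv ℝ w x + (innerSL ℝ a).comp (fderiv ℝ Θ x)) x := fun x =>
    (hw.differentiable (by simp) x).hasFDerivAt.add (hid x)
  have hg : ContDiff ℝ (⊤ : ℕ∞) fun y => w y + innerSL ℝ a (Θ y) := hw.add hic
  have hgs : HasCompactSupport fun y => w y + innerSL ℝ a (Θ y) := hc.add his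
  have hin : ‖innerSL ℝ a‖ = ‖a‖ := innerSL_apply_norm ℝ a
  have habs : ∀ x, |innerSL ℝ a (Θ x)| ≤ ‖a‖ * ‖Θ x‖ := fun x => by
    have := (innerSL ℝ a).le_opNorm (Θ x)
    rwa [hin] at this
  have hclose : ∀ y, |w y + innerSL ℝ a (Θ y) - w y| ≤ ‖a‖ * ‖Θ y‖ := fun y => by
    rw [add_sub_cancel_left]; exact habs y
  have hclose2 : ∀ y, |w y + innerSL ℝ a (Θ y) - w y| ≤ η := fun y =>
    (hclose y).trans ((mul_le_mul_of_nonneg_left (hA3 y) han).trans q3)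
  refine ⟨fun y => w y + innerSL ℝ a (Θ y), hg, hgs, ?_, ?_, hclose2, ?_⟩
  · have h1 := integral_mono (gint hg hgs) ((gint hw hc).add (i1.const_mul ‖a‖)) fun x => by
      show ‖fderiv ℝ (fun y => w y + innerSL ℝ a (Θ y)) x‖ ≤ ‖fderiv ℝ w x‖ + ‖a‖ * ‖fderiv ℝ Θ x‖
      rw [(hgd x).fderiv]
      refine (norm_add_le _ _).trans ?_
      gcongr
      refine (ContinuousLinearMap.opNorm_comp_le _ _).trans ?_
      rw [hin]
    simp only [Pi.add_apply] at h1
    rw [integral_add (gint hw hc) (i1.const_mul ‖a‖), integral_const_mul] at h1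
    linarith
  · have h1 := integral_mono_of_nonneg (Eventually.of_forall fun y => abs_nonneg _)
      (i2.const_mul ‖a‖) (Eventually.of_forall hclose)
    rw [integral_const_mul] at h1
    exact h1.trans q2
  · refine hcnt.mono ?_
    rintro x ⟨h1, h2⟩
    have hwx : w x ≠ 0 := by
      intro h0
      have := hclose2 x
      rw [h0, sub_zero] at this
      have h3 := (le_abs_self _).trans this
      have h1' : η < w x + innerSL ℝ a (Θ x) := h1
      rw [h0] at h1'
      linarith
    have hx : x ∈ tsupport w := subset_tsupport _ hwx
    have hev : ∀ᶠ y in 𝓝 x, θ y = 1 := (mem_nhdsSet_iff_forall.1 t4 x hx)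
    have hev2 : Θ =ᶠ[𝓝 x] id := hev.mono fun y hy => by simp [hΘ, hy]
    have h3 : fderiv ℝ Θ x = ContinuousLinearMap.id ℝ _ := by
      rw [hev2.fderiv_eq, fderiv_id]
    rw [(hgd x).fderiv, h3, ContinuousLinearMap.comp_id] at h2
    exact eq_neg_of_add_eq_zero_left h2
end
end
end

section
open MeasureTheory Metric Filter Set
open scoped ENNReal Topology NNReal

noncomputable section

section
variable {n : ℕ} {Ω : Set (ES n)} {μ : Measure (ES n)} {K C : ℝ}

lemma exists_ramp {δ : ℝ} (hδ : 0 < δ) (hδ2 : δ < 1/2) : ∃ (T : ℝ → ℝ) (J : ℝ), 1 - 2 * δ ≤ J ∧ J ≤ 1 ∧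
    ContDiff ℝ 1 T ∧ (∀ t, t ≤ 0 → T t = 0) ∧ (∀ t, 1 ≤ t → T t = J) ∧ (∀ t, |T t| ≤ 1) ∧
    (∀ t, 0 ≤ deriv T t) ∧ (∀ t, deriv T t ≤ 1) ∧ (∀ t, t ≤ 0 → deriv T t = 0) ∧
    ∀ t, 1 ≤ t → deriv T t = 0 := by
  set ρ : ℝ → ℝ := fun t => max 0 (min 1 (min t (1 - t) / δ)) with hρ
  have hρc : Continuous ρ := by fun_prop
  have r0 : ∀ t, 0 ≤ ρ t := fun t => le_max_left _ _
  have r1 : ∀ t, ρ t ≤ 1 := fun t => max_le zero_le_one (min_le_left _ _)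
  have rl : ∀ t, t ≤ 0 → ρ t = 0 := fun t ht => by
    refine max_eq_left ((min_le_right _ _).trans (div_nonpos_of_nonpos_of_nonneg ?_ hδ.le))
    exact (min_le_left _ _).trans ht
  have rr : ∀ t, 1 ≤ t → ρ t = 0 := fun t ht => by
    refine max_eq_left ((min_le_right _ _).trans (div_nonpos_of_nonpos_of_nonneg ?_ hδ.le))
    exact (min_le_right _ _).trans (by linarith)
  have rm : ∀ t ∈ Icc δ (1 - δ), ρ t = 1 := fun t ht => by
    have : 1 ≤ min t (1 - t) / δ := by
      rw [le_div_iff₀ hδ, one_mul]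
      exact le_min ht.1 (by linarith [ht.2])
    simp only [hρ]
    rw [min_eq_left this]; simp
  have ii : ∀ a b, IntervalIntegrable ρ volume a b := fun a b => hρc.intervalIntegrable a b
  have hd : ∀ t, HasDerivAt (fun t => ∫ s in (0:ℝ)..t, ρ s) (ρ t) t := fun t =>
    intervalIntegral.integral_hasDerivAt_right (ii 0 t) (hρc.stronglyMeasurableAtFilter _ _) hρc.continuousAt
  have hdd : deriv (fun t => ∫ s in (0:ℝ)..t, ρ s) = ρ := funext fun t => (hd t).deriv
  have hT0 : ∀ t, t ≤ 0 → ∫ s in (0:ℝ)..t, ρ s = 0 := fun t ht => by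
    rw [intervalIntegral.integral_symm, intervalIntegral.integral_congr (g := fun _ => 0)]
    · simp
    · intro s hs
      rw [uIcc_of_le ht] at hs
      exact rl s hs.2
  have hT1 : ∀ t, 1 ≤ t → ∫ s in (0:ℝ)..t, ρ s = ∫ s in (0:ℝ)..1, ρ s := fun t ht => by
    rw [← intervalIntegral.integral_add_adjacent_intervals (ii 0 1) (ii 1 t),
      intervalIntegral.integral_congr (g := fun _ => 0) (a := 1) (b := t)]
    · simp
    · intro s hs
      rw [uIcc_of_le ht] at hs
      exact rr s hs.1
  have hle : ∀ t, 0 ≤ t → ∫ s in (0:ℝ)..t, ρ s ≤ t := fun t ht => by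
    have := intervalIntegral.integral_mono_on ht (ii 0 t) (g := fun _ => 1) (by simp) (fun s _ => r1 s)
    simpa using this
  have hge : ∀ t, 0 ≤ t → 0 ≤ ∫ s in (0:ℝ)..t, ρ s := fun t ht =>
    intervalIntegral.integral_nonneg ht fun s _ => r0 s
  refine ⟨fun t => ∫ s in (0:ℝ)..t, ρ s, ∫ s in (0:ℝ)..1, ρ s, ?_, hle 1 zero_le_one, ?_, hT0, hT1, ?_,
    ?_, ?_, ?_, ?_⟩
  · have h1 := intervalIntegral.integral_add_adjacent_intervals (ii 0 δ) (ii δ 1)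
    have h2 := intervalIntegral.integral_add_adjacent_intervals (ii δ (1 - δ)) (ii (1 - δ) 1)
    have h3 : ∫ s in δ..(1 - δ), ρ s = 1 - 2 * δ := by
      rw [intervalIntegral.integral_congr (g := fun _ => 1)]
      · simp; ring
      · intro s hs
        rw [uIcc_of_le (by linarith)] at hs
        exact rm s hs
    have h4 : 0 ≤ ∫ s in (0:ℝ)..δ, ρ s := hge δ hδ.le
    have h5 : 0 ≤ ∫ s in (1 - δ)..1, ρ s := intervalIntegral.integral_nonneg (by linarith) fun s _ => r0 s
    linarith
  · rw [contDiff_one_iff_deriv, hdd]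
    exact ⟨fun t => (hd t).differentiableAt, hρc⟩
  · intro t
    rcases le_total t 0 with h | h
    · simp [hT0 t h]
    rw [abs_of_nonneg (hge t h)]
    rcases le_total t 1 with h' | h'
    · exact (hle t h).trans h'
    · rw [hT1 t h']; exact hle 1 zero_le_one
  all_goals rw [hdd]
  exacts [r0, r1, rl, rr]

/-- sublevel gradient mass -/
def GG (g : ES n → ℝ) (s : ℝ) : ℝ := ∫ x in {x | g x ≤ s}, ‖fderiv ℝ g x‖

lemma GG_sub {g : ES n → ℝ} (hg : ContDiff ℝ (⊤ : ℕ∞) g) (hc : HasCompactSupport g) {s t : ℝ}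
    (h : s ≤ t) : GG g t - GG g s = ∫ x in {x | s < g x ∧ g x ≤ t}, ‖fderiv ℝ g x‖ := by
  have hme : ∀ s, MeasurableSet {x | g x ≤ s} := fun s =>
    (isClosed_le hg.continuous continuous_const).measurableSet
  have hm2 : MeasurableSet {x | s < g x ∧ g x ≤ t} :=
    ((isOpen_lt continuous_const hg.continuous).measurableSet).inter (hme t)
  have hU : {x | g x ≤ t} = {x | g x ≤ s} ∪ {x | s < g x ∧ g x ≤ t} := by
    ext x
    simp only [Set.mem_union, Set.mem_ofPred_eq]
    constructor
    · intro hx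
      rcases le_or_gt (g x) s with h1 | h1
      · exact Or.inl h1
      · exact Or.inr ⟨h1, hx⟩
    · rintro (h1 | h1)
      · exact h1.trans h
      · exact h1.2
  unfold GG
  rw [hU, setIntegral_union _ hm2 (gint hg hc).integrableOn (gint hg hc).integrableOn]
  · ring
  · rw [Set.disjoint_left]
    intro x h1 h2
    exact absurd h2.1 (not_lt.2 h1)

lemma GG_mono {g : ES n → ℝ} (hg : ContDiff ℝ (⊤ : ℕ∞) g) (hc : HasCompactSupport g) :
    Monotone (GG g) := by
  intro s t h
  have := GG_sub hg hc h
  have h2 : 0 ≤ ∫ x in {x | s < g x ∧ g x ≤ t}, ‖fderiv ℝ g x‖ := integral_nonneg fun _ => norm_nonneg _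
  linarith

lemma GG_le {g : ES n → ℝ} (hg : ContDiff ℝ (⊤ : ℕ∞) g) (hc : HasCompactSupport g) {s t : ℝ}
    (h : s ≤ t) : GG g t - GG g s ≤ ∫ x, ‖fderiv ℝ g x‖ := by
  rw [GG_sub hg hc h]
  exact setIntegral_le_integral (gint hg hc) (Eventually.of_forall fun _ => norm_nonneg _)

lemma ramp_test {g : ES n → ℝ} (hg : ContDiff ℝ (⊤ : ℕ∞) g) (hc : HasCompactSupport g)
    {φ : ES n → ES n} (hφ : Adm φ) {T : ℝ → ℝ} (hT : ContDiff ℝ 1 T)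
    (d0 : ∀ t, 0 ≤ deriv T t) (d1 : ∀ t, deriv T t ≤ 1) (dl : ∀ t, t ≤ 0 → deriv T t = 0)
    (dr : ∀ t, 1 ≤ t → deriv T t = 0) (s : ℝ) {h : ℝ} (hh : 0 < h) :
    ∫ x, T ((g x - s) / h) * vdiv φ x ≤ (GG g (s + h) - GG g s) / h := by
  have hg1 : ContDiff ℝ 1 g := hg.of_le (by exact_mod_cast le_top)
  have hq : ContDiff ℝ 1 fun x => (g x - s) / h := (hg1.sub contDiff_const).div_const h
  have hTg : ContDiff ℝ 1 fun x => T ((g x - s) / h) := hT.comp hq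
  have hfd : ∀ x, HasFDerivAt (fun x => T ((g x - s) / h))
      ((deriv T ((g x - s) / h) * (1 / h)) • fderiv ℝ g x) x := fun x => by
    have h1 : HasDerivAt (fun t => T ((t - s) / h)) (deriv T ((g x - s) / h) * (1 / h)) (g x) :=
      HasDerivAt.comp (g x) ((hT.differentiable one_ne_zero _).hasDerivAt)
        (((hasDerivAt_id (g x)).sub_const s).div_const h)
    exact h1.comp_hasFDerivAt x (hg1.differentiable one_ne_zero x).hasFDerivAt
  have hm2 : MeasurableSet {x | s < g x ∧ g x ≤ s + h} :=
    ((isOpen_lt continuous_const hg.continuous).measurableSet).inter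
      (isClosed_le hg.continuous continuous_const).measurableSet
  rw [ibp hTg hφ.cd hφ.cs, ← integral_neg, GG_sub hg hc (by linarith), ← integral_div,
    ← integral_indicator hm2]
  refine integral_mono ((fderiv_app_continuous hTg hφ.cd).integrable_of_hasCompactSupport
    (fderiv_app_cs hφ.cs)).neg (((gint hg hc).div_const h).indicator hm2) fun x => ?_
  show -(fderiv ℝ (fun x => T ((g x - s) / h)) x (φ x)) ≤ _
  rw [(hfd x).fderiv]
  by_cases hx : x ∈ {x | s < g x ∧ g x ≤ s + h}
  · rw [indicator_of_mem hx]
    have h1 := (fderiv ℝ g x).le_opNorm (φ x)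
    have h2 := hφ.le x
    have h3 := neg_abs_le (fderiv ℝ g x (φ x))
    rw [Real.norm_eq_abs] at h1
    have h4 := norm_nonneg (fderiv ℝ g x)
    have h5 : -(fderiv ℝ g x (φ x)) ≤ ‖fderiv ℝ g x‖ := by nlinarith
    show -(deriv T ((g x - s) / h) * (1 / h) * (fderiv ℝ g x (φ x))) ≤ ‖fderiv ℝ g x‖ / h
    have h6 : deriv T ((g x - s) / h) * -(fderiv ℝ g x (φ x)) ≤ ‖fderiv ℝ g x‖ := by
      have := d0 ((g x - s) / h); have := d1 ((g x - s) / h)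
      nlinarith
    rw [le_div_iff₀ hh]
    have : -(deriv T ((g x - s) / h) * (1 / h) * (fderiv ℝ g x (φ x))) * h =
      deriv T ((g x - s) / h) * -(fderiv ℝ g x (φ x)) := by field_simp
    rw [this]; exact h6
  · rw [indicator_of_notMem hx]
    have : deriv T ((g x - s) / h) = 0 := by
      rw [Set.mem_ofPred_eq, not_and_or, not_lt, not_le] at hx
      rcases hx with hx | hx
      · exact dl _ (div_nonpos_of_nonpos_of_nonneg (by linarith) hh.le)
      · exact dr _ (by rw [le_div_iff₀ hh]; linarith)
    rw [this]; simp

lemma per_level {g : ES n → ℝ} (hg : ContDiff ℝ (⊤ : ℕ∞) g) (hc : HasCompactSupport g) {s d : ℝ}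
    (hd : HasDerivAt (GG g) d s) : perimeter {x | s < g x} ≤ ENNReal.ofReal d := by
  refine per_le fun φ hφ => ?_
  have hvi := vdiv_integrable hφ.cd hφ.cs
  have hm : MeasurableSet {x | s < g x} := (isOpen_lt continuous_const hg.continuous).measurableSet
  set X := ∫ x in {x | s < g x}, vdiv φ x with hX
  have key : ∀ δ, 0 < δ → δ < 1/2 → ∃ J, 1 - 2 * δ ≤ J ∧ J ≤ 1 ∧ J * X ≤ d := by
    intro δ h0 h1
    obtain ⟨T, J, j1, j2, Tc, T0, T1, Tb, d0, d1, dl, dr⟩ := exists_ramp h0 h1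
    refine ⟨J, j1, j2, ?_⟩
    have hlim : Tendsto (fun h : ℝ => ∫ x, T ((g x - s) / h) * vdiv φ x) (𝓝[>] 0) (𝓝 (J * X)) := by
      rw [hX, ← integral_indicator hm, ← integral_const_mul]
      refine tendsto_integral_filter_of_dominated_convergence (fun x => ‖vdiv φ x‖) ?_ ?_ hvi.norm ?_
      · refine Eventually.of_forall fun h => ?_
        exact ((Tc.continuous.comp ((hg.continuous.sub continuous_const).div_const h)).mul
          (vdiv_continuous hφ.cd)).aestronglyMeasurable
      · refine Eventually.of_forall fun h => Eventually.of_forall fun x => ?_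
        rw [norm_mul]
        have := Tb ((g x - s) / h)
        exact mul_le_of_le_one_left (norm_nonneg _) this
      · refine Eventually.of_forall fun x => ?_
        refine tendsto_const_nhds.congr' ?_
        by_cases hx : s < g x
        · filter_upwards [self_mem_nhdsWithin, mem_nhdsWithin_of_mem_nhds
            (eventually_lt_nhds (show (0:ℝ) < g x - s by linarith))] with h hh hh2
          rw [indicator_of_mem (show x ∈ {x | s < g x} from hx), T1]
          rw [le_div_iff₀ hh]; linarith
        · filter_upwards [self_mem_nhdsWithin] with h hh
          rw [indicator_of_notMem (show x ∉ {x | s < g x} from hx), T0]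
          · simp
          · exact div_nonpos_of_nonpos_of_nonneg (by linarith) (le_of_lt hh)
    refine le_of_tendsto_of_tendsto hlim (deriv_right hd) ?_
    filter_upwards [self_mem_nhdsWithin] with h hh
    exact ramp_test hg hc hφ Tc d0 d1 dl dr s hh
  by_contra! hlt
  obtain ⟨J, a1, a2, a3⟩ := key (1/4) (by norm_num) (by norm_num)
  have hX0 : 0 < X := by
    by_contra! h
    nlinarith
  have hd0 : 0 < d := by nlinarith
  obtain ⟨J', b1, b2, b3⟩ := key ((X - d)/(4*X)) (div_pos (by linarith) (by linarith))
    (by rw [div_lt_iff₀ (by linarith)]; linarith)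
  have h1 := mul_le_mul_of_nonneg_right b1 hX0.le
  have h2 : (1 - 2 * ((X - d)/(4*X))) * X = X - (X - d)/2 := by field_simp; ring
  linarith
end
end
end

section
open MeasureTheory Metric Filter Set
open scoped ENNReal Topology NNReal

noncomputable section

section
variable {n : ℕ} {Ω : Set (ES n)} {μ : Measure (ES n)} {K C : ℝ}

lemma smooth_level {g : ES n → ℝ} (hg : ContDiff ℝ (⊤ : ℕ∞) g) (hc : HasCompactSupport g) {s : ℝ}
    (hs : 0 < s) (hreg : ∀ x, g x = s → fderiv ℝ g x ≠ 0) : IsSmoothSet {x | s < g x} := by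
  have ho : IsOpen {x | s < g x} := isOpen_lt continuous_const hg.continuous
  have hfr : frontier {x | s < g x} = {x | s - g x = 0} := by
    apply Set.Subset.antisymm
    · intro x hx
      have := frontier_lt_subset_eq continuous_const hg.continuous hx
      have h2 : s = g x := this
      show s - g x = 0
      linarith
    · intro x hx
      have hx : s - g x = 0 := hx
      rw [ho.frontier_eq]
      refine ⟨?_, fun h => ?_⟩
      · by_contra hcl
        have hev : ∀ᶠ y in 𝓝 x, y ∉ {x | s < g x} := by
          filter_upwards [isClosed_closure.isOpen_compl.mem_nhds hcl] with y hy hy2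
          exact hy (subset_closure hy2)
        have hmax : IsLocalMax g x := hev.mono fun y hy => by
          have : ¬ (s < g y) := hy
          linarith
        exact hreg x (by linarith) hmax.fderiv_eq_zero
      · have : s < g x := h
        linarith
  refine ⟨ho, ?_, fun x => s - g x, contDiff_const.sub hg, ?_, hfr, ?_⟩
  · refine hc.isCompact.isBounded.subset fun x hx => subset_tsupport _ ?_
    have : s < g x := hx
    rw [Function.mem_support]; linarith
  · ext x
    show s < g x ↔ s - g x < 0
    rw [sub_neg]
  · intro x hx
    rw [hfr] at hx
    have hx : s - g x = 0 := hx
    rw [fderiv_const_sub, neg_ne_zero]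
    exact hreg x (by linarith)

lemma exists_E (hn : 2 ≤ n) (hb : Bornology.IsBounded Ω) (hm : MeasurableSet Ω)
    (hP : perimeter Ω ≠ ⊤) (hS : μH[(n:ℝ)-1] (frontier Ω ∩ densityPts Ω 1) = 0) {η : ℝ} (hη : 0 < η)
    (hη8 : η < 1/8) :
    ∃ E : Set (ES n), IsSmoothSet E ∧ CpctContained E Ω ∧
      volume ((E \ Ω) ∪ (Ω \ E)) ≤ ENNReal.ofReal η ∧
      perimeter E ≤ ENNReal.ofReal (((perimeter Ω).toReal + 2 * η ^ 2) / (1 - 4 * η) + η) := by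
  have hη2 : 0 < η ^ 2 := by positivity
  have hηη : η ^ 2 < η := by nlinarith
  obtain ⟨w, w1, w2, w3, w4, w5, w6, w7⟩ := exists_w hn hb hm hP hS hη2
  obtain ⟨g, g1, g2, g3, g4, g5, g6⟩ := exists_g w1 w2 hη2
  set D := g '' {x | η ^ 2 < g x ∧ fderiv ℝ g x = 0} with hD
  have hDc : D.Countable := g6.image g
  set c := ((perimeter Ω).toReal + 2 * η ^ 2) / (1 - 4 * η) + η with hcd
  have hex : ∃ s ∈ Ioo (2 * η) (1 - 2 * η), s ∉ D ∧ DifferentiableAt ℝ (GG g) s ∧ deriv (GG g) s < c := by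
    by_contra! hcon
    have h1 := mono_growth' (GG_mono g1 g2) hDc (show 2 * η ≤ 1 - 2 * η by linarith) hcon
    have h2 := GG_le g1 g2 (show 2 * η ≤ 1 - 2 * η by linarith)
    have h4 : (0:ℝ) < 1 - 4 * η := by linarith
    have h3 : c * (1 - 2 * η - 2 * η) = (perimeter Ω).toReal + 2 * η ^ 2 + η * (1 - 4 * η) := by
      rw [hcd, show 1 - 2 * η - 2 * η = 1 - 4 * η by ring, add_mul, div_mul_cancel₀ _ h4.ne']
    have h5 : 0 < η * (1 - 4 * η) := by positivity
    linarith
  obtain ⟨s, ⟨s1, s2⟩, sD, sd, sc⟩ := hex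
  have hsub : closure {x | s < g x} ⊆ tsupport w := by
    intro x hx
    have h1 : s ≤ g x := closure_lt_subset_le continuous_const g1.continuous hx
    have h2 := (abs_le.1 (g5 x)).2
    refine subset_tsupport _ ?_
    rw [Function.mem_support]; linarith
  refine ⟨{x | s < g x}, smooth_level g1 g2 (by linarith) fun x hx h0 => ?_,
    ⟨w2.isCompact.of_isClosed_subset isClosed_closure hsub,
      (hsub.trans w3).trans interior_subset⟩, ?_, ?_⟩
  · exact sD ⟨x, ⟨by linarith, h0⟩, hx⟩
  · have hchi := chi_integrable hb hm
    have iw := w1.continuous.integrable_of_hasCompactSupport (μ := volume) w2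
    have ig := g1.continuous.integrable_of_hasCompactSupport (μ := volume) g2
    have i3 : Integrable fun y => |g y - chi Ω y| := (ig.sub hchi).abs
    have i1 : Integrable fun y => |g y - w y| := (ig.sub iw).abs
    have i2 : Integrable fun y => |w y - chi Ω y| := (iw.sub hchi).abs
    have h1 := integral_mono i3 (i1.add i2) fun y => abs_sub_le _ (w y) _
    simp only [Pi.add_apply] at h1
    rw [integral_add i1 i2] at h1
    have h2 := mul_meas_ge_le_integral_of_nonneg (Eventually.of_forall fun y => abs_nonneg _) i3 (2 * η)
    have hfin : volume {x | 2 * η ≤ |g x - chi Ω x|} ≠ ⊤ :=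
      (i3.measure_ge_lt_top (by linarith)).ne
    have h3 : volume.real {x | 2 * η ≤ |g x - chi Ω x|} ≤ η := by
      have : 2 * η * volume.real {x | 2 * η ≤ |g x - chi Ω x|} ≤ 2 * η * η := by nlinarith
      exact le_of_mul_le_mul_left this (by linarith)
    have h4 : (({x | s < g x} \ Ω) ∪ (Ω \ {x | s < g x})) ⊆ {x | 2 * η ≤ |g x - chi Ω x|} := by
      rintro x (⟨hx, hx2⟩ | ⟨hx, hx2⟩)
      · have hx : s < g x := hx
        show 2 * η ≤ |g x - chi Ω x|
        have : chi Ω x = 0 := by simp [chi, hx2]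
        rw [this, sub_zero]
        exact le_trans (by linarith) (le_abs_self _)
      · have hx2 : ¬ s < g x := hx2
        show 2 * η ≤ |g x - chi Ω x|
        have : chi Ω x = 1 := by simp [chi, hx]
        rw [this]
        exact le_trans (by linarith) (neg_le_abs _)
    refine (measure_mono h4).trans ?_
    rw [← ENNReal.ofReal_toReal hfin]
    exact ENNReal.ofReal_le_ofReal h3
  · exact (per_level g1 g2 sd.hasDerivAt).trans (ENNReal.ofReal_le_ofReal sc.le)

lemma forward (hn : 2 ≤ n) (hb : Bornology.IsBounded Ω) (hm : MeasurableSet Ω)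
    (hP : perimeter Ω ≠ ⊤) (hS : μH[(n:ℝ)-1] (frontier Ω ∩ densityPts Ω 1) = 0) :
    ∃ E : ℕ → Set (ES n), (∀ k, IsSmoothSet (E k)) ∧ (∀ k, CpctContained (E k) Ω) ∧
        TendstoL1 E Ω ∧ Tendsto (fun k => perimeter (E k)) atTop (𝓝 (perimeter Ω)) := by
  set η : ℕ → ℝ := fun k => 1 / ((k + 8 : ℕ) + 1 : ℝ) with hη
  have η0 : ∀ k, 0 < η k := fun k => by simp only [hη]; positivity
  have η8 : ∀ k, η k < 1/8 := fun k => by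
    simp only [hη]
    rw [div_lt_div_iff₀ (by positivity) (by norm_num)]
    push_cast
    have : (0:ℝ) ≤ k := by positivity
    linarith
  have ηt : Tendsto η atTop (𝓝 0) :=
    (tendsto_one_div_add_atTop_nhds_zero_nat (𝕜 := ℝ)).comp (tendsto_add_atTop_nat 8)
  choose E e1 e2 e3 e4 using fun k => exists_E hn hb hm hP hS (η0 k) (η8 k)
  have hL : TendstoL1 E Ω := by
    refine tendsto_of_tendsto_of_tendsto_of_le_of_le tendsto_const_nhds ?_ (fun _ => zero_le) e3
    have := ENNReal.tendsto_ofReal ηt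
    simpa using this
  refine ⟨E, e1, e2, hL, ?_⟩
  have hup : Tendsto (fun k => ENNReal.ofReal (((perimeter Ω).toReal + 2 * η k ^ 2) / (1 - 4 * η k) + η k))
      atTop (𝓝 (perimeter Ω)) := by
    have h1 : Tendsto (fun k => ((perimeter Ω).toReal + 2 * η k ^ 2) / (1 - 4 * η k) + η k) atTop
        (𝓝 (((perimeter Ω).toReal + 2 * 0 ^ 2) / (1 - 4 * 0) + 0)) :=
      (((ηt.pow 2).const_mul 2).const_add _ |>.div ((ηt.const_mul 4).const_sub 1) (by norm_num)).add ηt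
    have h2 := ENNReal.tendsto_ofReal h1
    simpa [ENNReal.ofReal_toReal hP] using h2
  refine tendsto_order.2 ⟨fun a ha => ?_, fun a ha => ?_⟩
  · have hat : a ≠ ⊤ := (ha.trans_le le_top).ne
    have hlt : a.toReal < (perimeter Ω).toReal := (ENNReal.toReal_lt_toReal hat hP).2 ha
    obtain ⟨φ, hφ, hφ2⟩ := exists_adm Ω (sub_pos.2 hlt)
    have ht := l1_int hm (fun k => (e1 k).1.measurableSet) hL (vdiv_integrable hφ.cd hφ.cs)
    filter_upwards [ht.eventually_const_lt (show a.toReal < _ by linarith)] with k hk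
    have hPk : perimeter (E k) ≠ ⊤ := ne_top_of_le_ne_top ENNReal.ofReal_ne_top (e4 k)
    rw [← ENNReal.toReal_lt_toReal hat hPk]
    exact hk.trans_le (hφ.le_per hPk)
  · filter_upwards [hup.eventually_lt_const ha] with k hk
    exact (e4 k).trans_lt hk
end
end
end

/-- For a bounded set of finite perimeter `Ω ⊆ ℝⁿ` (`n ≥ 2`),
`H^{n-1}(∂Ω ∩ Ω¹) = 0` iff there are smooth bounded open sets `E k ⋐ Ω` with `E k → Ω` in `L¹`
and `P(E k) → P(Ω)`. -/
theorem smooth_interior_approx_iff (n : ℕ) (hn : 2 ≤ n)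
    (Ω : Set (EuclideanSpace ℝ (Fin n)))
    (hb : Bornology.IsBounded Ω) (hm : MeasurableSet Ω) (hper : perimeter Ω ≠ ⊤) :
    μH[(n : ℝ) - 1] (frontier Ω ∩ densityPts Ω 1) = 0 ↔
      ∃ E : ℕ → Set (EuclideanSpace ℝ (Fin n)),
        (∀ k, IsSmoothSet (E k)) ∧
        (∀ k, CpctContained (E k) Ω) ∧
        TendstoL1 E Ω ∧
        Tendsto (fun k => perimeter (E k)) atTop (𝓝 (perimeter Ω)) := by
  constructor
  · exact fun h => forward hn hb hm hper h
  · rintro ⟨E, h1, h2, h3, h4⟩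
    exact backward hn hb hm hper h1 h2 h3 h4
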